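/- Let n = 4. A glueing datum of dimension n consists of: a finite nonempty index set I (indexing copies Δ_i of the standard n-simplex, realized as {x : {0,…,n} → [0,∞) | Σ_v x_v = 1}, with vertices labeled 0,…,n); a fixed-point-free involution P of the set I × {0,…,n} of codimension-1 faces, where (i,k) denotes the face {x ∈ Δ_i | x_k = 0}; and, for each face (i,k) with P(i,k) = (j,l), a bijection φ_{(i,k)} : {0,…,n}∖{k} → {0,…,n}∖{l}, subject to φ_{(j,l)} = φ_{(i,k)}⁻¹. Let X be the quotient of the disjoint union of the Δ_i by the identifications which, for each (i,k) with P(i,k) = (j,l), identify each point x of the face (i,k) with the point y of the face (j,l) given by y_{φ_{(i,k)}(a)} = x_a for a ≠ k and y_l = 0, with the quotient topology. Define: condition Dir — there exist relations o_i on {0,…,4} such that for all a ≠ b exactly one of o_i(a,b), o_i(b,a) holds, and for every face (i,k) with P(i,k) = (j,l) and all a,b ∈ {0,…,4}∖{k} with a ≠ b one has o_i(a,b) ↔ o_j(φ_{(i,k)}(a), φ_{(i,k)}(b)); condition Surf — for each i ∈ I and each 2-element subset {a,b} of {0,…,4}, take a copy T_i(a,b) of the standard 2-simplex with its three vertices labeled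 by the three elements of {0,…,4}∖{a,b}; each face (i,k) with P(i,k) = (j,l) and φ = φ_{(i,k)} induces, for every 2-element subset {a,b} of {0,…,4}∖{k}, the affine identification of the edge of T_i(a,b) with endpoints labeled by the two elements c,d of {0,…,4}∖{k,a,b} with the edge of T_j(φ(a),φ(b)) with endpoints labeled φ(c), φ(d), matching c to φ(c) and d to φ(d); letting Σ be the quotient of the disjoint union of all the T_i(a,b) by these identifications, every connected component of Σ is homeomorphic to the 2-sphere S² (the unit sphere in ℝ³). Then conditions Dir and Surf jointly hold if and only if for every i ∈ I and every 2-element subset {a,b} of {0,…,4}, the image in X of the midpoint of the corresponding edge of Δ_i (the point x with x_a = x_b = 1/2 and all other coordinates 0) has an open neighborhood in X homeomorphic to ℝ⁴. -/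

import Mathlib

open scoped Classical

noncomputable section

/-- A glueing datum of dimension `n`: a finite nonempty set `I` indexing copies of the
standard `n`-simplex, a fixed-point-free involution `P` of the set `I × Fin (n+1)` of
codimension-1 faces (the face `(i,k)` of the `i`-th simplex being opposite to the vertex
`k`), and for each face `(i,k)` with `P (i,k) = (j,l)` a simplicial identification,
encoded as a permutation `glue (i,k)` of the vertex labels sending `k` to `l` (its
restriction to `{0,…,n} \ {k}` is the bijection `φ_{(i,k)}` onto `{0,…,n} \ {l}`),
subject to `φ_{P f} = (φ f)⁻¹`. -/
structure GlueingDatum (n : ℕ) where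
  I : Type
  fintypeI : Fintype I
  nonemptyI : Nonempty I
  P : I × Fin (n + 1) → I × Fin (n + 1)
  P_involutive : ∀ f, P (P f) = f
  P_fixedPointFree : ∀ f, P f ≠ f
  glue : I × Fin (n + 1) → Equiv.Perm (Fin (n + 1))
  glue_face : ∀ f, glue f f.2 = (P f).2
  glue_symm : ∀ f, glue (P f) = (glue f).symm

/-- The permutation of `Fin n` obtained from a permutation `e` of `Fin (n+1)` by
deleting `k` from the source and `e k` from the target, conjugating by the
order-preserving bijections `{0,…,n} \ {k} ≃ {1,…,n}` and `{0,…,n} \ {e k} ≃ {1,…,n}`. -/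
def restrictPerm {n : ℕ} (e : Equiv.Perm (Fin (n + 1))) (k : Fin (n + 1)) :
    Equiv.Perm (Fin n) :=
  (finSuccAboveEquiv k).trans
    ((e.subtypeEquiv (fun _ => (not_congr e.apply_eq_iff_eq).symm)).trans
      (finSuccAboveEquiv (e k)).symm)

/-- The signature of the face-pairing `e` at the face opposite to `k`. -/
def glueSign {n : ℕ} (e : Equiv.Perm (Fin (n + 1))) (k : Fin (n + 1)) : ℤˣ :=
  Equiv.Perm.sign (restrictPerm e k)

/-- Condition Ori: the simplices can be given signs so that every face-pairing
reverses the induced orientation. -/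
def Ori {n : ℕ} (D : GlueingDatum n) : Prop :=
  ∃ ε : D.I → ℤˣ, ∀ (i : D.I) (k : Fin (n + 1)),
    ε i * (-1) ^ (k : ℕ) * glueSign (D.glue (i, k)) k
      = -(ε (D.P (i, k)).1 * (-1) ^ (((D.P (i, k)).2 : Fin (n + 1)) : ℕ))

/-- Condition Dir: the edges of the simplices can be directed compatibly with all the
face-pairings. -/
def Dir {n : ℕ} (D : GlueingDatum n) : Prop :=
  ∃ o : D.I → Fin (n + 1) → Fin (n + 1) → Prop,
    (∀ i a b, a ≠ b → Xor' (o i a b) (o i b a)) ∧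
    (∀ (i : D.I) (k a b : Fin (n + 1)), a ≠ k → b ≠ k → a ≠ b →
      (o i a b ↔ o (D.P (i, k)).1 (D.glue (i, k) a) (D.glue (i, k) b)))

/-- The standard `n`-simplex, in barycentric coordinates. -/
abbrev Delta (n : ℕ) : Type :=
  {x : Fin (n + 1) → ℝ // (∀ v, 0 ≤ x v) ∧ ∑ v, x v = 1}

/-- The disjoint union of the simplices `Δ_i`, `i ∈ I`. -/
abbrev GlueTotal {n : ℕ} (D : GlueingDatum n) : Type := Σ _ : D.I, Delta n

/-- The identifications: for each face `(i,k)` with `P (i,k) = (j,l)`, every point `x`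
of the face `(i,k)` (i.e. with `x k = 0`) is identified with the point `y = x ∘ φ⁻¹` of
the face `(j,l)`, which satisfies `y (φ a) = x a` for `a ≠ k` and `y l = 0`. -/
def glueRel {n : ℕ} (D : GlueingDatum n) : GlueTotal D → GlueTotal D → Prop :=
  fun p q => ∃ k : Fin (n + 1), p.2.1 k = 0 ∧ (D.P (p.1, k)).1 = q.1 ∧
    (q.2.1 : Fin (n + 1) → ℝ) = p.2.1 ∘ ⇑(D.glue (p.1, k)).symm

/-- The glued space `X = S/P`, with the quotient topology. -/
abbrev GlueSpace {n : ℕ} (D : GlueingDatum n) : Type := Quot (glueRel D)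

/-- The image in `X` of the vertices of the simplices. -/
def vertexImage {n : ℕ} (D : GlueingDatum n) : Set (GlueSpace D) :=
  {z | ∃ p : GlueTotal D, (∃ v, p.2.1 v = 1) ∧ Quot.mk (glueRel D) p = z}

/-- The space `X* = X ∖ {vertices}`, with the subspace topology. -/
abbrev GlueSpaceStar {n : ℕ} (D : GlueingDatum n) : Type := ↥((vertexImage D)ᶜ)

/-- Local euclideanness: every point has an open neighborhood homeomorphic to `ℝⁿ`. -/
def LocEuclidean (n : ℕ) (Z : Type) [TopologicalSpace Z] : Prop :=
  ∀ z : Z, ∃ U : Set Z, IsOpen U ∧ z ∈ U ∧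
    Nonempty (↥U ≃ₜ EuclideanSpace ℝ (Fin n))

/-- The triangle `T_i(a,b)` (for `s = {a,b}`), realized in barycentric coordinates on
`Fin 5` supported on the complement of `s`: its three vertices are labeled by the three
elements of `{0,…,4} \ s`. -/
abbrev LabTri (s : Finset (Fin 5)) : Type :=
  {x : Fin 5 → ℝ // (∀ v, 0 ≤ x v) ∧ (∑ v, x v = 1) ∧ ∀ v ∈ s, x v = 0}

/-- The disjoint union of the triangles `T_i(a,b)` over all `i ∈ I` and all 2-element
subsets `{a,b}` of `{0,…,4}`. -/
abbrev SurfTotal (D : GlueingDatum 4) : Type :=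
  Σ p : D.I × {s : Finset (Fin 5) // s.card = 2}, LabTri p.2.1

/-- The edge identifications induced by the face-pairings: for a face `(i,k)` with
`P (i,k) = (j,l)` and `φ = φ_{(i,k)}`, and a 2-element subset `s ⊆ {0,…,4} \ {k}`, the
edge of `T_i(s)` with endpoints labeled by the two elements of `{0,…,4} \ (s ∪ {k})`
(i.e. the points with `x k = 0`) is identified with the corresponding edge of
`T_j(φ(s))` by `y = x ∘ φ⁻¹`, which matches each endpoint label `c` with `φ(c)`. -/
def surfRel (D : GlueingDatum 4) : SurfTotal D → SurfTotal D → Prop := fun p q =>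
  ∃ k : Fin 5, k ∉ p.1.2.1 ∧ p.2.1 k = 0 ∧
    (D.P (p.1.1, k)).1 = q.1.1 ∧
    q.1.2.1 = p.1.2.1.image (⇑(D.glue (p.1.1, k))) ∧
    (q.2.1 : Fin 5 → ℝ) = p.2.1 ∘ ⇑(D.glue (p.1.1, k)).symm

/-- The closed surface `Σ(S,P)` associated to the glueing datum, with the quotient
topology. -/
abbrev SurfSpace (D : GlueingDatum 4) : Type := Quot (surfRel D)

/-- Condition Surf: every connected component of the surface `Σ(S,P)` is homeomorphic
to the 2-sphere (the unit sphere in ℝ³). -/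
def Surf (D : GlueingDatum 4) : Prop :=
  ∀ z : SurfSpace D,
    Nonempty (↥(connectedComponent z) ≃ₜ
      ↥(Metric.sphere (0 : EuclideanSpace ℝ (Fin 3)) 1))

/-- The midpoint of the edge of the standard 4-simplex spanned by the two vertices in
`s`: the point with coordinates `1/2` on `s` and `0` elsewhere. -/
def edgeMidpoint (s : Finset (Fin 5)) (hs : s.card = 2) : Delta 4 :=
  ⟨fun v => if v ∈ s then (1 / 2 : ℝ) else 0, by
    constructor
    · intro v
      dsimp only
      split <;> norm_num
    · simp [Finset.sum_ite_mem, hs]⟩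

section
/-- Alexander–Spanier style 1-cocycle on `O`. -/
def IsAS {X : Type*} [TopologicalSpace X] (w : X → X → ZMod 2) (O : Set X) : Prop :=
  ∀ x ∈ O, ∃ V ∈ nhds x, ∃ h : X → ZMod 2, ∀ y ∈ V, ∀ z ∈ V, w y z = h y + h z

def hol {X : Type*} (w : X → X → ZMod 2) (γ : ℝ → X) (n : ℕ) : ZMod 2 :=
  ∑ i ∈ Finset.range n, w (γ ((i : ℝ) / n)) (γ (((i + 1 : ℕ) : ℝ) / n))

def vdot {m : ℕ} (x y : Fin m → ℝ) : ℝ := ∑ i, x i * y i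

def signW {X : Type*} {m : ℕ} (c : X → Fin m → ℝ) (x y : X) : ZMod 2 :=
  if vdot (c x) (c y) < 0 then 1 else 0

theorem leb_lemma {X : Type*} [PseudoMetricSpace X] {K : Set X} (hK : IsCompact K)
    (Q : Set X → Prop) (hQ : ∀ s t, s ⊆ t → Q t → Q s)
    (h : ∀ x ∈ K, ∃ V ∈ nhdsWithin x K, Q V) :
    ∃ δ > 0, ∀ s ⊆ K, s.Nonempty → (∀ x ∈ s, ∀ y ∈ s, dist x y < δ) → Q s := by
  choose! V hV hQV using h
  have h2 : ∀ x ∈ K, ∃ W, IsOpen W ∧ x ∈ W ∧ W ∩ K ⊆ V x := fun x hx =>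
    mem_nhdsWithin.1 (hV x hx)
  choose! W hWo hxW hWV using h2
  obtain ⟨δ, hδ, h3⟩ := lebesgue_number_lemma_of_metric (c := fun x : K => W x.1) hK
    (fun i => hWo i i.2) (fun x hx => Set.mem_iUnion.2 ⟨⟨x, hx⟩, hxW x hx⟩)
  refine ⟨δ, hδ, fun s hs ⟨x, hx⟩ hd => ?_⟩
  · obtain ⟨i, hi⟩ := h3 x (hs hx)
    exact hQ _ _ (fun y hy => hWV i i.2 ⟨hi (hd y hy x hx), hs hy⟩) (hQV i i.2)

theorem vdot_self_pos {m : ℕ} {x : Fin m → ℝ} (hx : x ≠ 0) : 0 < vdot x x := by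
  unfold vdot
  obtain ⟨i, hi⟩ : ∃ i, x i ≠ 0 := by
    by_contra! h
    exact hx (funext h)
  exact Finset.sum_pos' (fun i _ => mul_self_nonneg _) ⟨i, Finset.mem_univ _, mul_self_pos.2 hi⟩

theorem vdot_cs {m : ℕ} (x y : Fin m → ℝ) : (vdot x y) ^ 2 ≤ vdot x x * vdot y y := by
  have := Finset.sum_mul_sq_le_sq_mul_sq Finset.univ x y
  simpa [vdot, sq] using this

theorem vdot_sign {m : ℕ} (p y z : Fin m → ℝ) (hp : 0 < vdot p p)
    (hy : vdot p p * vdot y y < 2 * (vdot p y) ^ 2)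
    (hz : vdot p p * vdot z z < 2 * (vdot p z) ^ 2) :
    (0 < vdot p y * vdot p z → 0 < vdot y z) ∧ (vdot p y * vdot p z < 0 → vdot y z < 0) := by
  have key : ∀ (c d e f : ℝ) (u v : Fin m → ℝ), vdot (fun i => c * u i - d * p i) (fun i => e * v i - f * p i)
      = c * e * vdot u v - c * f * vdot p u - d * e * vdot p v + d * f * vdot p p := by
    intro c d e f u v
    simp only [vdot, Finset.mul_sum, ← Finset.sum_sub_distrib, ← Finset.sum_add_distrib]
    exact Finset.sum_congr rfl fun i _ => by ring
  have h := vdot_cs (fun i => vdot p p * y i - vdot p y * p i) (fun i => vdot p p * z i - vdot p z * p i)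
  rw [key, key, key] at h
  set a := vdot p y
  set b := vdot p z
  set P := vdot p p
  set Y := vdot y y
  set Z := vdot z z
  set t := vdot y z
  have hY : 0 ≤ Y := Finset.sum_nonneg fun i _ => mul_self_nonneg _
  have hZ : 0 ≤ Z := Finset.sum_nonneg fun i _ => mul_self_nonneg _
  have h1 : P ^ 2 * (P * t - a * b) ^ 2 ≤ P ^ 2 * ((P * Y - a ^ 2) * (P * Z - b ^ 2)) := by
    nlinarith [h]
  have h2 : (P * t - a * b) ^ 2 ≤ (P * Y - a ^ 2) * (P * Z - b ^ 2) :=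
    le_of_mul_le_mul_left h1 (by positivity)
  have ha : P * Y - a ^ 2 < a ^ 2 := by linarith
  have hb : P * Z - b ^ 2 < b ^ 2 := by linarith
  have hb0 : 0 ≤ P * Z - b ^ 2 := by have := vdot_cs p z; simp only [P, Z, b]; linarith
  have ha0 : 0 ≤ P * Y - a ^ 2 := by have := vdot_cs p y; simp only [P, Y, a]; linarith
  have h3 : (P * t - a * b) ^ 2 < (a * b) ^ 2 := by
    calc _ ≤ _ := h2
      _ < a ^ 2 * b ^ 2 := by nlinarith
      _ = _ := by ring
  have h4 := sq_lt_sq.1 h3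
  constructor
  · intro hab
    rw [abs_of_pos hab, abs_lt] at h4
    by_contra ht
    push Not at ht
    nlinarith [h4.1]
  · intro hab
    rw [abs_of_neg hab, abs_lt] at h4
    by_contra ht
    push Not at ht
    nlinarith [h4.1]

theorem signW_isAS {X : Type*} [TopologicalSpace X] {m : ℕ} (c : X → Fin m → ℝ) {O : Set X}
    (hO : IsOpen O) (hc : ∀ i j, ContinuousOn (fun x => c x i * c x j) O)
    (h0 : ∀ x ∈ O, c x ≠ 0) : IsAS (signW c) O := by
  intro x hx
  let p := c x
  have hp : 0 < vdot p p := vdot_self_pos (h0 x hx)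
  have hV : {y | vdot p p * vdot (c y) (c y) < 2 * (vdot p (c y)) ^ 2} ∈ nhds x := by
    have e1 : ContinuousAt (fun y => vdot p p * vdot (c y) (c y)) x := by
      unfold vdot
      refine ContinuousAt.mul continuousAt_const ?_
      exact tendsto_finsetSum _ fun i _ => (hc i i).continuousAt (hO.mem_nhds hx)
    have e2 : ContinuousAt (fun y => 2 * (vdot p (c y)) ^ 2) x := by
      have : (fun y => 2 * (vdot p (c y)) ^ 2) = fun y => 2 * ∑ i, ∑ j, (p i * p j) * (c y i * c y j) := by
        funext y
        rw [sq, vdot, Finset.sum_mul_sum]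
        congr 1
        exact Finset.sum_congr rfl fun i _ => Finset.sum_congr rfl fun j _ => by ring
      rw [this]
      refine ContinuousAt.mul continuousAt_const ?_
      exact tendsto_finsetSum _ fun i _ => tendsto_finsetSum _ fun j _ =>
        ContinuousAt.mul continuousAt_const ((hc i j).continuousAt (hO.mem_nhds hx))
    refine e1.eventually_lt e2 ?_
    change vdot p p * vdot p p < 2 * (vdot p p) ^ 2
    nlinarith
  refine ⟨_, hV, fun y => if vdot p (c y) < 0 then 1 else 0, ?_⟩
  intro y hy z hz
  simp only [Set.mem_ofPred_eq] at hy hz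
  have h := vdot_sign p (c y) (c z) hp hy hz
  have nn : ∀ y : Fin m → ℝ, 0 ≤ vdot y y := fun y => Finset.sum_nonneg fun i _ => mul_self_nonneg _
  have hy0 : vdot p (c y) ≠ 0 := by
    intro h0; rw [h0] at hy; have := nn (c y); nlinarith [mul_nonneg hp.le this]
  have hz0 : vdot p (c z) ≠ 0 := by
    intro h0; rw [h0] at hz; have := nn (c z); nlinarith [mul_nonneg hp.le this]
  unfold signW
  rcases lt_or_gt_of_ne hy0 with h1 | h1 <;> rcases lt_or_gt_of_ne hz0 with h2 | h2
  · have := h.1 (mul_pos_of_neg_of_neg h1 h2)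
    simp [h1, h2, this.le, not_lt.2]; decide
  · have := h.2 (mul_neg_of_neg_of_pos h1 h2)
    simp [h1, this, not_lt.2 h2.le]
  · have := h.2 (mul_neg_of_pos_of_neg h1 h2)
    simp [h2, this, not_lt.2 h1.le]
  · have := h.1 (mul_pos h1 h2)
    simp [this.le, not_lt.2 h1.le, not_lt.2 h2.le, not_lt.2]

theorem grid_mem {n i : ℕ} (hn : 0 < n) (hi : i ≤ n) : (i : ℝ) / n ∈ Set.Icc (0 : ℝ) 1 := by
  have : (0 : ℝ) < n := by exact_mod_cast hn
  constructor
  · positivity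
  · rw [div_le_one this]; exact_mod_cast hi

theorem eventually_one_div_lt {δ : ℝ} (hδ : 0 < δ) : ∀ᶠ n : ℕ in Filter.atTop, 0 < n ∧ 1 / (n : ℝ) < δ := by
  filter_upwards [(tendsto_one_div_atTop_nhds_zero_nat (𝕜 := ℝ)).eventually (gt_mem_nhds hδ),
    Filter.eventually_gt_atTop 0] with n h1 h2
  exact ⟨h2, h1⟩

theorem zmod2_tel (f : ℕ → ZMod 2) (n : ℕ) : ∑ i ∈ Finset.range n, (f i + f (i + 1)) = f 0 + f n := by
  induction n with
  | zero => simp [CharTwo.add_self_eq_zero]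
  | succ n ih =>
    rw [Finset.sum_range_succ, ih]
    have := CharTwo.add_self_eq_zero (f n)
    linear_combination this

theorem hol_lift {X : Type*} {m : ℕ} (c : X → Fin m → ℝ) (γ : ℝ → X)
    (l : ℝ → Fin m → ℝ) (hl : ContinuousOn l (Set.Icc 0 1)) (hl0 : ∀ s ∈ Set.Icc (0:ℝ) 1, l s ≠ 0)
    (hlc : ∀ s ∈ Set.Icc (0:ℝ) 1, l s = c (γ s) ∨ l s = - c (γ s)) (hγ : γ 0 = γ 1)
    (hh : ∀ᶠ n in Filter.atTop, hol (signW c) γ n = 0) : l 0 = l 1 := by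
  obtain ⟨δ, hδ, hd⟩ := leb_lemma (isCompact_Icc (a := (0:ℝ)) (b := 1))
    (fun S => ∀ x ∈ S, ∀ y ∈ S, 0 < vdot (l x) (l y))
    (fun s t hst h x hx y hy => h x (hst hx) y (hst hy)) (by
      intro x hx
      have hp := vdot_self_pos (hl0 x hx)
      have hc2 : ContinuousWithinAt (fun q : ℝ × ℝ => vdot (l q.1) (l q.2)) (Set.Icc 0 1 ×ˢ Set.Icc 0 1) (x, x) := by
        unfold vdot
        refine tendsto_finsetSum _ fun i _ => ?_
        have h1 : ContinuousOn (fun q : ℝ × ℝ => l q.1 i) (Set.Icc 0 1 ×ˢ Set.Icc 0 1) :=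
          ((continuous_apply i).comp_continuousOn hl).comp continuousOn_fst (fun q hq => hq.1)
        have h2 : ContinuousOn (fun q : ℝ × ℝ => l q.2 i) (Set.Icc 0 1 ×ˢ Set.Icc 0 1) :=
          ((continuous_apply i).comp_continuousOn hl).comp continuousOn_snd (fun q hq => hq.2)
        exact (h1.mul h2) (x, x) ⟨hx, hx⟩
      have := hc2.eventually (lt_mem_nhds hp)
      rw [nhdsWithin_prod_eq] at this
      obtain ⟨p, hp1, hp2⟩ := Filter.mem_prod_same_iff.1 this
      exact ⟨_, hp1, fun x hx y hy => hp2 (Set.mk_mem_prod hx hy)⟩)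
  obtain ⟨n, hn, hn0, hn1⟩ := (hh.and (eventually_one_div_lt hδ)).exists
  have hn' : (0:ℝ) < n := by exact_mod_cast hn0
  let σ : ℝ → ZMod 2 := fun s => if l s = c (γ s) then 0 else 1
  have hw : ∀ i ∈ Finset.range n, signW c (γ ((i : ℝ) / n)) (γ (((i + 1 : ℕ) : ℝ) / n))
      = σ ((i:ℝ)/n) + σ (((i+1 : ℕ):ℝ)/n) := by
    intro i hi
    have hi := Finset.mem_range.1 hi
    have hm1 := grid_mem hn0 (show i ≤ n by omega)
    have hm2 := grid_mem hn0 (show i + 1 ≤ n by omega)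
    have hpos := hd {(i:ℝ)/n, ((i+1 : ℕ):ℝ)/n} (by
      rintro x (rfl | rfl)
      · exact hm1
      · exact hm2) ⟨_, Or.inl rfl⟩ (by
      have e : ((i+1 : ℕ):ℝ)/n - (i:ℝ)/n = 1 / n := by push_cast; ring
      have e' : (i:ℝ)/n - ((i+1 : ℕ):ℝ)/n = -(1 / n) := by push_cast; ring
      have : (0:ℝ) < 1 / n := by positivity
      rintro x (rfl | rfl) y (rfl | rfl)
      · simpa using hδ
      · rw [Real.dist_eq, e', abs_neg, abs_of_pos this]; exact hn1
      · rw [Real.dist_eq, e, abs_of_pos this]; exact hn1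
      · simpa using hδ) _ (Or.inl rfl) _ (Or.inr rfl)
    generalize (i:ℝ)/n = s at *
    generalize ((i+1 : ℕ):ℝ)/n = t at *
    have vneg : ∀ x y : Fin m → ℝ, vdot (-x) y = - vdot x y := by intro x y; simp [vdot]
    have vneg' : ∀ x y : Fin m → ℝ, vdot x (-y) = - vdot x y := by intro x y; simp [vdot]
    have ne : ∀ s ∈ Set.Icc (0:ℝ) 1, l s = - c (γ s) → l s ≠ c (γ s) := by
      intro s hs h h'
      apply hl0 s hs
      rw [h] at h'
      have : c (γ s) = 0 := by
        have := congrArg (· + c (γ s)) h'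
        simp only [neg_add_cancel] at this
        funext i
        have h3 := congrFun this i
        simp only [Pi.zero_apply, Pi.add_apply] at h3
        simp only [Pi.zero_apply]; linarith
      rw [h, this, neg_zero]
    simp only [σ, signW]
    rcases hlc s hm1 with h1 | h1 <;> rcases hlc t hm2 with h2 | h2
    · rw [h1, h2] at hpos
      simp [h1, h2, hpos.le, not_lt.2]
    · have h2' := ne t hm2 h2
      rw [h1, h2, vneg'] at hpos
      rw [if_pos (by linarith), if_pos h1, if_neg h2']; rfl
    · have h1' := ne s hm1 h1
      rw [h1, h2, vneg] at hpos
      rw [if_pos (by linarith), if_neg h1', if_pos h2]; rfl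
    · have h1' := ne s hm1 h1
      have h2' := ne t hm2 h2
      rw [h1, h2, vneg, vneg', neg_neg] at hpos
      rw [if_neg (by linarith), if_neg h1', if_neg h2']; rfl
  rw [hol, Finset.sum_congr rfl hw] at hn
  have := zmod2_tel (fun i => σ ((i:ℝ)/n)) n
  rw [this] at hn
  simp only [Nat.cast_zero, zero_div, div_self hn'.ne', σ] at hn
  have hm1 := hlc 0 (by simp)
  have hm2 := hlc 1 (by simp)
  rw [hγ] at hn hm1
  by_cases h1 : l 0 = c (γ 1) <;> by_cases h2 : l 1 = c (γ 1)
  · rw [h1, h2]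
  · rw [if_pos h1, if_neg h2] at hn; exact absurd hn (by decide)
  · rw [if_neg h1, if_pos h2] at hn; exact absurd hn (by decide)
  · rw [hm1.resolve_left h1, hm2.resolve_left h2]
end

section
def smoothAlg {m : ℕ} (K : Set (Fin m → ℝ)) : Subalgebra ℝ C(K, ℝ) where
  carrier := {φ | ∃ P : (Fin m → ℝ) → ℝ, ContDiff ℝ 1 P ∧ ∀ x : K, φ x = P x}
  mul_mem' := by
    rintro a b ⟨P, hP, hP'⟩ ⟨Q, hQ, hQ'⟩
    exact ⟨fun x => P x * Q x, hP.mul hQ, fun x => by simp [hP', hQ']⟩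
  add_mem' := by
    rintro a b ⟨P, hP, hP'⟩ ⟨Q, hQ, hQ'⟩
    exact ⟨fun x => P x + Q x, hP.add hQ, fun x => by simp [hP', hQ']⟩
  algebraMap_mem' := by
    intro r
    exact ⟨fun _ => r, contDiff_const, fun x => by simp⟩

theorem exists_smooth_approx {m : ℕ} (K : Set (Fin m → ℝ)) (hK : IsCompact K) (f : C(K, ℝ))
    {ε : ℝ} (hε : 0 < ε) : ∃ P : (Fin m → ℝ) → ℝ, ContDiff ℝ 1 P ∧ ∀ x : K, |P x - f x| < ε := by
  have : CompactSpace K := isCompact_iff_compactSpace.1 hK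
  have hsep : (smoothAlg K).SeparatesPoints := by
    intro x y hxy
    have : ∃ i, x.1 i ≠ y.1 i := by
      by_contra! h
      exact hxy (Subtype.ext (funext h))
    obtain ⟨i, hi⟩ := this
    refine ⟨_, ⟨⟨fun x : K => x.1 i, (continuous_apply i).comp continuous_subtype_val⟩, ⟨fun x => x i, contDiff_apply ℝ ℝ i, fun x => rfl⟩, rfl⟩, hi⟩
  have htop := ContinuousMap.subalgebra_topologicalClosure_eq_top_of_separatesPoints _ hsep
  have hf : f ∈ (smoothAlg K).topologicalClosure := by rw [htop]; trivial
  have hf' : f ∈ closure (smoothAlg K : Set C(K, ℝ)) := hf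
  obtain ⟨φ, ⟨P, hP, hφ⟩, hd⟩ := Metric.mem_closure_iff.1 hf' ε hε
  refine ⟨P, hP, fun x => ?_⟩
  rw [← hφ x, ← Real.dist_eq, dist_comm]
  exact (ContinuousMap.dist_lt_iff hε).1 hd x

abbrev E4 := EuclideanSpace ℝ (Fin 4)

theorem exists_avoid {m : ℕ} (g : ℝ × ℝ → Fin m → ℝ) (hg : ContDiff ℝ 1 g)
    (P : (Fin m → ℝ) → E4) (hP : ContDiff ℝ 1 P) : ∃ v : E4, ∀ x (l : ℝ), v ≠ l • P (g x) := by
  let F : (ℝ × ℝ) × ℝ → E4 := fun q => q.2 • P (g q.1)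
  have hF : ContDiff ℝ 1 F := contDiff_snd.smul (hP.comp (hg.comp contDiff_fst))
  have := hF.dense_compl_range_of_finrank_lt_finrank (by simp)
  obtain ⟨v, hv⟩ := this.nonempty
  exact ⟨v, fun x l h => hv ⟨(x, l), h.symm⟩⟩

theorem filling {R : Type*} [TopologicalSpace R] [CompactSpace R] {m : ℕ}
    (e : R → Fin m → ℝ) (he : Continuous e) (g : ℝ × ℝ → Fin m → ℝ) (hg : ContDiff ℝ 1 g)
    (heg : ∀ r, ∃ x, g x = e r) (f : R → E4) (hf : Continuous f) (hf0 : ∀ r, f r ≠ 0)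
    (hfe : ∀ r r', e r = e r' → f r = f r') :
    ∃ H : R × ℝ → E4, Continuous H ∧ (∀ r, H (r, 0) = f r) ∧ (∃ v, ∀ r, H (r, 1) = v) ∧
      (∀ r, ∀ τ ∈ Set.Icc (0:ℝ) 1, H (r, τ) ≠ 0) ∧
      (∀ r r' τ, e r = e r' → H (r, τ) = H (r', τ)) := by
  rcases isEmpty_or_nonempty R with hR | hR
  · exact ⟨fun _ => 0, continuous_const, fun r => hR.elim r, ⟨0, fun r => hR.elim r⟩, fun r => hR.elim r,
      fun r => hR.elim r⟩
  let K := Set.range e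
  have hK : IsCompact K := isCompact_range he
  let e' : R → K := fun r => ⟨e r, r, rfl⟩
  have he' : Continuous e' := by fun_prop
  have hq : Topology.IsQuotientMap e' := he'.isClosedMap.isQuotientMap he' (by
    rintro ⟨_, r, rfl⟩; exact ⟨r, rfl⟩)
  choose r₀ hr₀ using fun x : K => x.2
  let fb : K → E4 := fun x => f (r₀ x)
  have hfb : ∀ r, fb (e' r) = f r := fun r => hfe _ _ (hr₀ (e' r))
  have hfbc : Continuous fb := by
    rw [hq.continuous_iff]
    convert hf using 1
    exact funext hfb
  obtain ⟨rm, -, hrm⟩ := isCompact_univ.exists_isMinOn Set.univ_nonempty hf.norm.continuousOn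
  replace hrm : ∀ r, ‖f rm‖ ≤ ‖f r‖ := fun r => hrm (Set.mem_univ r)
  have hm : 0 < ‖f rm‖ := norm_pos_iff.2 (hf0 rm)
  choose P hP hPf using fun i : Fin 4 => exists_smooth_approx K hK ⟨fun x => fb x i, by fun_prop⟩
    (show 0 < ‖f rm‖ / 8 by positivity)
  let Q : (Fin m → ℝ) → E4 := fun x => WithLp.toLp 2 fun i => P i x
  have hQ : ContDiff ℝ 1 Q := by
    rw [contDiff_euclidean]; exact hP
  have hQf : ∀ r, ‖Q (e r) - f r‖ < ‖f rm‖ := by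
    intro r
    have h1 : ‖Q (e r) - f r‖ ^ 2 ≤ (‖f rm‖ / 2) ^ 2 := by
      rw [EuclideanSpace.norm_sq_eq]
      have h2 : ∀ i, ‖(Q (e r) - f r) i‖ ^ 2 ≤ (‖f rm‖ / 8) ^ 2 := by
        intro i
        have := (hPf i (e' r)).le
        simp only [ContinuousMap.coe_mk, hfb] at this
        exact pow_le_pow_left₀ (norm_nonneg _) this 2
      calc _ ≤ ∑ i : Fin 4, (‖f rm‖ / 8) ^ 2 := Finset.sum_le_sum fun i _ => h2 i
        _ ≤ _ := by simp; nlinarith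
    have := abs_le_of_sq_le_sq h1 (by positivity)
    rw [abs_of_nonneg (norm_nonneg _)] at this
    linarith
  obtain ⟨v, hv⟩ := exists_avoid g hg Q hQ
  let a : ℝ → ℝ := fun τ => max (1 - 2 * τ) 0
  let c : ℝ → ℝ := fun τ => max (2 * τ - 1) 0
  refine ⟨fun q => a q.2 • f q.1 + (1 - a q.2 - c q.2) • Q (e q.1) + c q.2 • v, ?_, ?_, ⟨v, ?_⟩, ?_, ?_⟩
  · have := hQ.continuous
    fun_prop
  · intro r; simp [a, c]
  · intro r; simp only [a, c]; norm_num
  · rintro r τ ⟨h0, h1⟩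
    simp only [a, c]
    have hfm := hrm r
    have hQr := hQf r
    rcases le_total τ (1/2) with h | h
    · rw [max_eq_left (by linarith), max_eq_right (by linarith)]
      intro h3
      have h4 : f r = - ((2 * τ) • (Q (e r) - f r)) := by
        rw [← sub_eq_zero, ← h3]; module
      have h5 : ‖f r‖ ≤ ‖Q (e r) - f r‖ := by
        nth_rewrite 1 [h4]
        rw [norm_neg, norm_smul, Real.norm_of_nonneg (by linarith)]
        nlinarith [norm_nonneg (Q (e r) - f r)]
      linarith
    · rw [max_eq_right (by linarith), max_eq_left (by linarith)]
      intro h3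
      have hQ0 : Q (e r) ≠ 0 := by
        intro h6; rw [h6, zero_sub, norm_neg] at hQr; linarith
      obtain ⟨x, hx⟩ := heg r
      rcases eq_or_lt_of_le h with h' | h'
      · rw [← h'] at h3
        norm_num at h3; exact hQ0 h3
      · refine hv x (-((2 - 2 * τ) / (2 * τ - 1))) ?_
        have hne : (2 * τ - 1) ≠ 0 := by linarith
        have h4 : (2 * τ - 1) • v = -(2 - 2 * τ) • Q (e r) := by
          rw [← sub_eq_zero, ← h3]; module
        rw [hx, ← neg_div, div_eq_inv_mul, mul_smul, ← h4, smul_smul, inv_mul_cancel₀ hne, one_smul]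
  · intro r r' τ h
    simp only [hfe r r' h, h]
end

section
theorem zmod2_self (a : ZMod 2) : a + a = 0 := CharTwo.add_self_eq_zero a

theorem sbp_lemma (χ h : ℕ → ZMod 2) (n : ℕ)
    (hjump : ∀ k < n, χ k ≠ χ (k + 1) → h (k + 1) = 0) :
    ∑ k ∈ Finset.range (n + 1), χ k * (h k + h (k + 1)) = χ 0 * h 0 + χ n * h (n + 1) := by
  induction n with
  | zero => simp [mul_add]
  | succ n ih =>
    rw [Finset.sum_range_succ, ih (fun k hk => hjump k (by omega))]
    have h1 : (χ n + χ (n + 1)) * h (n + 1) = 0 := by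
      by_cases h2 : χ n = χ (n + 1)
      · rw [h2, zmod2_self, zero_mul]
      · rw [hjump n (by omega) h2, mul_zero]
    linear_combination h1

theorem cube_sum (n : ℕ) (hn : 0 < n) (a b c : ℕ → ℕ → ℕ → ZMod 2) (χ : ℕ → ℕ → ℕ → ZMod 2)
    (hb : ∀ j k, b n j k = b 0 j k) (hc : ∀ j k, c n j k = c 0 j k)
    (hχ : ∀ j k, χ n j k = χ 0 j k)
    (hst : ∀ i < n, ∀ j < 2 * n, ∀ k < n, χ i j k ≠ χ i j (k+1) →
      a i j (k+1) + b (i+1) j (k+1) + a i (j+1) (k+1) + b i j (k+1) = 0)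
    (hst1 : ∀ i j, a i j n + b (i+1) j n + a i (j+1) n + b i j n = 0)
    (hsu : ∀ i < n, ∀ j < 2 * n, ∀ k < n, χ i j k ≠ χ i (j+1) k →
      a i (j+1) k + c (i+1) (j+1) k + a i (j+1) (k+1) + c i (j+1) k = 0)
    (hsu0 : ∀ i k, a i 0 k + c (i+1) 0 k + a i 0 (k+1) + c i 0 k = 0)
    (hsu1 : ∀ i k, a i (2*n) k + c (i+1) (2*n) k + a i (2*n) (k+1) + c i (2*n) k = 0)
    (htu : ∀ i < n, ∀ j < 2 * n, ∀ k < n, χ i j k ≠ χ (i+1) j k →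
      b (i+1) j k + c (i+1) (j+1) k + b (i+1) j (k+1) + c (i+1) j k = 0) :
    ∑ i ∈ Finset.range n, ∑ j ∈ Finset.range (2 * n),
      χ i j 0 * (a i j 0 + b (i+1) j 0 + a i (j+1) 0 + b i j 0) = 0 := by
  obtain ⟨m, rfl⟩ : ∃ m, n = m + 1 := ⟨n - 1, by omega⟩
  have e1 : ∀ i ∈ Finset.range (m+1), ∀ j ∈ Finset.range (2 * (m+1)),
      ∑ k ∈ Finset.range (m+1), χ i j k * ((a i j k + b (i+1) j k + a i (j+1) k + b i j k)
        + (a i j (k+1) + b (i+1) j (k+1) + a i (j+1) (k+1) + b i j (k+1)))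
      = χ i j 0 * (a i j 0 + b (i+1) j 0 + a i (j+1) 0 + b i j 0) := by
    intro i hi j hj
    rw [Finset.mem_range] at hi hj
    have := sbp_lemma (fun k => χ i j k) (fun k => a i j k + b (i+1) j k + a i (j+1) k + b i j k) m
      (fun k hk => hst i hi j hj k (by omega))
    rw [hst1, mul_zero, add_zero] at this
    exact this
  have e2 : ∀ i ∈ Finset.range (m+1), ∀ k ∈ Finset.range (m+1),
      ∑ j ∈ Finset.range (2 * (m+1)), χ i j k * ((a i j k + c (i+1) j k + a i j (k+1) + c i j k)
        + (a i (j+1) k + c (i+1) (j+1) k + a i (j+1) (k+1) + c i (j+1) k)) = 0 := by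
    intro i hi k hk
    rw [Finset.mem_range] at hi hk
    have := sbp_lemma (fun j => χ i j k) (fun j => a i j k + c (i+1) j k + a i j (k+1) + c i j k) (2 * m + 1)
      (fun j hj => hsu i hi j (by omega) k hk)
    have e : 2 * (m + 1) = 2 * m + 1 + 1 := by ring
    rw [e] at hsu1
    rw [hsu1, hsu0, mul_zero, mul_zero, add_zero] at this
    rw [e]; exact this
  have e3 : ∀ j ∈ Finset.range (2 * (m+1)), ∀ k ∈ Finset.range (m+1),
      ∑ i ∈ Finset.range (m+1), χ i j k * ((b i j k + c i (j+1) k + b i j (k+1) + c i j k)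
        + (b (i+1) j k + c (i+1) (j+1) k + b (i+1) j (k+1) + c (i+1) j k)) = 0 := by
    intro j hj k hk
    rw [Finset.mem_range] at hj hk
    have := sbp_lemma (fun i => χ i j k) (fun i => b i j k + c i (j+1) k + b i j (k+1) + c i j k) m
      (fun i hi => htu i (by omega) j hj k hk)
    rw [this]
    rw [← hχ, ← hb, ← hc, ← hb, ← hc, ← add_mul]
    by_cases h2 : χ m j k = χ (m + 1) j k
    · rw [h2, zmod2_self, zero_mul]
    · have := htu m (by omega) j hj k hk h2
      rw [this, mul_zero]
  have E1 : ∑ i ∈ Finset.range (m+1), ∑ j ∈ Finset.range (2 * (m+1)), ∑ k ∈ Finset.range (m+1),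
     (χ i j k * ((a i j k + b (i+1) j k + a i (j+1) k + b i j k)
        + (a i j (k+1) + b (i+1) j (k+1) + a i (j+1) (k+1) + b i j (k+1)))
      + χ i j k * ((a i j k + c (i+1) j k + a i j (k+1) + c i j k)
        + (a i (j+1) k + c (i+1) (j+1) k + a i (j+1) (k+1) + c i (j+1) k))
      + χ i j k * ((b i j k + c i (j+1) k + b i j (k+1) + c i j k)
        + (b (i+1) j k + c (i+1) (j+1) k + b (i+1) j (k+1) + c (i+1) j k))) = 0 := by
    refine Finset.sum_eq_zero fun i _ => Finset.sum_eq_zero fun j _ => Finset.sum_eq_zero fun k _ => ?_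
    have h2 : (2 : ZMod 2) = 0 := by decide
    linear_combination (χ i j k * (a i j k + b (i+1) j k + a i (j+1) k + b i j k + a i j (k+1) + b (i+1) j (k+1) + a i (j+1) (k+1) + b i j (k+1) + c (i+1) j k + c i j k + c (i+1) (j+1) k + c i (j+1) k)) * h2
  simp only [Finset.sum_add_distrib] at E1
  have E2 : ∑ i ∈ Finset.range (m+1), ∑ j ∈ Finset.range (2 * (m+1)), ∑ k ∈ Finset.range (m+1),
      χ i j k * ((a i j k + c (i+1) j k + a i j (k+1) + c i j k)
        + (a i (j+1) k + c (i+1) (j+1) k + a i (j+1) (k+1) + c i (j+1) k)) = 0 := by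
    refine Finset.sum_eq_zero fun i hi => ?_
    rw [Finset.sum_comm]
    exact Finset.sum_eq_zero fun k hk => e2 i hi k hk
  have E3 : ∑ i ∈ Finset.range (m+1), ∑ j ∈ Finset.range (2 * (m+1)), ∑ k ∈ Finset.range (m+1),
      χ i j k * ((b i j k + c i (j+1) k + b i j (k+1) + c i j k)
        + (b (i+1) j k + c (i+1) (j+1) k + b (i+1) j (k+1) + c (i+1) j k)) = 0 := by
    rw [Finset.sum_comm]
    refine Finset.sum_eq_zero fun j hj => ?_
    rw [Finset.sum_comm]
    exact Finset.sum_eq_zero fun k hk => e3 j hj k hk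
  rw [E2, E3, add_zero, add_zero] at E1
  rw [← E1]
  exact Finset.sum_congr rfl fun i hi => Finset.sum_congr rfl fun j hj => (e1 i hi j hj).symm

def gpt (n i j k : ℕ) : ℝ × ℝ × ℝ := ((i : ℝ) / n, (j : ℝ) / n - 1, (k : ℝ) / n)

def boxK : Set (ℝ × ℝ × ℝ) := Set.Icc 0 1 ×ˢ Set.Icc (-1) 1 ×ˢ Set.Icc 0 1

theorem boxK_compact : IsCompact boxK := isCompact_Icc.prod (isCompact_Icc.prod isCompact_Icc)

theorem gpt_mem {n i j k : ℕ} (hn : 0 < n) (hi : i ≤ n) (hj : j ≤ 2 * n) (hk : k ≤ n) :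
    gpt n i j k ∈ boxK := by
  refine ⟨grid_mem hn hi, ⟨?_, ?_⟩, grid_mem hn hk⟩
  · simp only [gpt]
    have : (0:ℝ) ≤ (j:ℝ) / n := by positivity
    linarith
  · simp only [gpt]
    have hn' : (0:ℝ) < n := by exact_mod_cast hn
    have hj' : (j:ℝ) ≤ 2 * n := by exact_mod_cast hj
    have : (j:ℝ) / n ≤ 2 := by rw [div_le_iff₀ hn']; linarith
    linarith

/-- index pairs differing by at most one -/
def nearN (i i' : ℕ) : Prop := i ≤ i' + 1 ∧ i' ≤ i + 1

theorem near_div {n i i' : ℕ} (h : nearN i i') {δ : ℝ} (hn : 0 < n) (hδ : 1 / (n:ℝ) < δ) :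
    |(i:ℝ)/n - (i':ℝ)/n| < δ := by
  have hn' : (0:ℝ) < n := by exact_mod_cast hn
  have h1 : (i:ℝ) ≤ i' + 1 := by exact_mod_cast h.1
  have h2 : (i':ℝ) ≤ i + 1 := by exact_mod_cast h.2
  rw [← sub_div, abs_div, abs_of_pos hn']
  refine lt_of_le_of_lt ?_ hδ
  gcongr
  rw [abs_le]; constructor <;> linarith

theorem gpt_dist {n : ℕ} {i j k i' j' k' : ℕ} (hn : 0 < n) {δ : ℝ} (hδ : 1 / (n:ℝ) < δ)
    (hi : nearN i i') (hj : nearN j j') (hk : nearN k k') : dist (gpt n i j k) (gpt n i' j' k') < δ := by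
  rw [Prod.dist_eq, Prod.dist_eq, max_lt_iff, max_lt_iff]
  refine ⟨near_div hi hn hδ, ?_, near_div hk hn hδ⟩
  rw [Real.dist_eq]
  simp only [gpt]
  rw [sub_sub_sub_cancel_right]
  exact near_div hj hn hδ

theorem zmod2_eq_of_ne {p q : Prop} (h : (if p then (1 : ZMod 2) else 0) ≠ if q then 1 else 0) :
    (p ∧ ¬ q) ∨ (¬ p ∧ q) := by
  by_cases hp : p <;> by_cases hq : q <;> simp_all

theorem coreB {Z : Type*} [TopologicalSpace Z] (Cp Cm : Set Z) 
    (θ : Z → ℝ) (hθ : Continuous θ) (hθp : ∀ z ∈ Cp, θ z = 1) (hθm : ∀ z ∈ Cm, θ z = 0)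
    (w : Z → Z → ZMod 2) (hw : IsAS w (Cp ∪ Cm)ᶜ) (hw0 : ∀ z, w z z = 0)
    (G : ℝ × ℝ × ℝ → Z) (hG : Continuous G)
    (hper : ∀ t u, G (0, t, u) = G (1, t, u))
    (htop : ∀ s s' u, G (s, 1, u) = G (s', 1, u))
    (hbot : ∀ s s' u, G (s, -1, u) = G (s', -1, u))
    (hend : ∀ s t s' t', G (s, t, 1) = G (s', t', 1))
    (hpos : ∀ s t, 0 ≤ t → G (s, t, 0) ∉ Cm) (hneg : ∀ s t, t ≤ 0 → G (s, t, 0) ∉ Cp) :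
    ∀ᶠ n in Filter.atTop, hol w (fun s => G (s, 0, 0)) n = 0 := by
  let R : Set (ℝ × ℝ × ℝ) := boxK ∩ ({q | 1/4 ≤ θ (G q) ∧ θ (G q) ≤ 3/4} ∪
    {q | q.2.2 = 0 ∧ 0 ≤ q.2.1 ∧ θ (G q) ≤ 3/4} ∪ {q | q.2.2 = 0 ∧ q.2.1 ≤ 0 ∧ 1/4 ≤ θ (G q)})
  have hRc : IsCompact R := by
    have hc : Continuous fun q => θ (G q) := hθ.comp hG
    have ht : Continuous fun q : ℝ × ℝ × ℝ => q.2.1 := by fun_prop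
    have hu : Continuous fun q : ℝ × ℝ × ℝ => q.2.2 := by fun_prop
    refine boxK_compact.inter_right (IsClosed.union (IsClosed.union ?_ ?_) ?_)
    · exact (isClosed_le continuous_const hc).inter (isClosed_le hc continuous_const)
    · exact (isClosed_eq hu continuous_const).inter
        ((isClosed_le continuous_const ht).inter (isClosed_le hc continuous_const))
    · exact (isClosed_eq hu continuous_const).inter
        ((isClosed_le ht continuous_const).inter (isClosed_le continuous_const hc))
  have hRgood : ∀ q ∈ R, G q ∈ (Cp ∪ Cm)ᶜ := by
    rintro ⟨s, t, u⟩ ⟨-, (⟨h1, h2⟩ | ⟨h1, h2, h3⟩) | ⟨h1, h2, h3⟩⟩ (h | h)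
    · have := hθp _ h; linarith
    · have := hθm _ h; linarith
    · have := hθp _ h; linarith
    · simp only at h1 h2; subst h1; exact hpos s t h2 h
    · simp only at h1 h2; subst h1; exact hneg s t h2 h
    · have := hθm _ h; linarith
  obtain ⟨δ₁, hδ₁, hL1⟩ := leb_lemma hRc
    (fun S => ∃ h : Z → ZMod 2, ∀ x ∈ S, ∀ y ∈ S, w (G x) (G y) = h (G x) + h (G y))
    (fun s t hst ⟨h, hh⟩ => ⟨h, fun x hx y hy => hh x (hst hx) y (hst hy)⟩) (by
      intro q hq
      obtain ⟨V, hV, h, hh⟩ := hw _ (hRgood q hq)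
      exact ⟨G ⁻¹' V, mem_nhdsWithin_of_mem_nhds (hG.continuousAt hV), h,
        fun x hx y hy => hh _ hx _ hy⟩)
  obtain ⟨δ₂, hδ₂, hL2⟩ := leb_lemma boxK_compact
    (fun S => ∀ x ∈ S, ∀ y ∈ S, θ (G x) - θ (G y) < 1/4)
    (fun s t hst hh => fun x hx y hy => hh x (hst hx) y (hst hy)) (by
      intro q hq
      have hc : Continuous fun x => θ (G x) := hθ.comp hG
      refine ⟨{x | |θ (G x) - θ (G q)| < 1/8}, mem_nhdsWithin_of_mem_nhds ?_, ?_⟩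
      · have := Metric.continuous_iff.1 hc q (1/8) (by norm_num)
        obtain ⟨ε, hε, h⟩ := this
        exact Filter.mem_of_superset (Metric.ball_mem_nhds q hε) (fun x hx => h x hx)
      · intro x hx y hy
        have h1 := abs_lt.1 (show |θ (G x) - θ (G q)| < 1/8 from hx)
        have h2 := abs_lt.1 (show |θ (G y) - θ (G q)| < 1/8 from hy)
        linarith [h1.2, h2.1])
  filter_upwards [eventually_one_div_lt hδ₁, eventually_one_div_lt hδ₂] with n hn1 hn2
  obtain ⟨hn, hn1⟩ := hn1
  have hn2 := hn2.2
  have hn' : (0:ℝ) < n := by exact_mod_cast hn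
  -- theta difference
  have hT : ∀ {i j k i' j' k'}, i ≤ n → j ≤ 2*n → k ≤ n → i' ≤ n → j' ≤ 2*n → k' ≤ n →
      nearN i i' → nearN j j' → nearN k k' → θ (G (gpt n i j k)) - θ (G (gpt n i' j' k')) < 1/4 := by
    intro i j k i' j' k' a1 a2 a3 a4 a5 a6 b1 b2 b3
    have hd := gpt_dist hn hn2 b1 b2 b3
    refine hL2 {gpt n i j k, gpt n i' j' k'} ?_ ⟨_, Or.inl rfl⟩ ?_ _ (Or.inl rfl) _ (Or.inr rfl)
    · rintro x (rfl | rfl)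
      exacts [gpt_mem hn a1 a2 a3, gpt_mem hn a4 a5 a6]
    · rintro x (rfl | rfl) y (rfl | rfl)
      · simpa using hδ₂
      · exact hd
      · rw [dist_comm]; exact hd
      · simpa using hδ₂
  have hS : ∀ {i j k i' j' k' a b c a' b' c' : ℕ},
      gpt n i j k ∈ R → gpt n i' j' k' ∈ R → gpt n a b c ∈ R → gpt n a' b' c' ∈ R →
      nearN i i' → nearN j j' → nearN k k' → nearN i a → nearN j b → nearN k c →
      nearN i a' → nearN j b' → nearN k c' → nearN i' a → nearN j' b → nearN k' c →
      nearN i' a' → nearN j' b' → nearN k' c' → nearN a a' → nearN b b' → nearN c c' →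
      w (G (gpt n i j k)) (G (gpt n i' j' k')) + w (G (gpt n i' j' k')) (G (gpt n a b c))
       + w (G (gpt n a' b' c')) (G (gpt n a b c)) + w (G (gpt n i j k)) (G (gpt n a' b' c')) = 0 := by
    intro i j k i' j' k' a b c a' b' c' r1 r2 r3 r4 x1 x2 x3 x4 x5 x6 x7 x8 x9 x10 x11 x12 x13 x14 x15 x16 x17 x18
    have d1 := gpt_dist hn hn1 x1 x2 x3
    have d2 := gpt_dist hn hn1 x4 x5 x6
    have d3 := gpt_dist hn hn1 x7 x8 x9
    have d4 := gpt_dist hn hn1 x10 x11 x12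
    have d5 := gpt_dist hn hn1 x13 x14 x15
    have d6 := gpt_dist hn hn1 x16 x17 x18
    generalize gpt n i j k = P1 at *
    generalize gpt n i' j' k' = P2 at *
    generalize gpt n a b c = P3 at *
    generalize gpt n a' b' c' = P4 at *
    have hm : ∀ x ∈ ({P1, P2, P3, P4} : Set (ℝ × ℝ × ℝ)), x = P1 ∨ x = P2 ∨ x = P3 ∨ x = P4 := by
      intro x hx; simpa using hx
    obtain ⟨h, hh⟩ := hL1 {P1, P2, P3, P4} (by
      intro x hx
      rcases hm x hx with rfl | rfl | rfl | rfl <;> assumption) ⟨P1, Or.inl rfl⟩ (by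
      intro x hx y hy
      rcases hm x hx with rfl | rfl | rfl | rfl <;> rcases hm y hy with rfl | rfl | rfl | rfl <;>
        first | (simpa using hδ₁) | assumption | (rw [dist_comm]; assumption))
    rw [hh P1 (by simp) P2 (by simp), hh P2 (by simp) P3 (by simp), hh P4 (by simp) P3 (by simp),
      hh P1 (by simp) P4 (by simp)]
    have h2 : (2 : ZMod 2) = 0 := by decide
    linear_combination (h (G P1) + h (G P2) + h (G P3) + h (G P4)) * h2
  -- membership in R when close to the 1/2 level
  have hRmid : ∀ {i j k i1 j1 k1 i2 j2 k2}, i ≤ n → j ≤ 2*n → k ≤ n → i1 ≤ n → j1 ≤ 2*n → k1 ≤ n →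
      i2 ≤ n → j2 ≤ 2*n → k2 ≤ n → nearN i i1 → nearN j j1 → nearN k k1 →
      nearN i i2 → nearN j j2 → nearN k k2 →
      ((θ (G (gpt n i1 j1 k1)) > 1/2 ∧ ¬ θ (G (gpt n i2 j2 k2)) > 1/2) ∨
      (¬ θ (G (gpt n i1 j1 k1)) > 1/2 ∧ θ (G (gpt n i2 j2 k2)) > 1/2)) → gpt n i j k ∈ R := by
    intro i j k i1 j1 k1 i2 j2 k2 a1 a2 a3 b1 b2 b3 c1 c2 c3 y1 y2 y3 z1 z2 z3 h
    have t1 := hT a1 a2 a3 b1 b2 b3 y1 y2 y3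
    have t2 := hT a1 a2 a3 c1 c2 c3 z1 z2 z3
    have t3 := hT b1 b2 b3 a1 a2 a3 y1.symm y2.symm y3.symm
    have t4 := hT c1 c2 c3 a1 a2 a3 z1.symm z2.symm z3.symm
    refine ⟨gpt_mem hn a1 a2 a3, Or.inl (Or.inl ?_)⟩
    rcases h with ⟨h1, h2⟩ | ⟨h1, h2⟩ <;> constructor <;> linarith
  let g := fun i j k => G (gpt n i j k)
  have hg0 : ∀ j k, g n j k = g 0 j k := by
    intro j k
    simp only [g, gpt, div_self hn'.ne', Nat.cast_zero, zero_div, hper]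
  have hgt : ∀ i i' k, g i (2 * n) k = g i' (2 * n) k := by
    intro i i' k
    have : ((2 * n : ℕ) : ℝ) / n - 1 = 1 := by push_cast; field_simp; norm_num
    simp only [g, gpt, this]
    exact htop _ _ _
  have hgb : ∀ i i' k, g i 0 k = g i' 0 k := by
    intro i i' k
    have : ((0 : ℕ) : ℝ) / n - 1 = -1 := by simp
    simp only [g, gpt, this]
    exact hbot _ _ _
  have hge : ∀ i j i' j', g i j n = g i' j' n := by
    intro i j i' j'
    simp only [g, gpt, div_self hn'.ne']
    exact hend _ _ _ _
  have main := cube_sum n hn (fun i j k => w (g i j k) (g (i+1) j k)) (fun i j k => w (g i j k) (g i (j+1) k))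
    (fun i j k => w (g i j k) (g i j (k+1))) (fun i j k => if θ (g i j k) > 1/2 then 1 else 0)
    (by intro j k; simp only [hg0]) (by intro j k; simp only [hg0]) (by intro j k; simp only [hg0])
    (by
      intro i hi j hj k hk hne
      have hne := zmod2_eq_of_ne hne
      refine hS ?_ ?_ ?_ ?_ ?_ ?_ ?_ ?_ ?_ ?_ ?_ ?_ ?_ ?_ ?_ ?_ ?_ ?_ ?_ ?_ ?_ ?_
      case refine_1 | refine_2 | refine_3 | refine_4 =>
        refine hRmid ?_ ?_ ?_ ?_ ?_ ?_ ?_ ?_ ?_ ?_ ?_ ?_ ?_ ?_ ?_ hne <;> (try unfold nearN) <;> omega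
      all_goals (unfold nearN; omega))
    (by
      intro i j
      rw [hge (i+1) j i j, hge (i+1) (j+1) i j, hge i (j+1) i j]
      simp [hw0])
    (by
      intro i hi j hj k hk hne
      have hne := zmod2_eq_of_ne hne
      refine hS ?_ ?_ ?_ ?_ ?_ ?_ ?_ ?_ ?_ ?_ ?_ ?_ ?_ ?_ ?_ ?_ ?_ ?_ ?_ ?_ ?_ ?_
      case refine_1 | refine_2 | refine_3 | refine_4 =>
        refine hRmid ?_ ?_ ?_ ?_ ?_ ?_ ?_ ?_ ?_ ?_ ?_ ?_ ?_ ?_ ?_ hne <;> (try unfold nearN) <;> omega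
      all_goals (unfold nearN; omega))
    (by
      intro i k
      rw [hgb (i+1) i k, hgb (i+1) i (k+1)]
      simp [hw0, zmod2_self])
    (by
      intro i k
      rw [hgt (i+1) i k, hgt (i+1) i (k+1)]
      simp [hw0, zmod2_self])
    (by
      intro i hi j hj k hk hne
      have hne := zmod2_eq_of_ne hne
      refine hS ?_ ?_ ?_ ?_ ?_ ?_ ?_ ?_ ?_ ?_ ?_ ?_ ?_ ?_ ?_ ?_ ?_ ?_ ?_ ?_ ?_ ?_
      case refine_1 | refine_2 | refine_3 | refine_4 =>
        refine hRmid ?_ ?_ ?_ ?_ ?_ ?_ ?_ ?_ ?_ ?_ ?_ ?_ ?_ ?_ ?_ hne <;> (try unfold nearN) <;> omega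
      all_goals (unfold nearN; omega))
  -- bottom
  have hlow : ∀ i < n, ∀ j < n, (if θ (g i j 0) > 1/2 then (1 : ZMod 2) else 0) *
      (w (g i j 0) (g (i+1) j 0) + w (g (i+1) j 0) (g (i+1) (j+1) 0) + w (g i (j+1) 0) (g (i+1) (j+1) 0)
        + w (g i j 0) (g i (j+1) 0)) = 0 := by
    intro i hi j hj
    split_ifs with h
    · rw [one_mul]
      have hr : ∀ i' j', i' ≤ i + 1 → i ≤ i' → j' ≤ j + 1 → j ≤ j' → gpt n i' j' 0 ∈ R := by
        intro i' j' h1 h2 h3 h4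
        refine ⟨gpt_mem hn (by omega) (by omega) (by omega), Or.inr ⟨?_, ?_, ?_⟩⟩
        · simp [gpt]
        · simp only [gpt]
          rw [sub_nonpos, div_le_one hn']
          exact_mod_cast (by omega : j' ≤ n)
        · have := hT (i := i) (j := j) (k := 0) (i' := i') (j' := j') (k' := 0) (by omega) (by omega)
            (by omega) (by omega) (by omega) (by omega) (by unfold nearN; omega) (by unfold nearN; omega)
            (by unfold nearN; omega)
          simp only [g] at h
          linarith
      refine hS (hr _ _ ?_ ?_ ?_ ?_) (hr _ _ ?_ ?_ ?_ ?_) (hr _ _ ?_ ?_ ?_ ?_) (hr _ _ ?_ ?_ ?_ ?_)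
        ?_ ?_ ?_ ?_ ?_ ?_ ?_ ?_ ?_ ?_ ?_ ?_ ?_ ?_ ?_ ?_ ?_ ?_
      all_goals ((try unfold nearN); omega)
    · rw [zero_mul]
  have hhigh : ∀ i < n, ∀ j < 2 * n, n ≤ j → (if θ (g i j 0) > 1/2 then (1 : ZMod 2) else 0) *
      (w (g i j 0) (g (i+1) j 0) + w (g (i+1) j 0) (g (i+1) (j+1) 0) + w (g i (j+1) 0) (g (i+1) (j+1) 0)
        + w (g i j 0) (g i (j+1) 0)) = 
      (w (g i j 0) (g (i+1) j 0) + w (g (i+1) j 0) (g (i+1) (j+1) 0) + w (g i (j+1) 0) (g (i+1) (j+1) 0)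
        + w (g i j 0) (g i (j+1) 0)) := by
    intro i hi j hj hnj
    split_ifs with h
    · rw [one_mul]
    · rw [zero_mul]
      symm
      have hr : ∀ i' j', i' ≤ i + 1 → i ≤ i' → j' ≤ j + 1 → j ≤ j' → gpt n i' j' 0 ∈ R := by
        intro i' j' h1 h2 h3 h4
        refine ⟨gpt_mem hn (by omega) (by omega) (by omega), Or.inl (Or.inr ⟨?_, ?_, ?_⟩)⟩
        · simp [gpt]
        · simp only [gpt]
          rw [sub_nonneg, one_le_div hn']
          exact_mod_cast (by omega : n ≤ j')
        · have := hT (i := i') (j := j') (k := 0) (i' := i) (j' := j) (k' := 0) (by omega) (by omega)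
            (by omega) (by omega) (by omega) (by omega) (by unfold nearN; omega) (by unfold nearN; omega)
            (by unfold nearN; omega)
          simp only [g, not_lt] at h
          linarith
      refine hS (hr _ _ ?_ ?_ ?_ ?_) (hr _ _ ?_ ?_ ?_ ?_) (hr _ _ ?_ ?_ ?_ ?_) (hr _ _ ?_ ?_ ?_ ?_)
        ?_ ?_ ?_ ?_ ?_ ?_ ?_ ?_ ?_ ?_ ?_ ?_ ?_ ?_ ?_ ?_ ?_ ?_
      all_goals ((try unfold nearN); omega)
  have hfin : ∑ i ∈ Finset.range n, w (g i n 0) (g (i+1) n 0) = 0 := by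
    let A : ℕ → ZMod 2 := fun j => ∑ i ∈ Finset.range n, w (g i j 0) (g (i+1) j 0)
    have h1 := main
    rw [Finset.sum_comm, two_mul, Finset.sum_range_add] at h1
    rw [Finset.sum_eq_zero (s := Finset.range n) (fun j hj => Finset.sum_eq_zero fun i hi =>
      hlow i (Finset.mem_range.1 hi) j (Finset.mem_range.1 hj)), zero_add] at h1
    have h2 : ∀ x ∈ Finset.range n, ∑ i ∈ Finset.range n, (if θ (g i (n+x) 0) > 1/2 then (1 : ZMod 2) else 0) *
      (w (g i (n+x) 0) (g (i+1) (n+x) 0) + w (g (i+1) (n+x) 0) (g (i+1) (n+x+1) 0) + w (g i (n+x+1) 0) (g (i+1) (n+x+1) 0)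
        + w (g i (n+x) 0) (g i (n+x+1) 0)) = A (n+x) + A (n+(x+1)) := by
      intro x hx
      have hx := Finset.mem_range.1 hx
      rw [Finset.sum_congr rfl fun i hi => hhigh i (Finset.mem_range.1 hi) (n+x) (by omega) (by omega)]
      have h3 := zmod2_tel (fun i => w (g i (n+x) 0) (g i (n+x+1) 0)) n
      rw [hg0, hg0, zmod2_self] at h3
      simp only [Finset.sum_add_distrib] at h3 ⊢
      simp only [A, ← add_assoc]
      linear_combination h3
    rw [Finset.sum_congr rfl h2, zmod2_tel (fun x => A (n + x)) n, add_zero, ← two_mul] at h1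
    have h4 : A (2 * n) = 0 := Finset.sum_eq_zero fun i _ => by rw [hgt (i+1) i 0, hw0]
    rw [h4, add_zero] at h1
    exact h1
  rw [← hfin, hol]
  refine Finset.sum_congr rfl fun i hi => ?_
  have : ((n : ℕ) : ℝ) / n - 1 = 0 := by rw [div_self hn'.ne']; ring
  simp only [g, gpt, this, Nat.cast_zero, zero_div]
end

section
theorem cos_sin_fibre {s s' : ℝ} (hs : s ∈ Set.Icc (0:ℝ) 1) (hs' : s' ∈ Set.Icc (0:ℝ) 1)
    (hc : Real.cos (2 * Real.pi * s) = Real.cos (2 * Real.pi * s'))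
    (hsn : Real.sin (2 * Real.pi * s) = Real.sin (2 * Real.pi * s')) :
    s = s' ∨ (s = 0 ∧ s' = 1) ∨ (s = 1 ∧ s' = 0) := by
  have := Real.Angle.cos_sin_inj hc hsn
  rw [Real.Angle.angle_eq_iff_two_pi_dvd_sub] at this
  obtain ⟨k, hk⟩ := this
  have hk' : s - s' = k := by
    have hpi := Real.pi_pos
    have : (2 * Real.pi) * (s - s' - k) = 0 := by linear_combination hk
    rcases mul_eq_zero.1 this with h | h
    · linarith
    · linarith
  have h1 : (k : ℝ) ≤ 1 := by linarith [hs.2, hs'.1]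
  have h2 : (-1 : ℝ) ≤ k := by linarith [hs.1, hs'.2]
  have h1' : k ≤ 1 := by exact_mod_cast h1
  have h2' : -1 ≤ k := by exact_mod_cast h2
  have : k = -1 ∨ k = 0 ∨ k = 1 := by omega
  rcases this with rfl | rfl | rfl
  · right; left; push_cast at hk'; constructor <;> linarith [hs.1, hs'.2]
  · left; push_cast at hk'; linarith
  · right; right; push_cast at hk'; constructor <;> linarith [hs.2, hs'.1]

abbrev PuncE4 := {x : E4 // x ≠ 0}

section pulled
variable {X : Type*} [TopologicalSpace X] {U : Set X} (ψ : U ≃ₜ E4) (p : U)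

def rhoU (z : PuncE4) : X := (ψ.symm (z.1 + ψ p)).1

theorem rhoU_cont : Continuous (rhoU ψ p) := by
  unfold rhoU; fun_prop

theorem rhoU_mem (z : PuncE4) : rhoU ψ p z ∈ U \ {p.1} := by
  refine ⟨Subtype.coe_prop _, fun h => z.2 ?_⟩
  have : ψ.symm (z.1 + ψ p) = p := Subtype.ext h
  have := congrArg ψ this
  simpa using this

/-- lift of a map to `U ∖ p` -/
theorem exists_lift {R : Type*} [TopologicalSpace R] (f : R → X) (hf : Continuous f)
    (hfU : ∀ r, f r ∈ U \ {p.1}) : ∃ F : R → E4, Continuous F ∧ (∀ r, F r ≠ 0) ∧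
      (∀ r (h : F r ≠ 0), rhoU ψ p ⟨F r, h⟩ = f r) ∧ (∀ r r', f r = f r' → F r = F r') := by
  refine ⟨fun r => ψ ⟨f r, (hfU r).1⟩ - ψ p, by fun_prop, ?_, ?_, ?_⟩
  · intro r h
    rw [sub_eq_zero] at h
    have := ψ.injective h
    exact (hfU r).2 (congrArg Subtype.val this)
  · intro r h
    simp [rhoU]
  · intro r r' h
    simp only [h]

theorem isAS_pull {Z Y : Type*} [TopologicalSpace Z] [TopologicalSpace Y] {ρ : Z → Y} {O : Set Z} {O' : Set Y} {w : Y → Y → ZMod 2}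
    (hO : IsOpen O) (hρ : ContinuousOn ρ O) (hw : IsAS w O') (h : ∀ z ∈ O, ρ z ∈ O') :
    IsAS (fun x y => w (ρ x) (ρ y)) O := by
  intro z hz
  obtain ⟨V, hV, k, hk⟩ := hw _ (h z hz)
  exact ⟨ρ ⁻¹' V, (hρ.continuousAt (hO.mem_nhds hz)) hV, fun y => k (ρ y), fun y hy x hx => hk _ hy _ hx⟩

end pulled

def pj (x : ℝ) : Set.Icc (0:ℝ) 1 := Set.projIcc 0 1 zero_le_one x
def pk (x : ℝ) : Set.Icc (-1:ℝ) 1 := Set.projIcc (-1) 1 (by norm_num) x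

theorem pj_cont : Continuous pj := continuous_projIcc (h := zero_le_one)
theorem pk_cont : Continuous pk := continuous_projIcc (h := by norm_num)
theorem pj_of {x : ℝ} (h : x ∈ Set.Icc (0:ℝ) 1) : pj x = ⟨x, h⟩ := Set.projIcc_of_mem _ h
theorem pk_of {x : ℝ} (h : x ∈ Set.Icc (-1:ℝ) 1) : pk x = ⟨x, h⟩ := Set.projIcc_of_mem _ h

theorem hol_congr {X : Type*} (w : X → X → ZMod 2) {γ γ' : ℝ → X} (h : ∀ s ∈ Set.Icc (0:ℝ) 1, γ s = γ' s) {n : ℕ} (hn : 0 < n) :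
    hol w γ n = hol w γ' n := by
  unfold hol
  refine Finset.sum_congr rfl fun i hi => ?_
  have hi := Finset.mem_range.1 hi
  rw [h _ (grid_mem hn (by omega)), h _ (grid_mem hn (by omega))]

theorem lemmaA {X : Type*} [TopologicalSpace X] {U : Set X} (ψ : U ≃ₜ E4) (p : X) (hp : p ∈ U)
    (w : X → X → ZMod 2) (hw : IsAS w (U \ {p})) (hw0 : ∀ x, w x x = 0)
    (γ : ℝ → X) (hγ : ContinuousOn γ (Set.Icc 0 1)) (hγU : ∀ s ∈ Set.Icc (0:ℝ) 1, γ s ∈ U \ {p})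
    (hloop : γ 0 = γ 1) : ∀ᶠ n in Filter.atTop, hol w γ n = 0 := by
  obtain ⟨F, hF, hF0, hFr, hFe⟩ := exists_lift ψ ⟨p, hp⟩ (fun s : Set.Icc (0:ℝ) 1 => γ s)
    (continuousOn_iff_continuous_domRestrict.1 hγ) (fun s => hγU s s.2)
  obtain ⟨H, hH, hH0, ⟨v, hH1⟩, hHne, hHe⟩ := filling
    (fun s : Set.Icc (0:ℝ) 1 => ![Real.cos (2 * Real.pi * s), Real.sin (2 * Real.pi * s)])
    (by refine continuous_pi fun i => ?_
        fin_cases i <;> simp <;> fun_prop)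
    (fun x : ℝ × ℝ => ![Real.cos (2 * Real.pi * x.1), Real.sin (2 * Real.pi * x.1)])
    (by
      rw [contDiff_pi]
      intro i
      fin_cases i
      · simp; fun_prop
      · simp; fun_prop)
    (fun r => ⟨(r, 0), rfl⟩) F hF hF0 (by
      intro r r' h
      have h1 := congrFun h 0
      have h2 := congrFun h 1
      simp at h1 h2
      apply hFe
      rcases cos_sin_fibre r.2 r'.2 h1 h2 with h | ⟨h, h'⟩ | ⟨h, h'⟩
      · rw [h]
      · rw [h, h', hloop]
      · rw [h, h', hloop])
  let m : ℝ × ℝ × ℝ → ℝ := fun q => max |q.2.1| q.2.2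
  let G : ℝ × ℝ × ℝ → PuncE4 := fun q => ⟨H (pj q.1, pj (m q)), hHne _ _ (pj (m q)).2⟩
  have hm : Continuous m := by fun_prop
  have hG : Continuous G := by
    refine Continuous.subtype_mk (hH.comp ?_) _
    exact (pj_cont.comp continuous_fst).prodMk (continuous_subtype_val.comp (pj_cont.comp hm))
  have hmone : ∀ q, 1 ≤ m q → pj (m q) = (⟨1, by simp⟩ : Set.Icc (0:ℝ) 1) := by
    intro q h
    exact Set.projIcc_of_right_le _ h
  have hcst : ∀ q q', 1 ≤ m q → 1 ≤ m q' → G q = G q' := by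
    intro q q' h h'
    apply Subtype.ext
    simp only [G]
    rw [hmone q h, hmone q' h', hH1, hH1]
  have hcore := coreB (Z := PuncE4) ∅ ∅ (fun _ => 1/2) continuous_const (by simp) (by simp)
    (fun x y => w (rhoU ψ ⟨p, hp⟩ x) (rhoU ψ ⟨p, hp⟩ y))
    (isAS_pull (by simp) (rhoU_cont ψ _).continuousOn hw (fun z _ => rhoU_mem ψ ⟨p, hp⟩ z))
    (fun z => hw0 _) G hG
    (by
      intro t u
      apply Subtype.ext
      simp only [G, m]
      apply hHe
      have h0 : ((pj 0 : Set.Icc (0:ℝ) 1) : ℝ) = 0 := by rw [pj_of (by simp)]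
      have h1 : ((pj 1 : Set.Icc (0:ℝ) 1) : ℝ) = 1 := by rw [pj_of (by simp)]
      rw [h0, h1]; simp)
    (fun s s' u => hcst _ _ (by simp [m]) (by simp [m]))
    (fun s s' u => hcst _ _ (by simp [m]) (by simp [m]))
    (fun s s' u v => hcst _ _ (by simp [m]) (by simp [m]))
    (by simp) (by simp)
  filter_upwards [hcore, Filter.eventually_gt_atTop 0] with n hn hn0
  rw [← hn]
  rw [hol_congr w (γ' := fun s => rhoU ψ ⟨p, hp⟩ (G (s, 0, 0))) ?_ hn0]
  · rfl
  · intro s hs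
    have h0 : (pj (m (s, 0, 0)) : ℝ) = 0 := by simp only [m]; rw [pj_of (by simp)]; simp
    have h1 : (G (s, 0, 0)).1 = F (⟨s, hs⟩) := by
      simp only [G]
      rw [h0, hH0, pj_of hs]
    have h2 := hFr ⟨s, hs⟩ (hF0 _)
    simp only at h2
    rw [← h2]
    congr 1
    exact Subtype.ext h1.symm

theorem lemmaB {X : Type*} [TopologicalSpace X] {U : Set X} (ψ : U ≃ₜ E4) (p : X) (hp : p ∈ U)
    (Cp Cm : Set X) (hCp : IsOpen (U \ Cp)) (hCm : IsOpen (U \ Cm))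
    (hdis : ∀ x ∈ U, x ∈ Cp → x ∈ Cm → x = p)
    (w : X → X → ZMod 2) (hw : IsAS w (U \ (Cp ∪ Cm))) (hw0 : ∀ x, w x x = 0)
    (D : ℝ × ℝ → X) (hD : ContinuousOn D (Set.Icc 0 1 ×ˢ Set.Icc (-1) 1))
    (hDU : ∀ s ∈ Set.Icc (0:ℝ) 1, ∀ t ∈ Set.Icc (-1:ℝ) 1, D (s, t) ∈ U \ {p})
    (hloop : ∀ t ∈ Set.Icc (-1:ℝ) 1, D (0, t) = D (1, t))
    (htop : ∀ s ∈ Set.Icc (0:ℝ) 1, D (s, 1) = D (0, 1))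
    (hbot : ∀ s ∈ Set.Icc (0:ℝ) 1, D (s, -1) = D (0, -1))
    (hpos : ∀ s ∈ Set.Icc (0:ℝ) 1, ∀ t ∈ Set.Icc (0:ℝ) 1, D (s, t) ∉ Cm)
    (hneg : ∀ s ∈ Set.Icc (0:ℝ) 1, ∀ t ∈ Set.Icc (-1:ℝ) 0, D (s, t) ∉ Cp) :
    ∀ᶠ n in Filter.atTop, hol w (fun s => D (s, 0)) n = 0 := by
  have hpi := Real.pi_pos
  let f : Set.Icc (0:ℝ) 1 × Set.Icc (-1:ℝ) 1 → X := fun r => D (r.1, r.2)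
  have hf : Continuous f := by
    refine hD.comp_continuous (by fun_prop) ?_
    intro r; exact ⟨r.1.2, r.2.2⟩
  obtain ⟨F, hF, hF0, hFr, hFe⟩ := exists_lift ψ ⟨p, hp⟩ f hf (fun r => hDU _ r.1.2 _ r.2.2)
  let sph : ℝ → ℝ → Fin 3 → ℝ := fun s t => ![Real.cos (2 * Real.pi * s) * Real.cos (Real.pi / 2 * t),
      Real.sin (2 * Real.pi * s) * Real.cos (Real.pi / 2 * t), Real.sin (Real.pi / 2 * t)]
  obtain ⟨H, hH, hH0, ⟨v, hH1⟩, hHne, hHe⟩ := filling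
    (fun r : Set.Icc (0:ℝ) 1 × Set.Icc (-1:ℝ) 1 => sph r.1 r.2)
    (by refine continuous_pi fun i => ?_
        fin_cases i <;> simp [sph] <;> fun_prop)
    (fun x : ℝ × ℝ => sph x.1 x.2)
    (by
      rw [contDiff_pi]
      intro i
      fin_cases i
      · simp [sph]; fun_prop
      · simp [sph]; fun_prop
      · simp [sph]; fun_prop)
    (fun r => ⟨(r.1, r.2), rfl⟩) F hF hF0 (by
      rintro ⟨⟨s, hs⟩, t, ht⟩ ⟨⟨s', hs'⟩, t', ht'⟩ h
      have h1 := congrFun h 0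
      have h2 := congrFun h 1
      have h3 := congrFun h 2
      simp [sph] at h1 h2 h3
      apply hFe
      have htt : t = t' := by
        have hmem : ∀ t ∈ Set.Icc (-1:ℝ) 1, Real.pi / 2 * t ∈ Set.Icc (-(Real.pi/2)) (Real.pi/2) := by
          intro t ht; constructor <;> nlinarith [ht.1, ht.2]
        have := Real.injOn_sin (hmem t ht) (hmem t' ht') h3
        exact mul_left_cancel₀ (by positivity) this
      subst htt
      simp only [f]
      rcases eq_or_ne t 1 with rfl | h4
      · rw [htop s hs, htop s' hs']
      rcases eq_or_ne t (-1) with rfl | h5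
      · rw [hbot s hs, hbot s' hs']
      have h4' : t < 1 := lt_of_le_of_ne ht.2 h4
      have h5' : -1 < t := lt_of_le_of_ne ht.1 (Ne.symm h5)
      have hcp : 0 < Real.cos (Real.pi / 2 * t) := by
        apply Real.cos_pos_of_mem_Ioo
        constructor <;> nlinarith
      have h1' := mul_right_cancel₀ hcp.ne' h1
      have h2' := mul_right_cancel₀ hcp.ne' h2
      rcases cos_sin_fibre hs hs' h1' h2' with h | ⟨h, h'⟩ | ⟨h, h'⟩
      · rw [h]
      · rw [h, h', hloop t ht]
      · rw [h, h', hloop t ht])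
  let G : ℝ × ℝ × ℝ → PuncE4 := fun q => ⟨H ((pj q.1, pk q.2.1), pj q.2.2), hHne _ _ (pj q.2.2).2⟩
  have hG : Continuous G := by
    refine Continuous.subtype_mk (hH.comp ?_) _
    have := pj_cont
    have := pk_cont
    fun_prop
  let ρ := rhoU ψ ⟨p, hp⟩
  have hρ : Continuous ρ := rhoU_cont ψ _
  have hρU : ∀ z, ρ z ∈ U \ {p} := rhoU_mem ψ _
  have hcl : ∀ C : Set X, IsOpen (U \ C) → IsClosed (ρ ⁻¹' C) := by
    intro C hC
    rw [← isOpen_compl_iff]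
    have : (ρ ⁻¹' C)ᶜ = ρ ⁻¹' (U \ C) := by
      ext z; simp [(hρU z).1]
    rw [this]
    exact hC.preimage hρ
  have hbase : ∀ s t, ρ (G (s, t, 0)) = D (pj s, pk t) := by
    intro s t
    have h0 : (pj 0 : ℝ) = 0 := by rw [pj_of (by simp)]
    have h1 : (G (s, t, 0)).1 = F (pj s, pk t) := by
      simp only [G]
      rw [h0, hH0]
    have h2 := hFr (pj s, pk t) (hF0 _)
    rw [show D (pj s, pk t) = f (pj s, pk t) from rfl, ← h2]
    simp only [ρ]
    congr 1
    exact Subtype.ext h1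
  obtain ⟨θ, hθm, hθp, -⟩ := exists_continuous_zero_one_of_isClosed (hcl Cm hCm) (hcl Cp hCp) (by
    rw [Set.disjoint_left]
    intro z h1 h2
    exact (hρU z).2 (hdis _ (hρU z).1 h2 h1))
  have h1' : ((pj 1 : Set.Icc (0:ℝ) 1) : ℝ) = 1 := by rw [pj_of (by simp)]
  have h0' : ((pj 0 : Set.Icc (0:ℝ) 1) : ℝ) = 0 := by rw [pj_of (by simp)]
  have k1 : ((pk 1 : Set.Icc (-1:ℝ) 1) : ℝ) = 1 := by rw [pk_of (by simp)]
  have k2 : ((pk (-1) : Set.Icc (-1:ℝ) 1) : ℝ) = -1 := by rw [pk_of (by simp)]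
  have hcore := coreB (Z := PuncE4) (ρ ⁻¹' Cp) (ρ ⁻¹' Cm) θ θ.continuous
    (fun z hz => hθp hz) (fun z hz => hθm hz) (fun x y => w (ρ x) (ρ y))
    (isAS_pull ((hcl Cp hCp).union (hcl Cm hCm)).isOpen_compl hρ.continuousOn hw
      (fun z hz => ⟨(hρU z).1, hz⟩))
    (fun z => hw0 _) G hG
    (by
      intro t u
      apply Subtype.ext
      simp only [G]
      apply hHe
      rw [h0', h1']; simp [sph])
    (by
      intro s s' u
      apply Subtype.ext
      simp only [G]
      apply hHe
      rw [k1]; simp [sph])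
    (by
      intro s s' u
      apply Subtype.ext
      simp only [G]
      apply hHe
      rw [k2]; simp [sph])
    (by
      intro s t s' t'
      apply Subtype.ext
      simp only [G]
      rw [h1', hH1, hH1])
    (by
      intro s t ht
      show ρ (G (s, t, 0)) ∉ Cm
      rw [hbase]
      refine hpos _ (pj s).2 _ ⟨?_, (pk t).2.2⟩
      simp only [pk, Set.coe_projIcc]
      exact le_max_of_le_right (le_min (by norm_num) ht))
    (by
      intro s t ht
      show ρ (G (s, t, 0)) ∉ Cp
      rw [hbase]
      refine hneg _ (pj s).2 _ ⟨(pk t).2.1, ?_⟩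
      simp only [pk, Set.coe_projIcc]
      exact max_le (by norm_num) (min_le_of_right_le ht))
  filter_upwards [hcore, Filter.eventually_gt_atTop 0] with n hn hn0
  rw [← hn]
  rw [hol_congr w (γ' := fun s => ρ (G (s, 0, 0))) ?_ hn0]
  · rfl
  · intro s hs
    rw [hbase, pj_of hs, pk_of (by simp)]
end

section
theorem eqvGen_prop {T : Type*} {r : T → T → Prop} (Q : T → T → Prop) (hr : ∀ x y, r x y → Q x y)
    (h1 : ∀ x, Q x x) (h2 : ∀ x y, Q x y → Q y x) (h3 : ∀ x y z, Q x y → Q y z → Q x z) :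
    ∀ {x y}, Quot.mk r x = Quot.mk r y → Q x y := by
  intro x y h
  have := Quot.eqvGen_exact h
  clear h
  induction this with
  | rel x y h => exact hr x y h
  | refl x => exact h1 x
  | symm x y _ ih => exact h2 _ _ ih
  | trans x y z _ _ ih1 ih2 => exact h3 _ _ _ ih1 ih2

section desc
variable {T : Type*} [TopologicalSpace T] {r : T → T → Prop} {O : Set T}

theorem mk_mem_image (hsat : ∀ p q, r p q → (p ∈ O ↔ q ∈ O)) (p : T) :
    Quot.mk r p ∈ Quot.mk r '' O ↔ p ∈ O := by
  constructor
  · rintro ⟨q, hq, h⟩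
    exact (eqvGen_prop (fun x y => (x ∈ O ↔ y ∈ O)) hsat (fun _ => Iff.rfl) (fun _ _ h => h.symm)
      (fun _ _ _ h h' => h.trans h') h).1 hq
  · intro h; exact ⟨p, h, rfl⟩

theorem desc_open (hO : IsOpen O) (hsat : ∀ p q, r p q → (p ∈ O ↔ q ∈ O)) :
    IsOpen (Quot.mk r '' O) := by
  have : (Quot.mk r) ⁻¹' (Quot.mk r '' O) = O := by
    ext p; exact mk_mem_image hsat p
  rw [← isQuotientMap_quot_mk.isOpen_preimage, this]
  exact hO

theorem desc_val {α : Type*} (hsat : ∀ p q, r p q → (p ∈ O ↔ q ∈ O)) (G : T → α)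
    (hinv : ∀ p q, p ∈ O → r p q → G p = G q) (p : T) (hp : p ∈ O) : G (Quot.mk r p).out = G p := by
  have h : Quot.mk r p = Quot.mk r (Quot.mk r p).out := (Quot.out_eq _).symm
  refine ((eqvGen_prop (fun x y => (x ∈ O ↔ y ∈ O) ∧ (x ∈ O → G x = G y))
    (fun x y h => ⟨hsat x y h, fun hx => hinv x y hx h⟩) (fun _ => ⟨Iff.rfl, fun _ => rfl⟩)
    (fun _ _ h => ⟨h.1.symm, fun hy => (h.2 (h.1.2 hy)).symm⟩)
      (fun _ _ _ h h' => ⟨h.1.trans h'.1, fun hx => (h.2 hx).trans (h'.2 (h.1.1 hx))⟩) h).2 hp).symm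

theorem desc_cont {α : Type*} [TopologicalSpace α] (hO : IsOpen O) (hsat : ∀ p q, r p q → (p ∈ O ↔ q ∈ O)) (G : T → α)
    (hG : ContinuousOn G O) (hinv : ∀ p q, p ∈ O → r p q → G p = G q) :
    ContinuousOn (fun x : Quot r => G x.out) (Quot.mk r '' O) := by
  rw [isQuotientMap_quot_mk.continuousOn_isOpen_iff (desc_open hO hsat)]
  have : (Quot.mk r) ⁻¹' (Quot.mk r '' O) = O := by
    ext p; exact mk_mem_image hsat p
  rw [this]
  exact hG.congr fun p hp => desc_val hsat G hinv p hp
end desc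

/-- shrinking a Euclidean neighbourhood -/
theorem shrink {X : Type*} [TopologicalSpace X] {U : Set X} (hU : IsOpen U) (h : Nonempty (U ≃ₜ E4))
    {p : X} (hp : p ∈ U) {V : Set X} (hV : V ∈ nhds p) :
    ∃ U', IsOpen U' ∧ p ∈ U' ∧ U' ⊆ V ∧ Nonempty (U' ≃ₜ E4) := by
  obtain ⟨ψ⟩ := h
  let q : U := ⟨p, hp⟩
  have h1 : (fun x : E4 => (ψ.symm x).1) ⁻¹' V ∈ nhds (ψ q) := by
    have hc : Continuous fun x : E4 => (ψ.symm x).1 := by fun_prop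
    apply hc.continuousAt
    simpa [q] using hV
  obtain ⟨ε, hε, hb⟩ := Metric.mem_nhds_iff.1 h1
  let B := Metric.ball (ψ q) ε
  let j : B → X := fun x => (ψ.symm x.1).1
  have hj : Topology.IsOpenEmbedding j :=
    (hU.isOpenEmbedding_subtypeVal.comp ψ.symm.isOpenEmbedding).comp
      Metric.isOpen_ball.isOpenEmbedding_subtypeVal
  refine ⟨Set.range j, hj.isOpen_range, ⟨⟨ψ q, Metric.mem_ball_self hε⟩, by simp [j, q]⟩, ?_, ?_⟩
  · rintro _ ⟨x, rfl⟩
    exact hb x.2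
  · have e1 : Set.range j ≃ₜ B := hj.isEmbedding.toHomeomorph.symm
    have e2 := (OpenPartialHomeomorph.univBall (ψ q) ε).toHomeomorphSourceTarget
    have e3 := Homeomorph.setCongr (OpenPartialHomeomorph.univBall_source (ψ q) ε)
    have e4 := Homeomorph.setCongr (OpenPartialHomeomorph.univBall_target (ψ q) hε)
    exact ⟨e1.trans (e4.symm.trans (e2.symm.trans (e3.trans (Homeomorph.Set.univ E4))))⟩

variable (D : GlueingDatum 4)

theorem glueRel_perm {p q : GlueTotal D} (h : Quot.mk (glueRel D) p = Quot.mk (glueRel D) q) :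
    ∃ σ : Equiv.Perm (Fin 5), q.2.1 = p.2.1 ∘ σ :=
  eqvGen_prop (fun p q : GlueTotal D => ∃ σ : Equiv.Perm (Fin 5), q.2.1 = p.2.1 ∘ σ)
    (fun p q ⟨k, _, _, h⟩ => ⟨_, h⟩) (fun p => ⟨1, rfl⟩)
    (fun p q ⟨σ, h⟩ => ⟨σ.symm, by rw [h]; funext v; simp⟩)
    (fun p q r ⟨σ, h⟩ ⟨τ, h'⟩ => ⟨σ * τ, by rw [h', h]; rfl⟩) h

theorem surfRel_perm {p q : SurfTotal D} (h : Quot.mk (surfRel D) p = Quot.mk (surfRel D) q) :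
    ∃ σ : Equiv.Perm (Fin 5), q.2.1 = p.2.1 ∘ σ :=
  eqvGen_prop (fun p q : SurfTotal D => ∃ σ : Equiv.Perm (Fin 5), q.2.1 = p.2.1 ∘ σ)
    (fun p q ⟨k, _, _, _, _, h⟩ => ⟨_, h⟩) (fun p => ⟨1, rfl⟩)
    (fun p q ⟨σ, h⟩ => ⟨σ.symm, by rw [h]; funext v; simp⟩)
    (fun p q r ⟨σ, h⟩ ⟨τ, h'⟩ => ⟨σ * τ, by rw [h', h]; rfl⟩) h

instance finI : Finite D.I := @Finite.of_fintype _ D.fintypeI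

instance glueT1 : T1Space (GlueSpace D) := by
  constructor
  intro x
  obtain ⟨p, rfl⟩ := Quot.exists_rep x
  rw [← isQuotientMap_quot_mk.isClosed_preimage]
  apply Set.Finite.isClosed
  let F : D.I × Equiv.Perm (Fin 5) → GlueTotal D := fun a =>
    ⟨a.1, ⟨p.2.1 ∘ a.2, fun v => p.2.2.1 _, by
      exact (Equiv.sum_comp a.2 p.2.1).trans p.2.2.2⟩⟩
  refine (Set.finite_range F).subset ?_
  rintro ⟨j, y⟩ h
  obtain ⟨σ, hσ⟩ := glueRel_perm D (Eq.symm h)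
  refine ⟨(j, σ), ?_⟩
  simp only [F]
  congr 1
  exact Subtype.ext hσ.symm

/-! ### big coordinates -/

def bigS (y : Fin 5 → ℝ) : Finset (Fin 5) := Finset.univ.filter fun v => 3/8 < y v

theorem mem_bigS {y : Fin 5 → ℝ} {v : Fin 5} : v ∈ bigS y ↔ 3/8 < y v := by simp [bigS]

theorem bigS_card_le {y : Fin 5 → ℝ} (h0 : ∀ v, 0 ≤ y v) (h1 : ∑ v, y v = 1) : (bigS y).card ≤ 2 := by
  by_contra! h
  have h2 : ∑ v ∈ bigS y, (3/8 : ℝ) ≤ ∑ v ∈ bigS y, y v :=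
    Finset.sum_le_sum fun v hv => (mem_bigS.1 hv).le
  have h3 : ∑ v ∈ bigS y, y v ≤ ∑ v, y v := Finset.sum_le_sum_of_subset_of_nonneg (Finset.subset_univ _) (fun v _ _ => h0 v)
  rw [Finset.sum_const, nsmul_eq_mul] at h2
  have : (3:ℝ) ≤ (bigS y).card := by exact_mod_cast h
  linarith

theorem bigS_eq {y : Fin 5 → ℝ} (h0 : ∀ v, 0 ≤ y v) (h1 : ∑ v, y v = 1) {s : Finset (Fin 5)} (hs : s.card = 2)
    (h : ∀ v ∈ s, 3/8 < y v) : bigS y = s :=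
  (Finset.eq_of_subset_of_card_le (fun v hv => mem_bigS.2 (h v hv)) (by rw [hs]; exact bigS_card_le h0 h1)).symm

theorem bigS_comp (y : Fin 5 → ℝ) (φ : Equiv.Perm (Fin 5)) : bigS (y ∘ φ.symm) = (bigS y).image φ := by
  ext v
  simp only [mem_bigS, Finset.mem_image, Function.comp]
  constructor
  · intro h; exact ⟨_, h, by simp⟩
  · rintro ⟨a, h, rfl⟩; simpa using h

def tilN : Set (GlueTotal D) := {p | (bigS p.2.1).card = 2}

theorem tilN_sat (p q : GlueTotal D) (h : glueRel D p q) : p ∈ tilN D ↔ q ∈ tilN D := by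
  obtain ⟨k, _, _, h⟩ := h
  simp only [tilN, Set.mem_ofPred_eq]
  rw [h, bigS_comp, Finset.card_image_of_injective _ (Equiv.injective _)]

/-- near a point of `tilN`, index and big set are constant -/
theorem tilN_nhd {p : GlueTotal D} (hp : p ∈ tilN D) :
    ∀ᶠ q in nhds p, q.1 = p.1 ∧ bigS q.2.1 = bigS p.2.1 ∧ q ∈ tilN D := by
  obtain ⟨j, y⟩ := p
  rw [Sigma.nhds_mk, Filter.eventually_map]
  have : ∀ᶠ z : Delta 4 in nhds y, ∀ v ∈ bigS y.1, 3/8 < z.1 v := by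
    rw [Filter.eventually_all_finset]
    intro v hv
    have hc : Continuous fun z : Delta 4 => z.1 v := (continuous_apply v).comp continuous_subtype_val
    exact hc.continuousAt.eventually (lt_mem_nhds (mem_bigS.1 hv))
  filter_upwards [this] with z hz
  have h1 : bigS z.1 = bigS y.1 := bigS_eq z.2.1 z.2.2 hp hz
  refine ⟨rfl, h1, ?_⟩
  simp only [tilN, Set.mem_ofPred_eq, h1]; exact hp

theorem tilN_open : IsOpen (tilN D) := by
  rw [isOpen_iff_eventually]
  intro p hp
  exact (tilN_nhd D hp).mono fun q hq => hq.2.2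

def setN : Set (GlueSpace D) := Quot.mk (glueRel D) '' tilN D

theorem setN_open : IsOpen (setN D) := desc_open (tilN_open D) (tilN_sat D)

/-- descend a family of functions depending on index and big set -/
theorem famCont {α : Type*} [TopologicalSpace α] (F : D.I → Finset (Fin 5) → Delta 4 → α)
    (O : Set (GlueTotal D)) (hON : O ⊆ tilN D) 
    (hF : ∀ p ∈ O, ContinuousAt (F p.1 (bigS p.2.1)) p.2) :
    ContinuousOn (fun p : GlueTotal D => F p.1 (bigS p.2.1) p.2) O := by
  intro p hp
  apply ContinuousAt.continuousWithinAt
  have h1 := hF p hp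
  have h2 := tilN_nhd D (hON hp)
  obtain ⟨j, y⟩ := p
  rw [ContinuousAt, Sigma.nhds_mk, Filter.tendsto_map'_iff]
  rw [Sigma.nhds_mk, Filter.eventually_map] at h2
  refine Filter.Tendsto.congr' ?_ h1
  filter_upwards [h2] with z hz
  simp only [Function.comp]
  rw [hz.2.1]
end

section
theorem exists_odd {T : Type} (r : T → T → Prop) (sw : T → T) (hsw : ∀ x, sw (sw x) = x)
    (hr : ∀ x y, r x y → r (sw x) (sw y)) (V : T → Prop)
    (hno : ∀ x, V x → Quot.mk r x ≠ Quot.mk r (sw x)) :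
    ∃ O : T → ℝ, (∀ x, O x = 1 ∨ O x = -1) ∧ (∀ x y, r x y → O x = O y) ∧
      ∀ x, V x → O (sw x) = - O x := by
  let lt : Quot r → Quot r → Prop := WellOrderingRel
  refine ⟨fun x => if lt (Quot.mk r x) (Quot.mk r (sw x)) then 1 else -1, ?_, ?_, ?_⟩
  · intro x; dsimp only; split_ifs <;> simp
  · intro x y h
    have h1 : Quot.mk r x = Quot.mk r y := Quot.sound h
    have h2 : Quot.mk r (sw x) = Quot.mk r (sw y) := Quot.sound (hr x y h)
    simp only [h1, h2]
  · intro x hx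
    have := hno x hx
    simp only [hsw]
    rcases trichotomous_of (WellOrderingRel (α := Quot r)) (Quot.mk r x) (Quot.mk r (sw x)) with h | h | h
    · have h' : ¬ lt (Quot.mk r (sw x)) (Quot.mk r x) := asymm_of (WellOrderingRel (α := Quot r)) h
      have h : lt (Quot.mk r x) (Quot.mk r (sw x)) := h
      simp [h, h']
    · exact absurd h this
    · have h' : ¬ lt (Quot.mk r x) (Quot.mk r (sw x)) := asymm_of (WellOrderingRel (α := Quot r)) h
      have h : lt (Quot.mk r (sw x)) (Quot.mk r x) := h
      simp [h, h']

theorem tube_small {κ X : Type*} [TopologicalSpace κ] [TopologicalSpace X] {K : Set κ} (hK : IsCompact K)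
    (f : ℝ × κ → X) {δ₀ : ℝ} (hδ : 0 < δ₀) (hf : ContinuousOn f (Set.Icc 0 δ₀ ×ˢ K)) {U : Set X} (hU : IsOpen U)
    (h0 : ∀ k ∈ K, f (0, k) ∈ U) : ∃ δ, 0 < δ ∧ δ ≤ δ₀ ∧ ∀ k ∈ K, f (δ, k) ∈ U := by
  have h1 : ∀ᶠ δ in nhds (0:ℝ), ∀ k ∈ K, δ ∈ Set.Icc 0 δ₀ → k ∈ K → f (δ, k) ∈ U := by
    apply hK.eventually_forall_of_forall_eventually
    intro k hk
    have h2 := (hf (0, k) ⟨⟨le_rfl, hδ.le⟩, hk⟩).eventually (hU.mem_nhds (h0 k hk))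
    rw [eventually_nhdsWithin_iff] at h2
    filter_upwards [h2] with z hz h3 h4
    exact hz ⟨h3, h4⟩
  obtain ⟨ε, hε, hb⟩ := Metric.eventually_nhds_iff.1 h1
  refine ⟨min (ε/2) δ₀, by positivity, min_le_right _ _, fun k hk => hb ?_ k hk ⟨by positivity, min_le_right _ _⟩ hk⟩
  rw [Real.dist_eq, sub_zero, abs_of_pos (by positivity)]
  exact (min_le_left _ _).trans_lt (by linarith)

theorem five {a b : Fin 5} (h : a ≠ b) : ∃ c d e : Fin 5, c ≠ a ∧ c ≠ b ∧ d ≠ a ∧ d ≠ b ∧ e ≠ a ∧ e ≠ b ∧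
    c ≠ d ∧ c ≠ e ∧ d ≠ e := by
  revert a b; decide

theorem five' {a b c : Fin 5} (h : a ≠ b) (h1 : c ≠ a) (h2 : c ≠ b) : ∃ d e : Fin 5, d ≠ a ∧ d ≠ b ∧ e ≠ a ∧ e ≠ b ∧
    c ≠ d ∧ c ≠ e ∧ d ≠ e := by
  revert a b c; decide

theorem univ5 {a b c d e : Fin 5} (h : a ≠ b) (h1 : c ≠ a) (h2 : c ≠ b) (h3 : d ≠ a) (h4 : d ≠ b)
    (h5 : e ≠ a) (h6 : e ≠ b) (h7 : c ≠ d) (h8 : c ≠ e) (h9 : d ≠ e) : (Finset.univ : Finset (Fin 5)) = {a, b, c, d, e} := by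
  symm
  rw [← Finset.card_eq_iff_eq_univ]
  rw [Finset.card_insert_of_notMem, Finset.card_insert_of_notMem, Finset.card_insert_of_notMem, Finset.card_insert_of_notMem]
  · simp
  all_goals simp; grind

theorem sum5 {a b c d e : Fin 5} (h : a ≠ b) (h1 : c ≠ a) (h2 : c ≠ b) (h3 : d ≠ a) (h4 : d ≠ b)
    (h5 : e ≠ a) (h6 : e ≠ b) (h7 : c ≠ d) (h8 : c ≠ e) (h9 : d ≠ e) (f : Fin 5 → ℝ) :
    ∑ v, f v = f a + f b + f c + f d + f e := by
  rw [univ5 h h1 h2 h3 h4 h5 h6 h7 h8 h9]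
  rw [Finset.sum_insert, Finset.sum_insert, Finset.sum_insert, Finset.sum_insert, Finset.sum_singleton]
  · ring
  all_goals simp; grind

theorem prod5 {a b c d e : Fin 5} (h : a ≠ b) (h1 : c ≠ a) (h2 : c ≠ b) (h3 : d ≠ a) (h4 : d ≠ b)
    (h5 : e ≠ a) (h6 : e ≠ b) (h7 : c ≠ d) (h8 : c ≠ e) (h9 : d ≠ e) (f : Fin 5 → ℝ) :
    ∏ v, f v = f a * f b * f c * f d * f e := by
  rw [univ5 h h1 h2 h3 h4 h5 h6 h7 h8 h9]
  rw [Finset.prod_insert, Finset.prod_insert, Finset.prod_insert, Finset.prod_insert, Finset.prod_singleton]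
  · ring
  all_goals simp; grind

/-- orientation-type auxiliary data -/
structure OE (D : GlueingDatum 4) where
  O : D.I → Fin 5 → Fin 5 → Fin 5 → ℝ
  E : D.I × Fin 5 → Fin 5 → Fin 5 → ℝ
  O1 : ∀ j k a b c, k ≠ a → k ≠ b → k ≠ c →
    O (D.P (j, k)).1 (D.glue (j, k) a) (D.glue (j, k) b) (D.glue (j, k) c) = O j a b c
  O2 : ∀ j a b c, a ≠ b → c ≠ a → c ≠ b → O j b a c = - O j a b c
  E1 : ∀ f a b, E (D.P f) (D.glue f a) (D.glue f b) = E f a b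
  E2 : ∀ f a b, a ≠ b → E f b a = - E f a b
  E3 : ∀ f a b, E f a b = 1 ∨ E f a b = -1

variable {D : GlueingDatum 4} 

theorem exists_E (D : GlueingDatum 4) : ∃ E : D.I × Fin 5 → Fin 5 → Fin 5 → ℝ, 
    (∀ f a b, E (D.P f) (D.glue f a) (D.glue f b) = E f a b) ∧
    (∀ f a b, a ≠ b → E f b a = - E f a b) ∧ (∀ f a b, E f a b = 1 ∨ E f a b = -1) := by
  let st : (D.I × Fin 5) × Fin 5 × Fin 5 → (D.I × Fin 5) × Fin 5 × Fin 5 := fun x =>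
    (D.P x.1, D.glue x.1 x.2.1, D.glue x.1 x.2.2)
  have hst : ∀ x, st (st x) = x := by
    rintro ⟨f, a, b⟩
    simp [st, D.P_involutive, D.glue_symm]
  obtain ⟨O, h1, h2, h3⟩ := exists_odd (T := (D.I × Fin 5) × Fin 5 × Fin 5) (fun x y => y = st x)
    (fun x => (x.1, x.2.2, x.2.1)) (fun x => rfl) (by rintro x y rfl; rfl) (fun x => x.2.1 ≠ x.2.2) (by
      rintro ⟨f, a, b⟩ hx h
      have := eqvGen_prop (fun x y => y = x ∨ y = st x) (fun x y h => Or.inr h) (fun x => Or.inl rfl)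
        (by rintro x y (rfl | rfl)
            · exact Or.inl rfl
            · right; exact (hst x).symm)
        (by rintro x y z (rfl | rfl) (rfl | rfl)
            · exact Or.inl rfl
            · exact Or.inr rfl
            · exact Or.inr rfl
            · exact Or.inl (hst x)) h
      rcases this with h | h
      · simp only [Prod.mk.injEq] at h
        exact hx h.2.2
      · simp only [st, Prod.mk.injEq] at h
        exact D.P_fixedPointFree f h.1.symm)
  exact ⟨fun f a b => O (f, a, b), fun f a b => (h2 (f, a, b) _ rfl).symm, fun f a b h => h3 (f, a, b) h, fun f a b => h1 _⟩

namespace OE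
variable (A : OE D)

def phi (j : D.I) (a b : Fin 5) (y : Fin 5 → ℝ) : Fin 4 → ℝ :=
  ![y a - y b, ∑ v, if v = a ∨ v = b then 0 else A.O j a b v * y v,
    ∑ k, if k = a ∨ k = b then 0 else A.E (j, k) a b * ∏ v, if v = a ∨ v = b ∨ v = k then 1 else y v,
    (if a < b then 1 else -1) * ∏ v, if v = a ∨ v = b then 1 else y v]

theorem phi_cont (j : D.I) (a b : Fin 5) : Continuous (A.phi j a b) := by
  unfold phi
  refine continuous_pi fun i => ?_
  fin_cases i
  · simp; fun_prop
  · simp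
    refine continuous_finsetSum _ fun v _ => ?_
    split_ifs <;> fun_prop
  · simp
    refine continuous_finsetSum _ fun v _ => ?_
    split_ifs
    · fun_prop
    · refine continuous_const.mul (continuous_finsetProd _ fun v _ => ?_)
      split_ifs <;> fun_prop
  · change Continuous fun y : Fin 5 → ℝ => (if a < b then (1:ℝ) else -1) * ∏ v, if v = a ∨ v = b then (1:ℝ) else y v
    refine continuous_const.mul (continuous_finsetProd _ fun v _ => ?_)
    split_ifs <;> fun_prop

theorem phi_swap (j : D.I) {a b : Fin 5} (h : a ≠ b) (y : Fin 5 → ℝ) : A.phi j b a y = - A.phi j a b y := by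
  funext i
  fin_cases i
  · simp [phi]
  · simp only [phi, Pi.neg_apply]
    simp
    rw [← Finset.sum_neg_distrib]
    refine Finset.sum_congr rfl fun v _ => ?_
    by_cases h1 : v = a <;> by_cases h2 : v = b <;> simp [h1, h2]
    rw [A.O2 j a b v h h1 h2]; ring
  · simp only [phi, Pi.neg_apply]
    simp
    rw [← Finset.sum_neg_distrib]
    refine Finset.sum_congr rfl fun v _ => ?_
    have e : ∀ w, (w = b ∨ w = a ∨ w = v) ↔ (w = a ∨ w = b ∨ w = v) := fun w => by tauto
    by_cases h1 : v = a <;> by_cases h2 : v = b <;> simp [h1, h2]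
    rw [A.E2 _ a b h]
    simp [e]
  · simp only [phi, Pi.neg_apply]
    simp
    have e : ∀ w, (w = b ∨ w = a) ↔ (w = a ∨ w = b) := fun w => by tauto
    simp only [e]
    rcases lt_trichotomy a b with h1 | h1 | h1
    · simp [h1, h1.not_gt]
    · exact absurd h1 h
    · simp [h1, h1.not_gt]

theorem phi_glue (j : D.I) (k : Fin 5) {a b : Fin 5} (y : Fin 5 → ℝ) (hk : y k = 0) (ha : k ≠ a) (hb : k ≠ b) :
    A.phi (D.P (j, k)).1 (D.glue (j, k) a) (D.glue (j, k) b) (y ∘ (D.glue (j, k)).symm) = A.phi j a b y := by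
  set φ := D.glue (j, k) with hφ
  have hPk : ((D.P (j, k)).1, φ k) = D.P (j, k) := by
    rw [hφ]; ext; rfl; exact congrArg _ (D.glue_face (j, k))
  funext i
  fin_cases i
  · simp [phi]
  · simp only [phi]
    simp
    rw [← Equiv.sum_comp φ]
    refine Finset.sum_congr rfl fun v _ => ?_
    simp only [EmbeddingLike.apply_eq_iff_eq, Equiv.symm_apply_apply]
    split_ifs with h1
    · rfl
    · by_cases hv : k = v
      · subst hv; simp [hk]
      · rw [A.O1 j k a b v ha hb hv]
  · simp only [phi]
    simp
    rw [← Equiv.sum_comp φ]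
    refine Finset.sum_congr rfl fun v _ => ?_
    simp only [EmbeddingLike.apply_eq_iff_eq]
    split_ifs with h1
    · rfl
    · have e2 : (∏ w, if w = φ a ∨ w = φ b ∨ w = φ v then 1 else y (φ.symm w)) =
         ∏ w, if w = a ∨ w = b ∨ w = v then 1 else y w := by
        rw [← Equiv.prod_comp φ]
        simp only [EmbeddingLike.apply_eq_iff_eq, Equiv.symm_apply_apply]
      rw [e2]
      by_cases hv : k = v
      · subst hv
        rw [hPk, hφ, A.E1]
      · have : (∏ w, if w = a ∨ w = b ∨ w = v then 1 else y w) = 0 := by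
          apply Finset.prod_eq_zero (Finset.mem_univ k)
          simp [ha, hb, hv, hk]
        rw [this]; simp
  · simp only [phi]
    simp
    have e1 : (∏ w, if w = a ∨ w = b then 1 else y w) = 0 := by
      apply Finset.prod_eq_zero (Finset.mem_univ k)
      simp [ha, hb, hk]
    have e2 : (∏ w, if w = φ a ∨ w = φ b then 1 else y (φ.symm w)) = 0 := by
      apply Finset.prod_eq_zero (Finset.mem_univ (φ k))
      simp [ha, hb, hk]
    rw [e1, e2]; simp

theorem phi_zero (j : D.I) {a b : Fin 5} (h : a ≠ b) (y : Fin 5 → ℝ) (h0 : A.phi j a b y = 0) :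
    y a = y b ∧ ∃ c, c ≠ a ∧ c ≠ b ∧ (∀ v, v ≠ a → v ≠ b → v ≠ c → y v = 0) ∧ A.O j a b c * y c = 0 := by
  have q0 := congrFun h0 0
  have q1 := congrFun h0 1
  have q2 := congrFun h0 2
  have q3 := congrFun h0 3
  simp only [phi] at q0 q1 q2 q3
  have sg : ¬ ((if a < b then (1:ℝ) else -1) = 0) := by split_ifs <;> norm_num
  change (if a < b then (1:ℝ) else -1) * (∏ v, if v = a ∨ v = b then (1:ℝ) else y v) = 0 at q3
  replace q3 := (mul_eq_zero.1 q3).resolve_left sg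
  simp at q0 q1 q2
  refine ⟨by linarith, ?_⟩
  obtain ⟨c, d, e, h1, h2, h3, h4, h5, h6, h7, h8, h9⟩ := five h
  rw [prod5 h h1 h2 h3 h4 h5 h6 h7 h8 h9] at q3
  rw [sum5 h h1 h2 h3 h4 h5 h6 h7 h8 h9] at q1 q2
  simp only [prod5 h h1 h2 h3 h4 h5 h6 h7 h8 h9] at q2
  simp [h1, h2, h3, h4, h5, h6, h7, h8, h9, h7.symm, h8.symm, h9.symm] at q1 q2 q3
  have Ec : A.E (j, c) a b ≠ 0 := by rcases A.E3 (j, c) a b with h | h <;> rw [h] <;> norm_num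
  have Ed : A.E (j, d) a b ≠ 0 := by rcases A.E3 (j, d) a b with h | h <;> rw [h] <;> norm_num
  have Ee : A.E (j, e) a b ≠ 0 := by rcases A.E3 (j, e) a b with h | h <;> rw [h] <;> norm_num
  have key : (y c = 0 ∧ y d = 0) ∨ (y c = 0 ∧ y e = 0) ∨ (y d = 0 ∧ y e = 0) := by
    rcases q3 with (h | h) | h
    · simp [h, Ec] at q2
      tauto
    · simp [h, Ed] at q2
      tauto
    · simp [h, Ee] at q2
      tauto
  have hall : ∀ v, v ≠ a → v ≠ b → v = c ∨ v = d ∨ v = e := by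
    intro v ha hb
    have := Finset.mem_univ v
    rw [univ5 h h1 h2 h3 h4 h5 h6 h7 h8 h9] at this
    simp [ha, hb] at this
    exact this
  rcases key with ⟨k1, k2⟩ | ⟨k1, k2⟩ | ⟨k1, k2⟩
  · refine ⟨e, h5, h6, ?_, ?_⟩
    · intro v ha hb hv
      rcases hall v ha hb with rfl | rfl | rfl
      · exact k1
      · exact k2
      · exact absurd rfl hv
    · simpa [k1, k2] using q1
  · refine ⟨d, h3, h4, ?_, ?_⟩
    · intro v ha hb hv
      rcases hall v ha hb with rfl | rfl | rfl
      · exact k1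
      · exact absurd rfl hv
      · exact k2
    · simpa [k1, k2] using q1
  · refine ⟨c, h1, h2, ?_, ?_⟩
    · intro v ha hb hv
      rcases hall v ha hb with rfl | rfl | rfl
      · exact absurd rfl hv
      · exact k1
      · exact k2
    · simpa [k1, k2] using q1

def fam (j : D.I) (s : Finset (Fin 5)) (y : Fin 5 → ℝ) : Fin 4 → ℝ :=
  if h : ∃ p : Fin 5 × Fin 5, p.1 ≠ p.2 ∧ s = {p.1, p.2} then A.phi j h.choose.1 h.choose.2 y else 0

theorem fam_cont (j : D.I) (s) : Continuous (A.fam j s) := by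
  unfold fam
  split_ifs
  · exact A.phi_cont _ _ _
  · exact continuous_const

theorem fam_pm (j : D.I) {a b : Fin 5} (h : a ≠ b) (y : Fin 5 → ℝ) :
    A.phi j a b y = A.fam j {a, b} y ∨ A.phi j a b y = - A.fam j {a, b} y := by
  have hh : ∃ p : Fin 5 × Fin 5, p.1 ≠ p.2 ∧ ({a, b} : Finset (Fin 5)) = {p.1, p.2} := ⟨(a, b), h, rfl⟩
  unfold fam
  rw [dif_pos hh]
  obtain ⟨h1, h2⟩ := hh.choose_spec
  set p := hh.choose
  have h3 : (a = p.1 ∧ b = p.2) ∨ (a = p.2 ∧ b = p.1) := by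
    have ha : a ∈ ({p.1, p.2} : Finset (Fin 5)) := by rw [← h2]; simp
    have hb : b ∈ ({p.1, p.2} : Finset (Fin 5)) := by rw [← h2]; simp
    simp at ha hb
    grind
  rcases h3 with ⟨e1, e2⟩ | ⟨e1, e2⟩
  · left; rw [← e1, ← e2]
  · right; rw [← e1, ← e2]
    rw [A.phi_swap j h]; simp

def famv (p : GlueTotal D) : Fin 4 → ℝ := A.fam p.1 (bigS p.2.1) p.2.1

theorem tilN_pair {p : GlueTotal D} (hp : p ∈ tilN D) : ∃ a b, a ≠ b ∧ bigS p.2.1 = {a, b} :=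
  Finset.card_eq_two.1 hp

theorem famv_inv (p q : GlueTotal D) (hp : p ∈ tilN D) (h : glueRel D p q) :
    A.famv p = A.famv q ∨ A.famv p = - A.famv q := by
  obtain ⟨j, y⟩ := p
  obtain ⟨j', y'⟩ := q
  obtain ⟨a, b, hab, hs⟩ := tilN_pair hp
  obtain ⟨k, hk, h1, h2⟩ := h
  simp only at hk h1 h2 hs
  have ha : 3/8 < y.1 a := mem_bigS.1 (by rw [hs]; simp)
  have hb : 3/8 < y.1 b := mem_bigS.1 (by rw [hs]; simp)
  have hka : k ≠ a := by rintro rfl; linarith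
  have hkb : k ≠ b := by rintro rfl; linarith
  subst h1
  have hs' : bigS y'.1 = {D.glue (j, k) a, D.glue (j, k) b} := by
    rw [h2, bigS_comp, hs]; simp
  have hab' : D.glue (j, k) a ≠ D.glue (j, k) b := fun h => hab ((D.glue (j,k)).injective h)
  have e := A.phi_glue j k y.1 hk hka hkb
  rw [← h2] at e
  simp only [famv, hs, hs']
  rcases A.fam_pm j hab y.1 with h | h <;> rcases A.fam_pm (D.P (j,k)).1 hab' y'.1 with h' | h' <;>
    rw [e, h] at h'
  · exact Or.inl h'
  · exact Or.inr h'
  · right; rw [← h']; simp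
  · left; simpa using h'

def cX (x : GlueSpace D) : Fin 4 → ℝ := A.famv x.out

theorem cX_cont (i i' : Fin 4) : ContinuousOn (fun x => A.cX x i * A.cX x i') (setN D) := by
  refine desc_cont (tilN_open D) (tilN_sat D) (fun p => A.famv p i * A.famv p i') ?_ ?_
  · refine famCont D (fun j s y => A.fam j s y.1 i * A.fam j s y.1 i') _ (fun _ h => h) ?_
    intro p _
    have : Continuous fun y : Delta 4 => A.fam p.1 (bigS p.2.1) y.1 := (A.fam_cont _ _).comp continuous_subtype_val
    exact (((continuous_apply i).comp this).mul ((continuous_apply i').comp this)).continuousAt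
  · intro p q hp h
    rcases A.famv_inv p q hp h with h | h <;> rw [h]
    simp

theorem cX_pm (p : GlueTotal D) {a b : Fin 5} (h : a ≠ b) (hs : bigS p.2.1 = {a, b}) :
    A.phi p.1 a b p.2.1 = A.cX (Quot.mk _ p) ∨ A.phi p.1 a b p.2.1 = - A.cX (Quot.mk _ p) := by
  have hp : p ∈ tilN D := by
    simp only [tilN, Set.mem_ofPred_eq, hs]; exact Finset.card_pair h
  have := desc_val (tilN_sat D) (fun p => ({A.famv p, -A.famv p} : Set (Fin 4 → ℝ))) (by
    intro p q hp h
    rcases A.famv_inv p q hp h with h | h <;> simp only [h]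
    simp [Set.pair_comm]) p hp
  have h2 : A.famv p = A.cX (Quot.mk _ p) ∨ A.famv p = - A.cX (Quot.mk _ p) := by
    have : A.famv p ∈ ({A.famv (Quot.mk (glueRel D) p).out, -A.famv (Quot.mk (glueRel D) p).out} : Set (Fin 4 → ℝ)) := by
      rw [this]; simp
    simpa [cX] using this
  have h1 := A.fam_pm p.1 h p.2.1
  rw [← hs] at h1
  change _ = A.famv p ∨ _ = - A.famv p at h1
  rcases h1 with h1 | h1 <;> rcases h2 with h2 | h2 <;> rw [h1, h2] <;> simp

end OE

def radX (x : GlueSpace D) : ℝ := 1 - ∑ v ∈ bigS x.out.2.1, x.out.2.1 v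

theorem radX_inv (p q : GlueTotal D) (h : glueRel D p q) : (1 - ∑ v ∈ bigS p.2.1, p.2.1 v) = (1 - ∑ v ∈ bigS q.2.1, q.2.1 v) := by
  obtain ⟨k, _, _, h⟩ := h
  rw [h, bigS_comp, Finset.sum_image (fun _ _ _ _ h => Equiv.injective _ h)]
  simp

theorem radX_mk (p : GlueTotal D) : radX (Quot.mk (glueRel D) p) = 1 - ∑ v ∈ bigS p.2.1, p.2.1 v :=
  desc_val (r := glueRel D) (O := Set.univ) (by simp) (fun p : GlueTotal D => (1 - ∑ v ∈ bigS p.2.1, p.2.1 v)) (fun p q _ h => radX_inv p q h) p trivial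

theorem radX_cont : ContinuousOn (radX (D := D)) (setN D) := by
  refine desc_cont (tilN_open D) (tilN_sat D) (fun p : GlueTotal D => (1 - ∑ v ∈ bigS p.2.1, p.2.1 v)) ?_ (fun p q _ h => radX_inv p q h)
  refine famCont D (fun j s y => 1 - ∑ v ∈ s, y.1 v) _ (fun _ h => h) ?_
  intro p _
  apply Continuous.continuousAt
  exact continuous_const.sub (continuous_finsetSum _ fun v _ => (continuous_apply v).comp continuous_subtype_val)
end

section
variable {D : GlueingDatum 4}

def stdS : Set (Fin 5 → ℝ) := {y | (∀ v, 0 ≤ y v) ∧ ∑ v, y v = 1}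

def toX (D : GlueingDatum 4) (j : D.I) (y : Fin 5 → ℝ) : GlueSpace D :=
  if h : y ∈ stdS then Quot.mk _ ⟨j, ⟨y, h⟩⟩ else Quot.mk _ ⟨j, edgeMidpoint {0, 1} (by decide)⟩

theorem toX_mem {j : D.I} {y : Fin 5 → ℝ} (h : y ∈ stdS) : toX D j y = Quot.mk _ ⟨j, ⟨y, h⟩⟩ := dif_pos h

theorem toX_cont (j : D.I) : ContinuousOn (toX D j) stdS := by
  rw [continuousOn_iff_continuous_domRestrict]
  have : Continuous fun y : stdS => (Quot.mk (glueRel D) ⟨j, y⟩ : GlueSpace D) :=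
    continuous_quot_mk.comp continuous_sigmaMk
  refine this.congr fun y => ?_
  exact (toX_mem y.2).symm

theorem comp_mem_stdS {y : Fin 5 → ℝ} (φ : Equiv.Perm (Fin 5)) : y ∘ φ ∈ stdS ↔ y ∈ stdS := by
  unfold stdS
  simp only [Set.mem_ofPred_eq, Function.comp]
  rw [Equiv.sum_comp φ y, φ.forall_congr_left]; simp

theorem toX_glue (j : D.I) (k : Fin 5) {y : Fin 5 → ℝ} (hy : y ∈ stdS) (hk : y k = 0) :
    toX D j y = toX D (D.P (j, k)).1 (y ∘ (D.glue (j, k)).symm) := by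
  rw [toX_mem hy, toX_mem ((comp_mem_stdS _).2 hy)]
  exact Quot.sound ⟨k, hk, rfl, rfl⟩

def quad (a b c : Fin 5) (α β γ ζ : ℝ) : Fin 5 → ℝ := fun v =>
  if v = a then α else if v = b then β else if v = c then γ else ζ

section quad
variable {a b c : Fin 5} {α β γ ζ : ℝ}
theorem quad_mem (h : a ≠ b) (h1 : c ≠ a) (h2 : c ≠ b) (hα : 0 ≤ α) (hβ : 0 ≤ β) (hγ : 0 ≤ γ) (hζ : 0 ≤ ζ)
    (hs : α + β + γ + 2 * ζ = 1) : quad a b c α β γ ζ ∈ stdS := by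
  constructor
  · intro v; unfold quad; split_ifs <;> assumption
  · obtain ⟨d, e, h3, h4, h5, h6, h7, h8, h9⟩ := five' h h1 h2
    rw [sum5 h h1 h2 h3 h4 h5 h6 h7 h8 h9]
    simp [quad, h.symm, h1, h2, h3, h4, h5, h6, h7.symm, h8.symm]
    linarith

theorem quad_big (h : a ≠ b) (hm : quad a b c α β γ ζ ∈ stdS) (hα : 3/8 < α) (hβ : 3/8 < β) :
    bigS (quad a b c α β γ ζ) = {a, b} := by
  refine bigS_eq hm.1 hm.2 (Finset.card_pair h) ?_
  intro v hv
  simp at hv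
  rcases hv with rfl | rfl
  · simpa [quad] using hα
  · simpa [quad, h.symm] using hβ

theorem quad_toX_mem (j : D.I) (h : a ≠ b) (hm : quad a b c α β γ ζ ∈ stdS) (hα : 3/8 < α) (hβ : 3/8 < β) :
    toX D j (quad a b c α β γ ζ) ∈ setN D := by
  rw [toX_mem hm]
  refine ⟨_, ?_, rfl⟩
  simp only [tilN, Set.mem_ofPred_eq, quad_big h hm hα hβ]
  exact Finset.card_pair h

theorem quad_rad (j : D.I) (h : a ≠ b) (hm : quad a b c α β γ ζ ∈ stdS) (hα : 3/8 < α) (hβ : 3/8 < β) :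
    radX (toX D j (quad a b c α β γ ζ)) = 1 - (α + β) := by
  rw [toX_mem hm, radX_mk]
  simp only [quad_big h hm hα hβ]
  rw [Finset.sum_pair h]
  simp [quad, h.symm]

theorem quad_pm (A : OE D) (j : D.I) (h : a ≠ b) (hm : quad a b c α β γ ζ ∈ stdS) (hα : 3/8 < α) (hβ : 3/8 < β) :
    A.phi j a b (quad a b c α β γ ζ) = A.cX (toX D j (quad a b c α β γ ζ)) ∨
    A.phi j a b (quad a b c α β γ ζ) = - A.cX (toX D j (quad a b c α β γ ζ)) := by
  rw [toX_mem hm]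
  exact A.cX_pm ⟨j, ⟨_, hm⟩⟩ h (quad_big h hm hα hβ)

theorem quad_phi0 (A : OE D) (j : D.I) (h : a ≠ b) (h1 : c ≠ a) (h2 : c ≠ b)
    (h0 : A.phi j a b (quad a b c α β γ ζ) = 0) : α = β ∧ ζ = 0 := by
  obtain ⟨e1, c', hc1, hc2, hc3, -⟩ := A.phi_zero j h _ h0
  refine ⟨by simpa [quad, h.symm] using e1, ?_⟩
  obtain ⟨d, e, h3, h4, h5, h6, h7, h8, h9⟩ := five' h h1 h2
  by_cases hd : d = c'
  · have := hc3 e h5 h6 (by rw [← hd]; exact h9.symm)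
    simpa [quad, h5, h6, h8.symm] using this
  · have := hc3 d h3 h4 hd
    simpa [quad, h3, h4, h7.symm] using this

theorem quad_c0 (A : OE D) (j : D.I) (h : a ≠ b) (h1 : c ≠ a) (h2 : c ≠ b) (hm : quad a b c α β γ ζ ∈ stdS)
    (hα : 3/8 < α) (hβ : 3/8 < β) (h0 : A.cX (toX D j (quad a b c α β γ ζ)) = 0) : α = β ∧ ζ = 0 := by
  apply quad_phi0 A j h h1 h2
  rcases quad_pm A j h hm hα hβ with e | e <;> rw [e, h0] <;> simp

theorem phi_quad_zero (A : OE D) (j : D.I) (h : a ≠ b) : A.phi j a b (quad a b c α β γ ζ) 0 = α - β := by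
  simp [OE.phi, quad, h.symm]

theorem quad_cont {Y : Type*} [TopologicalSpace Y] (a b c : Fin 5) {f1 f2 f3 f4 : Y → ℝ} (h1 : Continuous f1) (h2 : Continuous f2)
    (h3 : Continuous f3) (h4 : Continuous f4) : Continuous fun x => quad a b c (f1 x) (f2 x) (f3 x) (f4 x) := by
  refine continuous_pi fun v => ?_
  unfold quad
  split_ifs <;> assumption
end quad

abbrev Trip (D : GlueingDatum 4) := D.I × Fin 5 × Fin 5 × Fin 5

def rT (D : GlueingDatum 4) (x y : Trip D) : Prop := ∃ k, k ≠ x.2.1 ∧ k ≠ x.2.2.1 ∧ k ≠ x.2.2.2 ∧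
  y = ((D.P (x.1, k)).1, D.glue (x.1, k) x.2.1, D.glue (x.1, k) x.2.2.1, D.glue (x.1, k) x.2.2.2)

theorem rT_toX {x y : Trip D} (h : Quot.mk (rT D) x = Quot.mk (rT D) y) (α β γ : ℝ) :
    (quad x.2.1 x.2.2.1 x.2.2.2 α β γ 0 ∈ stdS → 
      toX D x.1 (quad x.2.1 x.2.2.1 x.2.2.2 α β γ 0) = toX D y.1 (quad y.2.1 y.2.2.1 y.2.2.2 α β γ 0)) := by
  refine (eqvGen_prop (fun x y : Trip D => (quad x.2.1 x.2.2.1 x.2.2.2 α β γ 0 ∈ stdS ↔ quad y.2.1 y.2.2.1 y.2.2.2 α β γ 0 ∈ stdS) ∧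
    (quad x.2.1 x.2.2.1 x.2.2.2 α β γ 0 ∈ stdS → 
      toX D x.1 (quad x.2.1 x.2.2.1 x.2.2.2 α β γ 0) = toX D y.1 (quad y.2.1 y.2.2.1 y.2.2.2 α β γ 0)))
      ?_ (fun _ => ⟨Iff.rfl, fun _ => rfl⟩) (fun _ _ h => ⟨h.1.symm, fun hy => (h.2 (h.1.2 hy)).symm⟩)
      (fun _ _ _ h h' => ⟨h.1.trans h'.1, fun hx => (h.2 hx).trans (h'.2 (h.1.1 hx))⟩) h).2
  rintro ⟨j, a, b, c⟩ _ ⟨k, ha, hb, hc, rfl⟩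
  simp only at ha hb hc ⊢
  have e : quad (D.glue (j, k) a) (D.glue (j, k) b) (D.glue (j, k) c) α β γ 0 = quad a b c α β γ 0 ∘ (D.glue (j,k)).symm := by
    funext v
    simp [quad, Equiv.symm_apply_eq]
  rw [e]
  refine ⟨(comp_mem_stdS _).symm, fun hm => toX_glue j k hm ?_⟩
  simp [quad, ha, hb, hc]

def badP (D : GlueingDatum 4) (r : ℝ) : Set (GlueSpace D) := Set.range fun x : Trip D =>
  toX D x.1 (quad x.2.1 x.2.2.1 x.2.2.2 ((1 - r)/2) ((1-r)/2) r 0)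

theorem badP_fin (r : ℝ) : (badP D r).Finite := Set.finite_range _

theorem cX_zero (A : OE D) {x : GlueSpace D} (hx : x ∈ setN D) (h0 : A.cX x = 0) :
    ∃ j a b c, a ≠ b ∧ c ≠ a ∧ c ≠ b ∧
      x = toX D j (quad a b c ((1 - radX x)/2) ((1 - radX x)/2) (radX x) 0) ∧ A.O j a b c * radX x = 0 := by
  obtain ⟨⟨j, y⟩, hp, rfl⟩ := hx
  obtain ⟨a, b, hab, hs⟩ := OE.tilN_pair hp
  have hphi : A.phi j a b y.1 = 0 := by
    rcases A.cX_pm ⟨j, y⟩ hab hs with e | e <;> rw [h0] at e <;> simpa using e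
  obtain ⟨e1, c, hc1, hc2, hc3, hc4⟩ := A.phi_zero j hab _ hphi
  have hr : radX (Quot.mk (glueRel D) ⟨j, y⟩) = 1 - (y.1 a + y.1 b) := by
    rw [radX_mk, hs, Finset.sum_pair hab]
  obtain ⟨d, e, h3, h4, h5, h6, h7, h8, h9⟩ := five' hab hc1 hc2
  have hsum := y.2.2
  rw [sum5 hab hc1 hc2 h3 h4 h5 h6 h7 h8 h9, hc3 d h3 h4 h7.symm, hc3 e h5 h6 h8.symm] at hsum
  have hyc : y.1 c = radX (Quot.mk (glueRel D) ⟨j, y⟩) := by rw [hr]; linarith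
  refine ⟨j, a, b, c, hab, hc1, hc2, ?_, by rw [← hyc]; exact hc4⟩
  have hq : quad a b c ((1 - radX (Quot.mk (glueRel D) ⟨j, y⟩))/2) ((1 - radX (Quot.mk (glueRel D) ⟨j, y⟩))/2) 
     (radX (Quot.mk (glueRel D) ⟨j, y⟩)) 0 = y.1 := by
    rw [hr]
    funext v
    unfold quad
    split_ifs with q1 q2 q3
    · subst q1; linarith
    · subst q2; linarith
    · subst q3; linarith
    · exact (hc3 v q1 q2 q3).symm
  rw [hq, toX_mem y.2]

def Euclid (D : GlueingDatum 4) : Prop := ∀ (i : D.I) (s : Finset (Fin 5)) (hs : s.card = 2),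
        ∃ U : Set (GlueSpace D), IsOpen U ∧
          Quot.mk (glueRel D) ⟨i, edgeMidpoint s hs⟩ ∈ U ∧
          Nonempty (↥U ≃ₜ EuclideanSpace ℝ (Fin 4))

theorem Euclid_quad (H : Euclid D) (j : D.I) {a b : Fin 5} (h : a ≠ b) (c : Fin 5) (h1 : c ≠ a) (h2 : c ≠ b) : ∃ U : Set (GlueSpace D), IsOpen U ∧
    toX D j (quad a b c (1/2) (1/2) 0 0) ∈ U ∧ Nonempty (U ≃ₜ E4) := by
  obtain ⟨U, h3, h4, h5⟩ := H j {a, b} (Finset.card_pair h)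
  refine ⟨U, h3, ?_, h5⟩
  convert h4
  rw [toX_mem (quad_mem h h1 h2 (by norm_num) (by norm_num) le_rfl le_rfl (by norm_num))]
  congr 2
  apply Subtype.ext
  funext v
  simp [quad, edgeMidpoint]
  grind

theorem nice_nhd {U : Set (GlueSpace D)} (hU : IsOpen U) (h : Nonempty (U ≃ₜ E4)) {q : GlueSpace D} (hq : q ∈ U) (hN : q ∈ setN D)
    (F : Set (GlueSpace D)) (hF : F.Finite) : ∃ U', IsOpen U' ∧ q ∈ U' ∧ Nonempty (U' ≃ₜ E4) ∧ U' ⊆ setN D ∧ ∀ x ∈ U', x ∈ F → x = q := by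
  have hV : setN D \ (F \ {q}) ∈ nhds q := by
    apply IsOpen.mem_nhds ((setN_open D).sdiff (hF.subset Set.sdiff_subset).isClosed)
    exact ⟨hN, fun h => h.2 rfl⟩
  obtain ⟨U', h1, h2, h3, h4⟩ := shrink hU h hq hV
  refine ⟨U', h1, h2, h4, fun x hx => (h3 hx).1, fun x hx hb => ?_⟩
  by_contra hne
  exact (h3 hx).2 ⟨hb, hne⟩

theorem signW_self {X : Type*} {m : ℕ} (c : X → (Fin m → ℝ)) (x : X) : signW c x x = 0 := by
  unfold signW
  rw [if_neg]
  unfold vdot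
  exact not_lt.2 (Finset.sum_nonneg fun i _ => mul_self_nonneg _)

theorem cX_isAS (A : OE D) (O : Set (GlueSpace D)) (hO : IsOpen O) (hN : O ⊆ setN D) (h0 : ∀ x ∈ O, A.cX x ≠ 0) : IsAS (signW A.cX) O :=
  signW_isAS _ hO (fun i j => (A.cX_cont i j).mono hN) h0

theorem trigne (s : ℝ) (h : Real.cos s = 0) (h' : Real.sin s = 0) : False := by
  have := Real.sin_sq_add_cos_sq s
  rw [h, h'] at this; norm_num at this
end

section
variable {D : GlueingDatum 4}

theorem cX_ne_open (A : OE D) {U : Set (GlueSpace D)} (hU : IsOpen U) (hN : U ⊆ setN D) : IsOpen {x | x ∈ U ∧ A.cX x ≠ 0} := by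
  have : {x | x ∈ U ∧ A.cX x ≠ 0} = ⋃ i : Fin 4, U ∩ (fun x => A.cX x i * A.cX x i) ⁻¹' {0}ᶜ := by
    ext x
    simp only [Set.mem_ofPred_eq, Set.mem_iUnion, Set.mem_inter_iff, Set.mem_preimage, Set.mem_compl_iff, Set.mem_singleton_iff,
      mul_self_eq_zero, exists_and_left, ne_eq, funext_iff, Pi.zero_apply, not_forall]
  rw [this]
  exact isOpen_iUnion fun i => ((A.cX_cont i i).mono hN).isOpen_inter_preimage hU isOpen_compl_singleton

theorem phi_quad_eq0 (A : OE D) (j : D.I) {a b c : Fin 5} (hab : a ≠ b) (h1 : c ≠ a) (h2 : c ≠ b) {α γ : ℝ}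
    (hO : A.O j a b c * γ = 0) : A.phi j a b (quad a b c α α γ 0) = 0 := by
  obtain ⟨d, e, h3, h4, h5, h6, h7, h8, h9⟩ := five' hab h1 h2
  have hv : ∀ v, v ≠ a → v ≠ b → v ≠ c → quad a b c α α γ 0 v = 0 := by
    intro v q1 q2 q3; simp [quad, q1, q2, q3]
  have hP : ∀ (S : Fin 5 → Prop) [DecidablePred S], (∃ v, v ≠ a ∧ v ≠ b ∧ v ≠ c ∧ ¬ S v) → (∏ v, if S v then 1 else quad a b c α α γ 0 v) = 0 := by
    rintro S _ ⟨v, k1, k2, k3, k4⟩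
    apply Finset.prod_eq_zero (Finset.mem_univ v)
    rw [if_neg k4, hv v k1 k2 k3]
  funext i
  unfold OE.phi
  fin_cases i
  · simp [quad, hab.symm]
  · simp
    refine Finset.sum_eq_zero fun v _ => ?_
    split_ifs with hh
    · rfl
    · push Not at hh
      by_cases hvc : v = c
      · rw [hvc]; simpa [quad, h1, h2] using hO
      · rw [hv v hh.1 hh.2 hvc]; simp
  · simp
    refine Finset.sum_eq_zero fun v _ => ?_
    split_ifs with hh
    · rfl
    · rw [hP, mul_zero]
      by_cases hvd : v = d
      · exact ⟨e, h5, h6, h8.symm, by rw [hvd]; simp [h5, h6, h9.symm]⟩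
      · exact ⟨d, h3, h4, h7.symm, by simp [h3, h4, Ne.symm hvd]⟩
  · change _ * (∏ v, if v = a ∨ v = b then 1 else quad a b c α α γ 0 v) = (0:ℝ)
    rw [hP, mul_zero]
    exact ⟨d, h3, h4, h7.symm, by simp [h3, h4]⟩

theorem T4b (H : Euclid D) (A : OE D) (hA : ∀ j a b c, A.O j a b c ≠ 0) (j : D.I) {a b : Fin 5} (hab : a ≠ b)
    (hc : Quot.mk (rT D) (j, a, b, a) = Quot.mk (rT D) (j, b, a, b)) : False := by
  obtain ⟨c, d, e, h1, h2, -⟩ := five hab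
  obtain ⟨U₀, hU₀, hq₀, hE₀⟩ := Euclid_quad H j hab c h1 h2
  have hm0 : quad a b c (1/2) (1/2) 0 0 ∈ stdS := quad_mem hab h1 h2 (by norm_num) (by norm_num) le_rfl le_rfl (by norm_num)
  set q := toX D j (quad a b c (1/2) (1/2) 0 0) with hq
  have hqN : q ∈ setN D := quad_toX_mem j hab hm0 (by norm_num) (by norm_num)
  obtain ⟨U, hU, hqU, ⟨ψ⟩, hUN, hUF⟩ := nice_nhd hU₀ hE₀ hq₀ hqN _ (badP_fin (D := D) 0)
  let Y : ℝ × ℝ → Fin 5 → ℝ := fun z => quad a b c ((1 - 3 * (z.1 * Real.sin (Real.pi * z.2)) + z.1 * Real.cos (Real.pi * z.2))/2)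
    ((1 - 3 * (z.1 * Real.sin (Real.pi * z.2)) - z.1 * Real.cos (Real.pi * z.2))/2) (z.1 * Real.sin (Real.pi * z.2)) (z.1 * Real.sin (Real.pi * z.2))
  have hYc : Continuous Y := by
    apply quad_cont <;> fun_prop
  have hest : ∀ z ∈ Set.Icc (0:ℝ) (1/100) ×ˢ Set.Icc (0:ℝ) 1, 0 ≤ z.1 * Real.sin (Real.pi * z.2) ∧ z.1 * Real.sin (Real.pi * z.2) ≤ 1/100 ∧
      z.1 * Real.cos (Real.pi * z.2) ≤ 1/100 ∧ -(1/100) ≤ z.1 * Real.cos (Real.pi * z.2) := by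
    rintro ⟨δ, s⟩ ⟨⟨hd, hd'⟩, hs, hs'⟩
    simp only at hd hd' hs hs' ⊢
    have hpi := Real.pi_pos
    have g1 : 0 ≤ Real.sin (Real.pi * s) := Real.sin_nonneg_of_nonneg_of_le_pi (by positivity) (by nlinarith)
    have g2 := Real.sin_le_one (Real.pi * s)
    have g3 := Real.cos_le_one (Real.pi * s)
    have g4 := Real.neg_one_le_cos (Real.pi * s)
    refine ⟨by positivity, by nlinarith, by nlinarith, by nlinarith⟩
  have hYm : ∀ z ∈ Set.Icc (0:ℝ) (1/100) ×ˢ Set.Icc (0:ℝ) 1, Y z ∈ stdS := by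
    intro z hz
    obtain ⟨g1, g2, g3, g4⟩ := hest z hz
    apply quad_mem hab h1 h2 <;> linarith
  have hcont : ContinuousOn (fun z => toX D j (Y z)) (Set.Icc (0:ℝ) (1/100) ×ˢ Set.Icc (0:ℝ) 1) :=
    (toX_cont j).comp hYc.continuousOn hYm
  obtain ⟨δ, hδ, hδ', hin⟩ := tube_small (isCompact_Icc (a := (0:ℝ)) (b := 1)) _ (by norm_num) hcont hU (by
    intro s hs
    have : Y (0, s) = quad a b c (1/2) (1/2) 0 0 := by simp [Y]
    simp only [this]; exact hqU)
  have hdom : ∀ s ∈ Set.Icc (0:ℝ) 1, (δ, s) ∈ Set.Icc (0:ℝ) (1/100) ×ˢ Set.Icc (0:ℝ) 1 := fun s hs => ⟨⟨hδ.le, hδ'⟩, hs⟩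
  have hpm : ∀ s ∈ Set.Icc (0:ℝ) 1, A.phi j a b (Y (δ, s)) = A.cX (toX D j (Y (δ, s))) ∨ A.phi j a b (Y (δ, s)) = - A.cX (toX D j (Y (δ, s))) := by
    intro s hs
    obtain ⟨g1, g2, g3, g4⟩ := hest _ (hdom s hs)
    refine quad_pm A j hab (hYm _ (hdom s hs)) ?_ ?_ <;> linarith
  have hphi0 : ∀ s, A.phi j a b (Y (δ, s)) ≠ 0 := by
    intro s h0
    obtain ⟨k1, k2⟩ := quad_phi0 A j hab h1 h2 h0
    simp only at k1 k2
    have k3 : δ * Real.cos (Real.pi * s) = 0 := by linarith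
    exact trigne _ ((mul_eq_zero.1 k3).resolve_left hδ.ne') ((mul_eq_zero.1 k2).resolve_left hδ.ne')
  have hc0 : A.cX q = 0 := by
    have : A.phi j a b (quad a b c (1/2) (1/2) 0 0) = 0 := phi_quad_eq0 A j hab h1 h2 (by simp)
    rcases quad_pm A j hab hm0 (by norm_num) (by norm_num) with k | k <;> rw [this] at k
    · exact k.symm
    · exact neg_eq_zero.1 k.symm
  have hloop : toX D j (Y (δ, 0)) = toX D j (Y (δ, 1)) := by
    have e0 : Y (δ, 0) = quad a b a ((1 + δ)/2) ((1-δ)/2) 0 0 := by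
      funext v; simp [Y, quad]
    have e1 : Y (δ, 1) = quad b a b ((1 + δ)/2) ((1-δ)/2) 0 0 := by
      funext v; simp [Y, quad]; grind
    rw [e0, e1]
    apply rT_toX (x := (j, a, b, a)) (y := (j, b, a, b)) hc
    simp only
    rw [← e0]; exact hYm _ (hdom 0 (by simp))
  have hw : ∀ᶠ n in Filter.atTop, hol (signW A.cX) (fun s => toX D j (Y (δ, s))) n = 0 := by
    refine lemmaA ψ q hqU (signW A.cX) ?_ (signW_self _) _ ?_ ?_ hloop
    · apply cX_isAS A _ (hU.sdiff isClosed_singleton) (fun x hx => hUN hx.1)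
      rintro x ⟨hx, hxq⟩ h0
      apply hxq
      obtain ⟨j', a', b', c', k1, k2, k3, k4, k5⟩ := cX_zero A (hUN hx) h0
      have hr := (mul_eq_zero.1 k5).resolve_left (hA _ _ _ _)
      rw [hr] at k4
      exact hUF x hx ⟨(j', a', b', c'), k4.symm⟩
    · exact hcont.comp (by fun_prop) (fun s hs => hdom s hs)
    · intro s hs
      refine ⟨hin s hs, ?_⟩
      intro hh
      have hh : toX D j (Y (δ, s)) = q := hh
      rcases hpm s hs with k | k <;> rw [hh, hc0] at k
      · exact hphi0 s k
      · exact hphi0 s (by simpa using k)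
  have := hol_lift A.cX _ (fun s => A.phi j a b (Y (δ, s))) 
    (((A.phi_cont j a b).comp (hYc.comp (by fun_prop))).continuousOn) (fun s _ => hphi0 s) hpm hloop hw
  have := congrFun this 0
  simp only [Y, phi_quad_zero A j hab] at this
  simp at this
  linarith

theorem T4a (H : Euclid D) (A : OE D) (hA : ∀ j a b c, A.O j a b c = 0) (j : D.I) {a b c : Fin 5} (hab : a ≠ b) (h1 : c ≠ a) (h2 : c ≠ b)
    (hc : Quot.mk (rT D) (j, a, b, c) = Quot.mk (rT D) (j, b, a, c)) : False := by
  obtain ⟨U₀, hU₀, hq₀, hE₀⟩ := Euclid_quad H j hab c h1 h2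
  obtain ⟨ε, hε, hε', hin0⟩ := tube_small (isCompact_singleton (x := ()))
    (fun z : ℝ × Unit => toX D j (quad a b c ((1 - z.1)/2) ((1 - z.1)/2) z.1 0)) (δ₀ := 1/16) (by norm_num) (by
      refine (toX_cont j).comp (quad_cont _ _ _ (by fun_prop) (by fun_prop) (by fun_prop) (by fun_prop)).continuousOn ?_
      rintro ⟨z, _⟩ ⟨⟨k1, k2⟩, -⟩
      simp only at k1 k2
      apply quad_mem hab h1 h2 <;> linarith) hU₀ (by
        intro k _; simpa using hq₀)
  have hq0 := hin0 () rfl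
  simp only at hq0
  have hm0 : quad a b c ((1 - ε)/2) ((1 - ε)/2) ε 0 ∈ stdS := by
    apply quad_mem hab h1 h2 <;> linarith
  set q := toX D j (quad a b c ((1 - ε)/2) ((1 - ε)/2) ε 0) with hq
  have hqN : q ∈ setN D := quad_toX_mem j hab hm0 (by linarith) (by linarith)
  have hqr : radX q = ε := by rw [hq, quad_rad j hab hm0 (by linarith) (by linarith)]; ring
  obtain ⟨U, hU, hqU, ⟨ψ⟩, hUN, hUF⟩ := nice_nhd hU₀ hE₀ hq0 hqN _ (badP_fin (D := D) ε)
  let Y : ℝ × ℝ × ℝ → Fin 5 → ℝ := fun z => quad a b c 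
    ((1 - (ε + z.1 * z.2.2) - 2 * (z.1 * ((1 - |z.2.2|) * Real.sin (Real.pi * z.2.1))) + z.1 * ((1 - |z.2.2|) * Real.cos (Real.pi * z.2.1)))/2)
    ((1 - (ε + z.1 * z.2.2) - 2 * (z.1 * ((1 - |z.2.2|) * Real.sin (Real.pi * z.2.1))) - z.1 * ((1 - |z.2.2|) * Real.cos (Real.pi * z.2.1)))/2)
    (ε + z.1 * z.2.2) (z.1 * ((1 - |z.2.2|) * Real.sin (Real.pi * z.2.1)))
  have hYc : Continuous Y := by
    apply quad_cont <;> fun_prop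
  set δ₀ := min ε (1/100) with hδ₀
  have hδ₀' : 0 < δ₀ := by positivity
  set K : Set (ℝ × ℝ) := Set.Icc (0:ℝ) 1 ×ˢ Set.Icc (-1:ℝ) 1 with hK
  have hest : ∀ z ∈ Set.Icc (0:ℝ) δ₀ ×ˢ K, 0 ≤ z.1 * ((1 - |z.2.2|) * Real.sin (Real.pi * z.2.1)) ∧ 
      z.1 * ((1 - |z.2.2|) * Real.sin (Real.pi * z.2.1)) ≤ 1/100 ∧
      z.1 * ((1 - |z.2.2|) * Real.cos (Real.pi * z.2.1)) ≤ 1/100 ∧ -(1/100) ≤ z.1 * ((1 - |z.2.2|) * Real.cos (Real.pi * z.2.1)) ∧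
      0 ≤ ε + z.1 * z.2.2 ∧ z.1 * z.2.2 ≤ 1/100 := by
    rintro ⟨δ, s, t⟩ ⟨⟨hd, hd'⟩, ⟨hs, hs'⟩, ht, ht'⟩
    simp only at hd hd' hs hs' ht ht' ⊢
    have k1 : δ ≤ ε := hd'.trans (min_le_left _ _)
    have k2 : δ ≤ 1/100 := hd'.trans (min_le_right _ _)
    have hpi := Real.pi_pos
    have g1 : 0 ≤ Real.sin (Real.pi * s) := Real.sin_nonneg_of_nonneg_of_le_pi (by positivity) (by nlinarith)
    have g2 := Real.sin_le_one (Real.pi * s)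
    have g3 := Real.cos_le_one (Real.pi * s)
    have g4 := Real.neg_one_le_cos (Real.pi * s)
    have g5 : |t| ≤ 1 := abs_le.2 ⟨ht, ht'⟩
    have g6 := abs_nonneg t
    have g7 : 0 ≤ 1 - |t| := by linarith
    have p1 : (1 - |t|) * Real.sin (Real.pi * s) ≤ 1 := by nlinarith
    have p2 : 0 ≤ (1 - |t|) * Real.sin (Real.pi * s) := by positivity
    have p3 : (1 - |t|) * Real.cos (Real.pi * s) ≤ 1 := by nlinarith
    have p4 : -1 ≤ (1 - |t|) * Real.cos (Real.pi * s) := by nlinarith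
    refine ⟨by positivity, by nlinarith, by nlinarith, by nlinarith, by nlinarith, by nlinarith⟩
  have hYm : ∀ z ∈ Set.Icc (0:ℝ) δ₀ ×ˢ K, Y z ∈ stdS := by
    intro z hz
    obtain ⟨g1, g2, g3, g4, g5, g6⟩ := hest z hz
    apply quad_mem hab h1 h2 <;> linarith
  have hcont : ContinuousOn (fun z => toX D j (Y z)) (Set.Icc (0:ℝ) δ₀ ×ˢ K) :=
    (toX_cont j).comp hYc.continuousOn hYm
  obtain ⟨δ, hδ, hδ', hin⟩ := tube_small (isCompact_Icc.prod isCompact_Icc : IsCompact K) _ hδ₀' hcont hU (by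
    intro s hs
    have : Y (0, s) = quad a b c ((1 - ε)/2) ((1 - ε)/2) ε 0 := by simp [Y]
    simp only [this]; exact hqU)
  have hdom : ∀ s ∈ K, (δ, s) ∈ Set.Icc (0:ℝ) δ₀ ×ˢ K := fun s hs => ⟨⟨hδ.le, hδ'⟩, hs⟩
  have hpm : ∀ s ∈ K, A.phi j a b (Y (δ, s)) = A.cX (toX D j (Y (δ, s))) ∨ A.phi j a b (Y (δ, s)) = - A.cX (toX D j (Y (δ, s))) := by
    intro s hs
    obtain ⟨g1, g2, g3, g4, g5, g6⟩ := hest _ (hdom s hs)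
    refine quad_pm A j hab (hYm _ (hdom s hs)) ?_ ?_ <;> linarith
  have hrad : ∀ s ∈ K, radX (toX D j (Y (δ, s))) = ε + δ * s.2 + 2 * (δ * ((1 - |s.2|) * Real.sin (Real.pi * s.1))) := by
    intro s hs
    obtain ⟨g1, g2, g3, g4, g5, g6⟩ := hest _ (hdom s hs)
    simp only [Y]
    rw [quad_rad j hab (hYm _ (hdom s hs)) (by linarith) (by linarith)]
    ring
  have hphi0 : ∀ s : ℝ × ℝ, A.phi j a b (Y (δ, s)) = 0 → |s.2| = 1 := by
    intro s h0
    obtain ⟨k1, k2⟩ := quad_phi0 A j hab h1 h2 h0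
    simp only at k1 k2
    have k3 : δ * ((1 - |s.2|) * Real.cos (Real.pi * s.1)) = 0 := by linarith
    by_contra hne
    have hne' : 1 - |s.2| ≠ 0 := fun h => hne (by linarith)
    simp [hδ.ne', hne'] at k2 k3
    exact trigne _ k3 k2
  have hcX0 : ∀ s ∈ K, A.cX (toX D j (Y (δ, s))) = 0 → |s.2| = 1 ∧ radX (toX D j (Y (δ, s))) = ε + δ * s.2 := by
    intro s hs h0
    have : |s.2| = 1 := by
      apply hphi0
      rcases hpm s hs with k | k <;> rw [k, h0] <;> simp
    refine ⟨this, ?_⟩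
    rw [hrad s hs, this]; ring
  have hcq : A.cX q = 0 ∨ True := Or.inr trivial
  have hsw : ∀ t ∈ Set.Icc (-1:ℝ) 1, toX D j (Y (δ, 0, t)) = toX D j (Y (δ, 1, t)) := by
    intro t ht
    have e0 : Y (δ, 0, t) = quad a b c ((1 - (ε + δ * t) + δ * (1 - |t|))/2) ((1 - (ε + δ * t) - δ * (1 - |t|))/2) (ε + δ * t) 0 := by
      funext v; simp [Y, quad]
    have e1 : Y (δ, 1, t) = quad b a c ((1 - (ε + δ * t) + δ * (1 - |t|))/2) ((1 - (ε + δ * t) - δ * (1 - |t|))/2) (ε + δ * t) 0 := by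
      funext v; simp [Y, quad]; grind
    rw [e0, e1]
    apply rT_toX (x := (j, a, b, c)) (y := (j, b, a, c)) hc
    simp only
    rw [← e0]; exact hYm _ (hdom (0, t) ⟨by simp, ht⟩)
  have hUne : IsOpen {x | x ∈ U ∧ A.cX x ≠ 0} := cX_ne_open A hU hUN
  have hw : ∀ᶠ n in Filter.atTop, hol (signW A.cX) (fun s => toX D j (Y (δ, s, 0))) n = 0 := by
    refine lemmaB ψ q hqU {x | A.cX x = 0 ∧ ε ≤ radX x} {x | A.cX x = 0 ∧ radX x ≤ ε} ?_ ?_ ?_ (signW A.cX) ?_ (signW_self _)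
      (fun s => toX D j (Y (δ, s))) ?_ ?_ hsw ?_ ?_ ?_ ?_
    · have : U \ {x | A.cX x = 0 ∧ ε ≤ radX x} = {x | x ∈ U ∧ A.cX x ≠ 0} ∪ (U ∩ radX ⁻¹' (Set.Iio ε)) := by
        ext x; simp; tauto
      rw [this]
      exact hUne.union ((radX_cont.mono hUN).isOpen_inter_preimage hU isOpen_Iio)
    · have : U \ {x | A.cX x = 0 ∧ radX x ≤ ε} = {x | x ∈ U ∧ A.cX x ≠ 0} ∪ (U ∩ radX ⁻¹' (Set.Ioi ε)) := by
        ext x; simp; tauto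
      rw [this]
      exact hUne.union ((radX_cont.mono hUN).isOpen_inter_preimage hU isOpen_Ioi)
    · rintro x hx ⟨hx0, hx1⟩ ⟨-, hx2⟩
      have hr : radX x = ε := le_antisymm hx2 hx1
      obtain ⟨j', a', b', c', k1, k2, k3, k4, k5⟩ := cX_zero A (hUN hx) hx0
      rw [hr] at k4
      exact hUF x hx ⟨(j', a', b', c'), k4.symm⟩
    · have : U \ ({x | A.cX x = 0 ∧ ε ≤ radX x} ∪ {x | A.cX x = 0 ∧ radX x ≤ ε}) = {x | x ∈ U ∧ A.cX x ≠ 0} := by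
        ext x
        simp only [Set.mem_sdiff, Set.mem_union, Set.mem_ofPred_eq, not_or, not_and, not_le]
        constructor
        · rintro ⟨h1, h2, h3⟩
          refine ⟨h1, fun h => ?_⟩
          have := h2 h; have := h3 h; linarith
        · rintro ⟨h1, h2⟩
          exact ⟨h1, fun h => absurd h h2, fun h => absurd h h2⟩
      rw [this]
      exact cX_isAS A _ hUne (fun x hx => hUN hx.1) (fun x hx => hx.2)
    · exact hcont.comp (by fun_prop) (fun s hs => hdom s hs)
    · intro s hs t ht
      refine ⟨hin (s, t) ⟨hs, ht⟩, ?_⟩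
      intro hh
      have hh : toX D j (Y (δ, s, t)) = q := hh
      have hr := hrad (s, t) ⟨hs, ht⟩
      have hph := hpm (s, t) ⟨hs, ht⟩
      have hq' := quad_pm A j hab hm0 (by linarith) (by linarith)
      rw [← hq] at hq'
      have hz : |t| = 1 ∧ radX (toX D j (Y (δ, s, t))) = ε + δ * t := by
        apply hcX0 (s, t) ⟨hs, ht⟩
        rw [hh]
        have hx : A.phi j a b (quad a b c ((1 - ε)/2) ((1 - ε)/2) ε 0) = 0 := phi_quad_eq0 A j hab h1 h2 (by rw [hA]; simp)
        rw [hx] at hq'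
        rcases hq' with k | k
        · exact k.symm
        · exact neg_eq_zero.1 k.symm
      rw [hh, hqr] at hz
      have : δ * t = 0 := by linarith
      rcases mul_eq_zero.1 this with k | k
      · exact hδ.ne' k
      · rw [k] at hz; simp at hz
    · intro s _
      simp [Y]
    · intro s _
      simp [Y]
    · rintro s hs t ht ⟨k1, k2⟩
      obtain ⟨k3, k4⟩ := hcX0 (s, t) ⟨hs, by linarith [ht.1], ht.2⟩ k1
      simp only at k3 k4
      rw [abs_of_nonneg ht.1] at k3
      rw [k4, k3] at k2; linarith
    · rintro s hs t ht ⟨k1, k2⟩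
      obtain ⟨k3, k4⟩ := hcX0 (s, t) ⟨hs, ht.1, by linarith [ht.2]⟩ k1
      simp only at k3 k4
      rw [abs_of_nonpos ht.2] at k3
      rw [k4] at k2
      nlinarith
  have := hol_lift A.cX _ (fun s => A.phi j a b (Y (δ, s, 0))) 
    (((A.phi_cont j a b).comp (hYc.comp (by fun_prop))).continuousOn) (fun s _ h0 => by
      have := hphi0 _ h0; simp at this) (fun s hs => hpm (s, 0) ⟨hs, by simp⟩) (hsw 0 (by simp)) hw
  have := congrFun this 0
  simp only [Y, phi_quad_zero A j hab] at this
  simp at this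
  linarith
end

section
theorem dir_of_euclid {D : GlueingDatum 4} (H : Euclid D) : Dir D := by
  obtain ⟨E, E1, E2, E3⟩ := exists_E D
  let A0 : OE D := ⟨fun _ _ _ _ => 0, E, by simp, by simp, E1, E2, E3⟩
  obtain ⟨O, o1, o2, o3⟩ := exists_odd (rT D) (fun x => (x.1, x.2.2.1, x.2.1, x.2.2.2)) (fun _ => rfl) (by
    rintro ⟨j, a, b, c⟩ _ ⟨k, h1, h2, h3, rfl⟩
    exact ⟨k, h2, h1, h3, rfl⟩) (fun x => x.2.1 ≠ x.2.2.1 ∧ x.2.2.2 ≠ x.2.1 ∧ x.2.2.2 ≠ x.2.2.1) (by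
    rintro ⟨j, a, b, c⟩ ⟨h1, h2, h3⟩ h
    exact T4a H A0 (fun _ _ _ _ => rfl) j h1 h2 h3 h)
  let A : OE D := ⟨fun j a b c => O (j, a, b, c), E,
    fun j k a b c h1 h2 h3 => (o2 (j, a, b, c) _ ⟨k, h1, h2, h3, rfl⟩).symm,
    fun j a b c h1 h2 h3 => o3 (j, a, b, c) ⟨h1, h2, h3⟩, E1, E2, E3⟩
  have hA : ∀ j a b c, A.O j a b c ≠ 0 := by
    intro j a b c h
    rcases o1 (j, a, b, c) with k | k <;> rw [show O (j, a, b, c) = 0 from h] at k <;> norm_num at k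
  let r2 : D.I × Fin 5 × Fin 5 → D.I × Fin 5 × Fin 5 → Prop := fun x y =>
    ∃ k, k ≠ x.2.1 ∧ k ≠ x.2.2 ∧ y = ((D.P (x.1, k)).1, D.glue (x.1, k) x.2.1, D.glue (x.1, k) x.2.2)
  obtain ⟨Q, q1, q2, q3⟩ := exists_odd r2 (fun x => (x.1, x.2.2, x.2.1)) (fun _ => rfl) (by
    rintro ⟨j, a, b⟩ _ ⟨k, h1, h2, rfl⟩
    exact ⟨k, h2, h1, rfl⟩) (fun x => x.2.1 ≠ x.2.2) (by
    rintro ⟨j, a, b⟩ h1 h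
    refine T4b H A hA j h1 (eqvGen_prop (fun x y : D.I × Fin 5 × Fin 5 => Quot.mk (rT D) (x.1, x.2.1, x.2.2, x.2.1) =
      Quot.mk (rT D) (y.1, y.2.1, y.2.2, y.2.1)) ?_ (fun _ => rfl) (fun _ _ h => h.symm) (fun _ _ _ h h' => h.trans h') h)
    rintro ⟨j, a, b⟩ _ ⟨k, h1, h2, rfl⟩
    exact Quot.sound ⟨k, h1, h2, h1, rfl⟩)
  refine ⟨fun j a b => Q (j, a, b) = 1, ?_, ?_⟩
  · intro j a b hab
    have := q3 (j, a, b) hab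
    simp only at this ⊢
    rw [this]
    rcases q1 (j, a, b) with h | h <;> rw [h] <;> norm_num [Xor']
  · intro j k a b ha hb hab
    simp only
    rw [q2 (j, a, b) _ ⟨k, ha.symm, hb.symm, rfl⟩]
end

section
abbrev Tri (D : GlueingDatum 4) := D.I × {s : Finset (Fin 5) // s.card = 2}

/-- a choice of directions -/
structure DD (D : GlueingDatum 4) where
  o : D.I → Fin 5 → Fin 5 → Prop
  o1 : ∀ i a b, a ≠ b → Xor' (o i a b) (o i b a)
  o2 : ∀ (i : D.I) (k a b : Fin 5), a ≠ k → b ≠ k → a ≠ b →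
      (o i a b ↔ o (D.P (i, k)).1 (D.glue (i, k) a) (D.glue (i, k) b))

variable {D : GlueingDatum 4}

def labS (s : Finset (Fin 5)) : Set (Fin 5 → ℝ) := {x | (∀ v, 0 ≤ x v) ∧ (∑ v, x v = 1) ∧ ∀ v ∈ s, x v = 0}

def defaultT (s : Finset (Fin 5)) (hs : s.card = 2) : LabTri s :=
  ⟨fun v => if v ∈ s then 0 else 1/3, by intro v; dsimp only; split_ifs <;> norm_num, by
    have : ∀ s : Finset (Fin 5), s.card = 2 → sᶜ.card = 3 := by decide
    have h := this s hs
    have e : ∀ v, (if v ∈ s then (0:ℝ) else 1/3) = if v ∈ sᶜ then 1/3 else 0 := by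
      intro v; by_cases h : v ∈ s <;> simp [h]
    simp only [e, Finset.sum_ite_mem, Finset.univ_inter, Finset.sum_const, h]
    norm_num, fun v hv => if_pos hv⟩

def mkS (D : GlueingDatum 4) (τ : Tri D) (x : Fin 5 → ℝ) : SurfSpace D :=
  if h : x ∈ labS τ.2.1 then Quot.mk _ ⟨τ, ⟨x, h⟩⟩ else Quot.mk _ ⟨τ, defaultT _ τ.2.2⟩

theorem mkS_mem {τ : Tri D} {x : Fin 5 → ℝ} (h : x ∈ labS τ.2.1) : mkS D τ x = Quot.mk _ ⟨τ, ⟨x, h⟩⟩ := dif_pos h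

theorem mkS_cont (τ : Tri D) : ContinuousOn (mkS D τ) (labS τ.2.1) := by
  rw [continuousOn_iff_continuous_domRestrict]
  have : Continuous fun y : labS τ.2.1 => (Quot.mk (surfRel D) ⟨τ, y⟩ : SurfSpace D) :=
    continuous_quot_mk.comp (continuous_sigmaMk (σ := fun p : Tri D => LabTri p.2.1))
  refine this.congr fun y => ?_
  exact (mkS_mem y.2).symm

/-- the neighbouring triangle across the side opposite to `k` -/
def nbr (τ : Tri D) (k : Fin 5) : Tri D := ((D.P (τ.1, k)).1, ⟨τ.2.1.image (D.glue (τ.1, k)), by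
  rw [Finset.card_image_of_injective _ (Equiv.injective _)]; exact τ.2.2⟩)

theorem mkS_glue (τ : Tri D) (k : Fin 5) (hk : k ∉ τ.2.1) {x : Fin 5 → ℝ} (hx : x ∈ labS τ.2.1) (h0 : x k = 0) :
    x ∘ (D.glue (τ.1, k)).symm ∈ labS (nbr τ k).2.1 ∧ mkS D τ x = mkS D (nbr τ k) (x ∘ (D.glue (τ.1, k)).symm) := by
  have h : x ∘ (D.glue (τ.1, k)).symm ∈ labS (nbr τ k).2.1 := by
    refine ⟨fun v => hx.1 _, ?_, ?_⟩
    · exact (Equiv.sum_comp (D.glue (τ.1, k)).symm x).trans hx.2.1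
    · intro v hv
      simp only [nbr, Finset.mem_image] at hv
      obtain ⟨w, hw, rfl⟩ := hv
      simpa using hx.2.2 w hw
  refine ⟨h, ?_⟩
  rw [mkS_mem hx, mkS_mem h]
  exact Quot.sound ⟨k, hk, h0, rfl, rfl, rfl⟩

theorem surf_ind {P : SurfSpace D → Prop} (h : ∀ τ : Tri D, ∀ x ∈ labS τ.2.1, P (mkS D τ x)) (z : SurfSpace D) : P z := by
  obtain ⟨⟨τ, x⟩, rfl⟩ := Quot.exists_rep z
  have := h τ x.1 x.2
  rwa [mkS_mem x.2] at this

namespace DD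
variable (A : DD D)

def sg (j : D.I) (s : Finset (Fin 5)) (v : Fin 5) : ℝ := if ∃ b ∈ s, b ≠ v ∧ A.o j v b then 1 else -1

theorem sg_abs (j : D.I) (s) (v) : A.sg j s v = 1 ∨ A.sg j s v = -1 := by
  unfold sg; split_ifs <;> simp

theorem sg_pair (j : D.I) {a b : Fin 5} (h : a ≠ b) : A.sg j {a, b} b = - A.sg j {a, b} a := by
  unfold sg
  have h1 : (∃ c ∈ ({a, b} : Finset (Fin 5)), c ≠ a ∧ A.o j a c) ↔ A.o j a b := by
    simp [h.symm]
  have h2 : (∃ c ∈ ({a, b} : Finset (Fin 5)), c ≠ b ∧ A.o j b c) ↔ A.o j b a := by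
    simp [h]
  simp only [h1, h2]
  have := A.o1 j a b h
  unfold Xor' at this
  by_cases k1 : A.o j a b <;> by_cases k2 : A.o j b a <;> simp_all

theorem sg_sum (j : D.I) {s : Finset (Fin 5)} (hs : s.card = 2) : ∑ v ∈ s, A.sg j s v = 0 := by
  obtain ⟨a, b, h, rfl⟩ := Finset.card_eq_two.1 hs
  rw [Finset.sum_pair h, A.sg_pair j h]; ring

theorem sg_glue (j : D.I) (k : Fin 5) {s : Finset (Fin 5)} (hk : k ∉ s) {v : Fin 5} (hv : v ∈ s) :
    A.sg (D.P (j, k)).1 (s.image (D.glue (j, k))) (D.glue (j, k) v) = A.sg j s v := by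
  unfold sg
  congr 1
  simp only [Finset.mem_image, exists_exists_and_eq_and, EmbeddingLike.apply_eq_iff_eq, ne_eq]
  apply propext
  refine exists_congr fun b => ?_
  constructor
  · rintro ⟨h1, h2, h3⟩
    exact ⟨h1, h2, (A.o2 j k v b (by rintro rfl; exact hk hv) (by rintro rfl; exact hk h1) (Ne.symm h2)).2 h3⟩
  · rintro ⟨h1, h2, h3⟩
    exact ⟨h1, h2, (A.o2 j k v b (by rintro rfl; exact hk hv) (by rintro rfl; exact hk h1) (Ne.symm h2)).1 h3⟩

/-! ### height -/
def htT (p : GlueTotal D) : ℝ := ∑ v ∈ bigS p.2.1, A.sg p.1 (bigS p.2.1) v * p.2.1 v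

theorem htT_inv (p q : GlueTotal D) (h : glueRel D p q) : A.htT p = A.htT q := by
  obtain ⟨j, y⟩ := p
  obtain ⟨j', y'⟩ := q
  obtain ⟨k, h0, h1, h2⟩ := h
  simp only at h0 h1 h2
  subst h1
  unfold htT
  simp only
  rw [h2, bigS_comp, Finset.sum_image (fun _ _ _ _ h => Equiv.injective _ h)]
  refine Finset.sum_congr rfl fun v hv => ?_
  rw [A.sg_glue j k _ hv]
  · simp
  · intro hk
    have := mem_bigS.1 hk
    rw [h0] at this; norm_num at this

def htX (x : GlueSpace D) : ℝ := A.htT x.out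

theorem htX_mk (p : GlueTotal D) : A.htX (Quot.mk (glueRel D) p) = A.htT p :=
  desc_val (r := glueRel D) (O := Set.univ) (by simp) A.htT (fun p q _ h => A.htT_inv p q h) p trivial

theorem htT_cont : ContinuousOn A.htT (tilN D) := by
  refine famCont D (fun j s y => ∑ v ∈ s, A.sg j s v * y.1 v) _ (fun _ h => h) ?_
  intro p _
  apply Continuous.continuousAt
  exact continuous_finsetSum _ fun v _ => continuous_const.mul ((continuous_apply v).comp continuous_subtype_val)

theorem htX_cont : ContinuousOn A.htX (setN D) :=
  desc_cont (tilN_open D) (tilN_sat D) A.htT A.htT_cont (fun p q _ h => A.htT_inv p q h)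

end DD

theorem radT_cont : ContinuousOn (fun p : GlueTotal D => (1 - ∑ v ∈ bigS p.2.1, p.2.1 v)) (tilN D) := by
  refine famCont D (fun j s y => 1 - ∑ v ∈ s, y.1 v) _ (fun _ h => h) ?_
  intro p _
  apply Continuous.continuousAt
  exact continuous_const.sub (continuous_finsetSum _ fun v _ => (continuous_apply v).comp continuous_subtype_val)

/-! ### projection -/

def prY (s : Finset (Fin 5)) (y : Fin 5 → ℝ) : Fin 5 → ℝ := fun v => if v ∈ s then 0 else y v / (1 - ∑ v ∈ s, y v)

theorem prY_mem {s : Finset (Fin 5)} {y : Fin 5 → ℝ} (hy : y ∈ stdS) (h : 0 < 1 - ∑ v ∈ s, y v) : prY s y ∈ labS s := by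
  refine ⟨?_, ?_, ?_⟩
  · intro v; unfold prY; split_ifs
    · exact le_rfl
    · exact div_nonneg (hy.1 v) h.le
  · have : ∑ v, prY s y v = (∑ v ∈ sᶜ, y v) / (1 - ∑ v ∈ s, y v) := by
      unfold prY
      rw [Finset.sum_div, ← Finset.sum_add_sum_compl s]
      rw [Finset.sum_eq_zero (fun v hv => if_pos hv), zero_add]
      exact Finset.sum_congr rfl fun v hv => if_neg (Finset.mem_compl.1 hv)
    rw [this]
    have h2 := Finset.sum_add_sum_compl s y
    rw [hy.2] at h2
    rw [div_eq_one_iff_eq h.ne']; linarith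
  · intro v hv; exact if_pos hv

def prT (j : D.I) (s : Finset (Fin 5)) (y : Delta 4) : SurfSpace D :=
  if h : s.card = 2 then mkS D (j, ⟨s, h⟩) (prY s y.1) else mkS D (j, ⟨{0, 1}, rfl⟩) 0

def prO (D : GlueingDatum 4) : Set (GlueTotal D) := tilN D ∩ {p | 0 < 1 - ∑ v ∈ bigS p.2.1, p.2.1 v}

theorem prO_open : IsOpen (prO D) := radT_cont.isOpen_inter_preimage (tilN_open D) isOpen_Ioi

theorem prO_sat (p q : GlueTotal D) (h : glueRel D p q) : p ∈ prO D ↔ q ∈ prO D := by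
  unfold prO
  simp only [Set.mem_inter_iff, Set.mem_ofPred_eq]
  rw [tilN_sat D p q h, radX_inv p q h]

def prX (x : GlueSpace D) : SurfSpace D := prT x.out.1 (bigS x.out.2.1) x.out.2

theorem prT_inv (p q : GlueTotal D) (hp : p ∈ prO D) (h : glueRel D p q) :
    prT p.1 (bigS p.2.1) p.2 = prT q.1 (bigS q.2.1) q.2 := by
  have hq := (prO_sat p q h).1 hp
  obtain ⟨j, y⟩ := p
  obtain ⟨j', y'⟩ := q
  have hr := radX_inv _ _ h
  obtain ⟨k, h0, h1, h2⟩ := h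
  simp only at h0 h1 h2 hr
  subst h1
  unfold prT
  have c1 : (bigS y.1).card = 2 := hp.1
  have c2 : (bigS y'.1).card = 2 := hq.1
  simp only [dif_pos c1, dif_pos c2]
  have hk : k ∉ bigS y.1 := by
    intro hk
    have := mem_bigS.1 hk
    rw [h0] at this; norm_num at this
  have e1 : prY (bigS y.1) y.1 k = 0 := by simp [prY, hk, h0]
  rw [(mkS_glue (j, ⟨bigS y.1, c1⟩) k hk (prY_mem y.2 hp.2) e1).2]
  have e2 : nbr (j, ⟨bigS y.1, c1⟩) k = ((D.P (j, k)).1, ⟨bigS y'.1, c2⟩) := by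
    refine Prod.ext rfl (Subtype.ext ?_)
    show (bigS y.1).image _ = bigS y'.1
    rw [h2, bigS_comp]
  rw [e2]
  congr 1
  funext v
  simp only [prY, Function.comp]
  rw [← hr]
  have e3 : (v ∈ bigS y'.1) ↔ ((D.glue (j, k)).symm v ∈ bigS y.1) := by
    rw [h2]; simp [mem_bigS]
  simp only [e3]
  rw [h2]; rfl

theorem prX_mk (p : GlueTotal D) (hp : p ∈ prO D) : prX (Quot.mk (glueRel D) p) = prT p.1 (bigS p.2.1) p.2 :=
  desc_val (prO_sat) (fun p : GlueTotal D => prT p.1 (bigS p.2.1) p.2) prT_inv p hp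

theorem prX_cont : ContinuousOn (prX (D := D)) {x | x ∈ setN D ∧ 0 < radX x} := by
  have : {x | x ∈ setN D ∧ 0 < radX x} = Quot.mk (glueRel D) '' prO D := by
    ext x
    constructor
    · rintro ⟨⟨p, hp, rfl⟩, hx⟩
      rw [radX_mk] at hx
      exact ⟨p, ⟨hp, hx⟩, rfl⟩
    · rintro ⟨p, hp, rfl⟩
      refine ⟨⟨p, hp.1, rfl⟩, ?_⟩
      rw [radX_mk]; exact hp.2
  rw [this]
  refine desc_cont prO_open prO_sat (fun p : GlueTotal D => prT p.1 (bigS p.2.1) p.2) ?_ prT_inv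
  refine famCont D prT _ (fun _ h => h.1) ?_
  intro p hp
  have c1 : (bigS p.2.1).card = 2 := hp.1
  have e : prT p.1 (bigS p.2.1) = fun y => mkS D (p.1, ⟨bigS p.2.1, c1⟩) (prY (bigS p.2.1) y.1) := by
    funext y; exact dif_pos c1
  rw [e]
  have hsum : Continuous fun y : Delta 4 => 1 - ∑ v ∈ bigS p.2.1, y.1 v :=
    continuous_const.sub (continuous_finsetSum _ fun v _ => (continuous_apply v).comp continuous_subtype_val)
  have hpos : ∀ᶠ y : Delta 4 in nhds p.2, 0 < 1 - ∑ v ∈ bigS p.2.1, y.1 v :=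
    hsum.continuousAt.eventually (lt_mem_nhds hp.2)
  have hc : ContinuousAt (fun y : Delta 4 => prY (bigS p.2.1) y.1) p.2 := by
    rw [continuousAt_pi]
    intro v
    unfold prY
    split_ifs
    · exact continuousAt_const
    · exact ((continuous_apply v).comp continuous_subtype_val).continuousAt.div hsum.continuousAt hp.2.ne'
  have h1 := (mkS_cont (D := D) (p.1, ⟨bigS p.2.1, c1⟩)) _ (prY_mem p.2.2 hp.2)
  refine h1.tendsto.comp (tendsto_nhdsWithin_iff.2 ⟨hc, ?_⟩)
  filter_upwards [hpos] with y hy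
  exact prY_mem y.2 hy
end

section
variable {D : GlueingDatum 4}

def crr (r : ℝ) : ℝ := max 0 (min (1/16) r)
def cuu (r : ℝ) : ℝ := max (-(1/16)) (min (1/16) r)

theorem crr_mem (r : ℝ) : crr r ∈ Set.Icc (0:ℝ) (1/16) :=
  ⟨le_max_left _ _, max_le (by norm_num) (min_le_left _ _)⟩
theorem cuu_mem (r : ℝ) : cuu r ∈ Set.Icc (-(1/16):ℝ) (1/16) :=
  ⟨le_max_left _ _, max_le (by norm_num) (min_le_left _ _)⟩
theorem crr_eq {r : ℝ} (h : r ∈ Set.Icc (0:ℝ) (1/16)) : crr r = r := by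
  unfold crr; rw [min_eq_right h.2, max_eq_right h.1]
theorem cuu_eq {r : ℝ} (h : r ∈ Set.Icc (-(1/16):ℝ) (1/16)) : cuu r = r := by
  unfold cuu; rw [min_eq_right h.2, max_eq_right h.1]

namespace DD
variable (A : DD D)

def kY (j : D.I) (s : Finset (Fin 5)) (x : Fin 5 → ℝ) (r u : ℝ) : Fin 5 → ℝ := fun v =>
  r * x v + if v ∈ s then (1 - r) / 2 + u / 2 * A.sg j s v else 0

theorem kY_mem {j : D.I} {s : Finset (Fin 5)} (hs : s.card = 2) {x : Fin 5 → ℝ} (hx : x ∈ labS s) {r u : ℝ}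
    (hr : r ∈ Set.Icc (0:ℝ) (1/16)) (hu : u ∈ Set.Icc (-(1/16):ℝ) (1/16)) : A.kY j s x r u ∈ stdS := by
  have hb : ∀ v, 0 ≤ (1 - r) / 2 + u / 2 * A.sg j s v := by
    intro v
    obtain ⟨h1, h2⟩ := hr
    obtain ⟨h3, h4⟩ := hu
    rcases A.sg_abs j s v with h | h <;> rw [h] <;> linarith
  refine ⟨fun v => ?_, ?_⟩
  · refine add_nonneg (mul_nonneg hr.1 (hx.1 v)) ?_
    split_ifs
    · exact hb v
    · exact le_rfl
  · unfold kY
    rw [Finset.sum_add_distrib, ← Finset.mul_sum, hx.2.1, Finset.sum_ite_mem, Finset.univ_inter,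
      Finset.sum_add_distrib, ← Finset.mul_sum, A.sg_sum j hs, Finset.sum_const, hs]
    simp; ring

theorem kY_big {j : D.I} {s : Finset (Fin 5)} (hs : s.card = 2) {x : Fin 5 → ℝ} (hx : x ∈ labS s) {r u : ℝ}
    (hr : r ∈ Set.Icc (0:ℝ) (1/16)) (hu : u ∈ Set.Icc (-(1/16):ℝ) (1/16)) : bigS (A.kY j s x r u) = s := by
  have hm := A.kY_mem (j := j) hs hx hr hu
  refine bigS_eq hm.1 hm.2 hs fun v hv => ?_
  unfold kY
  rw [if_pos hv, hx.2.2 v hv]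
  obtain ⟨h1, h2⟩ := hr
  obtain ⟨h3, h4⟩ := hu
  rcases A.sg_abs j s v with h | h <;> rw [h] <;> linarith

theorem kY_glue {j : D.I} {k : Fin 5} {s : Finset (Fin 5)} (hk : k ∉ s) (x : Fin 5 → ℝ) (r u : ℝ) :
    A.kY j s x r u ∘ (D.glue (j, k)).symm = A.kY (D.P (j, k)).1 (s.image (D.glue (j,k))) (x ∘ (D.glue (j, k)).symm) r u := by
  funext v
  obtain ⟨v, rfl⟩ := (D.glue (j, k)).surjective v
  simp only [kY, Function.comp, Equiv.symm_apply_apply]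
  congr 1
  by_cases hv : v ∈ s
  · rw [if_pos hv, if_pos (Finset.mem_image_of_mem _ hv), A.sg_glue j k hk hv]
  · rw [if_neg hv, if_neg (by simpa using hv)]

theorem kY_cont (j : D.I) (s : Finset (Fin 5)) :
    Continuous fun q : (Fin 5 → ℝ) × ℝ × ℝ => A.kY j s q.1 q.2.1 q.2.2 := by
  refine continuous_pi fun v => ?_
  unfold kY
  by_cases hv : v ∈ s
  · simp only [if_pos hv]; fun_prop
  · simp only [if_neg hv]; fun_prop

def kapT (p : SurfTotal D) (w : ℝ × ℝ) : GlueSpace D := toX D p.1.1 (A.kY p.1.1 p.1.2.1 p.2.1 (crr w.1) (cuu w.2))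

theorem kapT_cont (τ : Tri D) : Continuous fun q : LabTri τ.2.1 × ℝ × ℝ => A.kapT ⟨τ, q.1⟩ q.2 := by
  unfold kapT
  refine (toX_cont τ.1).comp_continuous (f := fun q : LabTri τ.2.1 × ℝ × ℝ => A.kY τ.1 τ.2.1 q.1.1 (crr q.2.1) (cuu q.2.2)) ?_ ?_
  · refine (A.kY_cont τ.1 τ.2.1).comp (?_ : Continuous fun q : LabTri τ.2.1 × ℝ × ℝ => ((q.1.1, crr q.2.1, cuu q.2.2) : (Fin 5 → ℝ) × ℝ × ℝ))
    unfold crr cuu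
    refine (continuous_subtype_val.comp continuous_fst).prodMk ?_
    fun_prop
  · intro q
    exact A.kY_mem τ.2.2 q.1.2 (crr_mem _) (cuu_mem _)

def kapTC (p : SurfTotal D) : C(ℝ × ℝ, GlueSpace D) := ⟨A.kapT p, by
  have := (A.kapT_cont p.1).comp (Continuous.prodMk_right p.2)
  exact this⟩

theorem kapTC_cont : Continuous A.kapTC := by
  refine continuous_sigma fun τ => ?_
  exact (ContinuousMap.curry ⟨_, A.kapT_cont τ⟩).continuous

theorem kapTC_inv (p q : SurfTotal D) (h : surfRel D p q) : A.kapTC p = A.kapTC q := by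
  obtain ⟨⟨j, s, hs⟩, x⟩ := p
  obtain ⟨⟨j', s', hs'⟩, x'⟩ := q
  obtain ⟨k, hk, h0, h1, h2, h3⟩ := h
  simp only at hk h0 h1 h2 h3
  subst h1 h2
  ext w
  show toX D j _ = toX D _ _
  rw [toX_glue j k (A.kY_mem hs x.2 (crr_mem _) (cuu_mem _)), A.kY_glue hk]
  · dsimp only
    rw [← h3]
  · simp [kY, hk, h0]

def kapC : SurfSpace D → C(ℝ × ℝ, GlueSpace D) := Quot.lift A.kapTC A.kapTC_inv

theorem kapC_cont : Continuous A.kapC := continuous_quot_lift _ A.kapTC_cont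

def kap (z : SurfSpace D) (r u : ℝ) : GlueSpace D := A.kapC z (r, u)

theorem kap_cont : Continuous fun q : SurfSpace D × ℝ × ℝ => A.kap q.1 q.2.1 q.2.2 := by
  unfold kap
  exact (A.kapC_cont.comp continuous_fst).eval continuous_snd

theorem kap_mkS {τ : Tri D} {x : Fin 5 → ℝ} (hx : x ∈ labS τ.2.1) {r u : ℝ}
    (hr : r ∈ Set.Icc (0:ℝ) (1/16)) (hu : u ∈ Set.Icc (-(1/16):ℝ) (1/16)) :
    A.kap (mkS D τ x) r u = toX D τ.1 (A.kY τ.1 τ.2.1 x r u) := by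
  rw [mkS_mem hx]
  show toX D τ.1 (A.kY τ.1 τ.2.1 x (crr r) (cuu u)) = _
  rw [crr_eq hr, cuu_eq hu]

theorem kY_sumS {j : D.I} {s : Finset (Fin 5)} (hs : s.card = 2) {x : Fin 5 → ℝ} (hx : x ∈ labS s) (r u : ℝ) :
    1 - ∑ v ∈ s, A.kY j s x r u v = r := by
  have : ∑ v ∈ s, A.kY j s x r u v = ∑ v ∈ s, ((1 - r)/2 + u/2 * A.sg j s v) := by
    refine Finset.sum_congr rfl fun v hv => ?_
    unfold kY; rw [if_pos hv, hx.2.2 v hv]; ring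
  rw [this, Finset.sum_add_distrib, ← Finset.mul_sum, A.sg_sum j hs, Finset.sum_const, hs]
  simp; ring

theorem kY_ht {j : D.I} {s : Finset (Fin 5)} (hs : s.card = 2) {x : Fin 5 → ℝ} (hx : x ∈ labS s) (r u : ℝ) :
    ∑ v ∈ s, A.sg j s v * A.kY j s x r u v = u := by
  have : ∑ v ∈ s, A.sg j s v * A.kY j s x r u v = ∑ v ∈ s, ((1 - r)/2 * A.sg j s v + u/2) := by
    refine Finset.sum_congr rfl fun v hv => ?_
    unfold kY; rw [if_pos hv, hx.2.2 v hv]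
    rcases A.sg_abs j s v with h | h <;> rw [h] <;> ring
  rw [this, Finset.sum_add_distrib, ← Finset.mul_sum, A.sg_sum j hs, Finset.sum_const, hs]
  simp; ring

theorem kap_facts (z : SurfSpace D) {r u : ℝ} (hr : r ∈ Set.Icc (0:ℝ) (1/16)) (hu : u ∈ Set.Icc (-(1/16):ℝ) (1/16)) :
    A.kap z r u ∈ setN D ∧ radX (A.kap z r u) = r ∧ A.htX (A.kap z r u) = u ∧ (0 < r → prX (A.kap z r u) = z) := by
  revert z
  refine surf_ind fun τ x hx => ?_
  obtain ⟨j, s, hs⟩ := τ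
  rw [A.kap_mkS hx hr hu, toX_mem (A.kY_mem hs hx hr hu)]
  have hb := A.kY_big (j := j) hs hx hr hu
  have hN : (⟨j, ⟨A.kY j s x r u, A.kY_mem hs hx hr hu⟩⟩ : GlueTotal D) ∈ tilN D := by
    show (bigS (A.kY j s x r u)).card = 2
    rw [hb]; exact hs
  refine ⟨⟨_, hN, rfl⟩, ?_, ?_, ?_⟩
  · rw [radX_mk]; dsimp only; rw [hb]; exact A.kY_sumS hs hx r u
  · rw [A.htX_mk]; unfold htT; dsimp only; rw [hb]; exact A.kY_ht hs hx r u
  · intro h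
    rw [prX_mk _ ⟨hN, by
      show 0 < 1 - ∑ v ∈ bigS (A.kY j s x r u), A.kY j s x r u v
      rw [hb, A.kY_sumS hs hx]; exact h⟩]
    dsimp only
    rw [hb]
    unfold prT
    rw [dif_pos hs]
    congr 1
    funext v
    unfold prY
    dsimp only
    rw [A.kY_sumS hs hx]
    by_cases hv : v ∈ s
    · rw [if_pos hv, hx.2.2 v hv]
    · rw [if_neg hv]; simp only [kY, if_neg hv]; field_simp; ring

/-- recover the two big coordinates -/
theorem recover {j : D.I} {s : Finset (Fin 5)} (hs : s.card = 2) (y : Fin 5 → ℝ) {v : Fin 5} (hv : v ∈ s) :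
    y v = (∑ v ∈ s, y v) / 2 + (∑ v ∈ s, A.sg j s v * y v) / 2 * A.sg j s v := by
  obtain ⟨a, b, h, rfl⟩ := Finset.card_eq_two.1 hs
  rw [Finset.sum_pair h, Finset.sum_pair h, A.sg_pair j h]
  have := A.sg_abs j {a, b} a
  simp only [Finset.mem_insert, Finset.mem_singleton] at hv
  rcases hv with rfl | rfl
  · rcases this with h' | h' <;> rw [h'] <;> ring
  · rw [A.sg_pair j h]; rcases this with h' | h' <;> rw [h'] <;> ring

theorem kap_pr {x : GlueSpace D} (hx : x ∈ setN D) (hr : 0 < radX x) (hr' : radX x ≤ 1/16)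
    (hu : A.htX x ∈ Set.Icc (-(1/16):ℝ) (1/16)) : A.kap (prX x) (radX x) (A.htX x) = x := by
  obtain ⟨⟨j, y⟩, hp, rfl⟩ := hx
  have hs : (bigS y.1).card = 2 := hp
  rw [radX_mk] at hr
  have hp' : (⟨j, y⟩ : GlueTotal D) ∈ prO D := ⟨hp, hr⟩
  rw [prX_mk _ hp']
  unfold prT
  dsimp only at hr ⊢
  rw [dif_pos hs, A.kap_mkS (prY_mem y.2 hr) ⟨by rw [radX_mk]; exact hr.le, hr'⟩ hu, ← toX_mem y.2]
  congr 1
  rw [toX_mem y.2, A.htX_mk, radX_mk]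
  unfold htT
  funext v
  by_cases hv : v ∈ bigS y.1
  · simp only [kY, if_pos hv, prY]
    rw [A.recover hs y.1 hv (j := j)]; ring
  · simp only [kY, if_neg hv, prY]
    rw [mul_div_cancel₀ _ hr.ne', add_zero]

theorem kap_zero {j : D.I} {y : Delta 4} (hs : (bigS y.1).card = 2) (hr : radX (Quot.mk (glueRel D) ⟨j, y⟩) = 0)
    (hu : A.htX (Quot.mk (glueRel D) ⟨j, y⟩) ∈ Set.Icc (-(1/16):ℝ) (1/16)) {x : Fin 5 → ℝ} (hx : x ∈ labS (bigS y.1)) :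
    A.kap (mkS D (j, ⟨bigS y.1, hs⟩) x) 0 (A.htX (Quot.mk (glueRel D) ⟨j, y⟩)) = Quot.mk (glueRel D) ⟨j, y⟩ := by
  rw [A.kap_mkS hx ⟨le_rfl, by norm_num⟩ hu, ← toX_mem y.2]
  congr 1
  rw [toX_mem y.2, A.htX_mk]
  rw [radX_mk] at hr
  dsimp only at hr
  unfold htT
  funext v
  by_cases hv : v ∈ bigS y.1
  · simp only [kY, if_pos hv]
    conv_rhs => rw [A.recover hs y.1 hv (j := j)]
    linarith
  · simp only [kY, if_neg hv]
    have h2 := Finset.sum_add_sum_compl (bigS y.1) y.1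
    rw [y.2.2] at h2
    have h3 : ∑ v ∈ (bigS y.1)ᶜ, y.1 v = 0 := by linarith
    rw [Finset.sum_eq_zero_iff_of_nonneg (fun v _ => y.2.1 v)] at h3
    rw [h3 v (Finset.mem_compl.2 hv)]; ring

/-- points on the axis -/
theorem kap_axis {τ : Tri D} {x x' : Fin 5 → ℝ} (hx : x ∈ labS τ.2.1) (hx' : x' ∈ labS τ.2.1) {u : ℝ}
    (hu : u ∈ Set.Icc (-(1/16):ℝ) (1/16)) : A.kap (mkS D τ x) 0 u = A.kap (mkS D τ x') 0 u := by
  rw [A.kap_mkS hx ⟨le_rfl, by norm_num⟩ hu, A.kap_mkS hx' ⟨le_rfl, by norm_num⟩ hu]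
  congr 1; funext v; simp [kY]

theorem kap_axis_fin {u : ℝ} (hu : u ∈ Set.Icc (-(1/16):ℝ) (1/16)) : (Set.range fun z => A.kap z 0 u).Finite := by
  have : (Set.range fun τ : Tri D => A.kap (mkS D τ (defaultT _ τ.2.2).1) 0 u).Finite := by
    have : Finite (Tri D) := inferInstance
    exact Set.finite_range _
  refine this.subset ?_
  rintro _ ⟨z, rfl⟩
  revert z
  refine surf_ind fun τ x hx => ?_
  exact ⟨τ, A.kap_axis (defaultT _ τ.2.2).2 hx hu⟩

theorem kap_axis_const {u : ℝ} (hu : u ∈ Set.Icc (-(1/16):ℝ) (1/16)) {C : Set (SurfSpace D)} (hC : IsPreconnected C)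
    {z z'} (hz : z ∈ C) (hz' : z' ∈ C) : A.kap z 0 u = A.kap z' 0 u := by
  have hd := (A.kap_axis_fin hu)
  haveI : DiscreteTopology (Set.range fun z => A.kap z 0 u) := by
    haveI := hd.to_subtype
    infer_instance
  have hc : Continuous fun z : SurfSpace D => A.kap z 0 u :=
    A.kap_cont.comp (continuous_id.prodMk (continuous_const (y := ((0:ℝ), u))))
  exact hC.constant_of_mapsTo (isDiscrete_iff_discreteTopology.2 this) hc.continuousOn (fun z _ => ⟨z, rfl⟩) hz hz'

end DD
end

section
variable {D : GlueingDatum 4}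

theorem labS_convex (s : Finset (Fin 5)) : Convex ℝ (labS s) := by
  intro x hx y hy a b ha hb hab
  refine ⟨fun v => ?_, ?_, fun v hv => ?_⟩
  · exact add_nonneg (mul_nonneg ha (hx.1 v)) (mul_nonneg hb (hy.1 v))
  · simp only [Pi.add_apply, Pi.smul_apply, smul_eq_mul, Finset.sum_add_distrib, ← Finset.mul_sum, hx.2.1, hy.2.1]
    linarith
  · simp [hx.2.2 v hv, hy.2.2 v hv]

theorem labS_compact (s : Finset (Fin 5)) : IsCompact (labS s) := by
  have h1 : labS s ⊆ Set.Icc (0 : Fin 5 → ℝ) 1 := by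
    intro x hx
    refine ⟨hx.1, fun v => ?_⟩
    have := Finset.single_le_sum (f := x) (fun v _ => hx.1 v) (Finset.mem_univ v)
    rw [hx.2.1] at this; exact this
  refine isCompact_Icc.of_isClosed_subset ?_ h1
  have : labS s = (⋂ v, {x | 0 ≤ x v}) ∩ ({x | ∑ v, x v = 1} ∩ ⋂ v ∈ s, {x | x v = 0}) := by
    ext x; simp [labS]
  rw [this]
  refine (isClosed_iInter fun v => isClosed_le continuous_const (continuous_apply v)).inter
    ((isClosed_eq (by fun_prop) continuous_const).inter ?_)
  exact isClosed_iInter fun v => isClosed_iInter fun _ => isClosed_eq (continuous_apply v) continuous_const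

instance labCompact (s : Finset (Fin 5)) : CompactSpace (LabTri s) := isCompact_iff_compactSpace.1 (labS_compact s)

instance surfCompact : CompactSpace (SurfSpace D) := by
  haveI : CompactSpace (SurfTotal D) := inferInstance
  exact Quot.compactSpace

theorem tri_cc {τ : Tri D} {x x' : Fin 5 → ℝ} (hx : x ∈ labS τ.2.1) (hx' : x' ∈ labS τ.2.1) :
    connectedComponent (mkS D τ x) = connectedComponent (mkS D τ x') := by
  have h : IsPreconnected (mkS D τ '' labS τ.2.1) := (labS_convex _).isPreconnected.image _ (mkS_cont τ)
  exact connectedComponent_eq (h.subset_connectedComponent ⟨x, hx, rfl⟩ ⟨x', hx', rfl⟩)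

def dfl (τ : Tri D) : SurfSpace D := mkS D τ (defaultT _ τ.2.2).1

theorem tri_cc' {τ : Tri D} {x : Fin 5 → ℝ} (hx : x ∈ labS τ.2.1) {z : SurfSpace D} :
    mkS D τ x ∈ connectedComponent z ↔ dfl τ ∈ connectedComponent z := by
  have := tri_cc hx (defaultT _ τ.2.2).2 
  constructor
  · intro h; rw [connectedComponent_eq h, this]; exact mem_connectedComponent
  · intro h; rw [connectedComponent_eq h]; unfold dfl; rw [← this]; exact mem_connectedComponent

theorem single_lab {s : Finset (Fin 5)} {c : Fin 5} (h : c ∉ s) : (Pi.single c 1 : Fin 5 → ℝ) ∈ labS s := by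
  refine ⟨fun v => ?_, ?_, fun v hv => ?_⟩
  · by_cases h : v = c
    · subst h; simp
    · simp [h]
  · simp
  · rw [Pi.single_eq_of_ne]; rintro rfl; exact h hv

theorem nbr_cc {τ : Tri D} {k : Fin 5} (hk : k ∉ τ.2.1) {z : SurfSpace D} :
    dfl (nbr τ k) ∈ connectedComponent z ↔ dfl τ ∈ connectedComponent z := by
  obtain ⟨c, hc, hck⟩ : ∃ c, c ∉ τ.2.1 ∧ c ≠ k := by
    have : ∀ s : Finset (Fin 5), s.card = 2 → ∀ k, ∃ c, c ∉ s ∧ c ≠ k := by decide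
    exact this _ τ.2.2 k
  have h := mkS_glue τ k hk (single_lab hc) (by simp [hck.symm])
  rw [← tri_cc' (single_lab hc), h.2, tri_cc' h.1]

theorem emb_aux {X Y : Type*} [TopologicalSpace X] [TopologicalSpace Y] [T2Space Y] {M M' : Set X} {F : X → Y}
    (hM : IsCompact M) (hF : ContinuousOn F M) (hinj : Set.InjOn F M) (h : M' ⊆ M) : Topology.IsEmbedding (M'.domRestrict F) := by
  haveI : CompactSpace M := isCompact_iff_compactSpace.1 hM
  have h1 := (continuousOn_iff_continuous_domRestrict.1 hF).isClosedEmbedding (Set.injOn_iff_injective.1 hinj)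
  exact h1.isEmbedding.comp (Topology.IsEmbedding.inclusion h)

namespace DD
variable (A : DD D)

def MT (z : SurfSpace D) : Set (GlueTotal D) := {p | ∃ h : (bigS p.2.1).card = 2, dfl (p.1, ⟨bigS p.2.1, h⟩) ∈ connectedComponent z ∧
  1 - ∑ v ∈ bigS p.2.1, p.2.1 v < 1/16 ∧ A.htT p ∈ Set.Ioo (-(1/16)) (1/16)}

theorem MT_open (z : SurfSpace D) : IsOpen (A.MT z) := by
  rw [isOpen_iff_eventually]
  rintro p ⟨hp, h1, h2, h3⟩
  have e1 := tilN_nhd D (p := p) hp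
  have e2 : ∀ᶠ q : GlueTotal D in nhds p, 1 - ∑ v ∈ bigS q.2.1, q.2.1 v < 1/16 :=
    (radT_cont.continuousAt ((tilN_open D).mem_nhds hp)).eventually (gt_mem_nhds h2)
  have e3 : ∀ᶠ q in nhds p, A.htT q ∈ Set.Ioo (-(1/16) : ℝ) (1/16) :=
    (A.htT_cont.continuousAt ((tilN_open D).mem_nhds hp)).eventually (isOpen_Ioo.mem_nhds h3)
  filter_upwards [e1, e2, e3] with q h1' h2' h3'
  refine ⟨h1'.2.2, ?_, h2', h3'⟩
  have : ((q.1, ⟨bigS q.2.1, h1'.2.2⟩) : Tri D) = (p.1, ⟨bigS p.2.1, hp⟩) :=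
    Prod.ext h1'.1 (Subtype.ext h1'.2.1)
  rw [this]; exact h1

theorem MT_sat (z : SurfSpace D) (p q : GlueTotal D) (h : glueRel D p q) : p ∈ A.MT z ↔ q ∈ A.MT z := by
  have hN := tilN_sat D p q h
  have hr := radX_inv _ _ h
  have hh := A.htT_inv _ _ h
  unfold MT
  simp only [Set.mem_ofPred_eq, ← hr, ← hh]
  have key : ∀ (hp : (bigS p.2.1).card = 2) (hq : (bigS q.2.1).card = 2),
      dfl (p.1, ⟨bigS p.2.1, hp⟩) ∈ connectedComponent z ↔ dfl (q.1, ⟨bigS q.2.1, hq⟩) ∈ connectedComponent z := by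
    intro hp hq
    obtain ⟨k, h0, h1, h2⟩ := h
    have hk : k ∉ bigS p.2.1 := by
      intro hk
      have := mem_bigS.1 hk
      rw [h0] at this; norm_num at this
    rw [← nbr_cc (τ := (p.1, ⟨bigS p.2.1, hp⟩)) (k := k) hk]
    have : nbr (p.1, ⟨bigS p.2.1, hp⟩) k = ((q.1, ⟨bigS q.2.1, hq⟩) : Tri D) := by
      refine Prod.ext h1 (Subtype.ext ?_)
      show (bigS p.2.1).image _ = bigS q.2.1
      rw [h2, bigS_comp]
    rw [this]
  constructor
  · rintro ⟨a, b, c, d⟩; exact ⟨hN.1 a, (key _ _).1 b, c, d⟩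
  · rintro ⟨a, b, c, d⟩; exact ⟨hN.2 a, (key _ _).2 b, c, d⟩

def MX (z : SurfSpace D) : Set (GlueSpace D) := Quot.mk (glueRel D) '' A.MT z

theorem MX_open (z : SurfSpace D) : IsOpen (A.MX z) := desc_open (A.MT_open z) (A.MT_sat z)

theorem kap_MX {z z' : SurfSpace D} (hz : z' ∈ connectedComponent z) {r u : ℝ} (hr : r ∈ Set.Ico (0:ℝ) (1/16))
    (hu : u ∈ Set.Ioo (-(1/16):ℝ) (1/16)) : A.kap z' r u ∈ A.MX z := by
  have hr' : r ∈ Set.Icc (0:ℝ) (1/16) := ⟨hr.1, hr.2.le⟩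
  have hu' : u ∈ Set.Icc (-(1/16):ℝ) (1/16) := ⟨hu.1.le, hu.2.le⟩
  revert hz
  refine surf_ind (P := fun z' => z' ∈ connectedComponent z → A.kap z' r u ∈ A.MX z) (fun τ x hx hz => ?_) z'
  obtain ⟨j, s, hs⟩ := τ
  rw [A.kap_mkS hx hr' hu', toX_mem (A.kY_mem hs hx hr' hu')]
  have hb := A.kY_big (j := j) hs hx hr' hu'
  refine ⟨_, ⟨by dsimp only; rw [hb]; exact hs, ?_, ?_, ?_⟩, rfl⟩
  · dsimp only
    simp only [hb]
    exact (tri_cc' hx).1 hz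
  · dsimp only
    rw [hb, A.kY_sumS hs hx]; exact hr.2
  · unfold htT; dsimp only; rw [hb, A.kY_ht hs hx]; exact hu

theorem prX_mem_cc {z : SurfSpace D} {p : GlueTotal D} (hp : p ∈ A.MT z) (h0 : 0 < 1 - ∑ v ∈ bigS p.2.1, p.2.1 v) :
    prX (Quot.mk (glueRel D) p) ∈ connectedComponent z := by
  obtain ⟨hs, h1, h2, h3⟩ := hp
  rw [prX_mk p ⟨hs, h0⟩]
  unfold prT
  rw [dif_pos hs]
  exact (tri_cc' (τ := (p.1, ⟨bigS p.2.1, hs⟩)) (prY_mem p.2.2 h0)).2 h1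

theorem MX_kap {z : SurfSpace D} {x : GlueSpace D} (hx : x ∈ A.MX z) : ∃ z' ∈ connectedComponent z, ∃ r ∈ Set.Ico (0:ℝ) (1/16),
    ∃ u ∈ Set.Ioo (-(1/16):ℝ) (1/16), x = A.kap z' r u := by
  obtain ⟨p, hp, rfl⟩ := hx
  obtain ⟨hs, h1, h2, h3⟩ := id hp
  have hr0 : 0 ≤ 1 - ∑ v ∈ bigS p.2.1, p.2.1 v := by
    have : ∑ v ∈ bigS p.2.1, p.2.1 v ≤ ∑ v, p.2.1 v :=
      Finset.sum_le_sum_of_subset_of_nonneg (Finset.subset_univ _) (fun v _ _ => p.2.2.1 v)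
    rw [p.2.2.2] at this; linarith
  rw [← A.htX_mk] at h3
  have h3' : A.htX (Quot.mk (glueRel D) p) ∈ Set.Icc (-(1/16):ℝ) (1/16) := ⟨h3.1.le, h3.2.le⟩
  rcases hr0.eq_or_lt with h | h
  · refine ⟨_, h1, 0, ⟨le_rfl, by norm_num⟩, _, h3, ?_⟩
    exact (A.kap_zero (j := p.1) (y := p.2) hs (by rw [radX_mk]; exact h.symm) h3' (defaultT _ hs).2).symm
  · refine ⟨_, A.prX_mem_cc hp h, radX (Quot.mk (glueRel D) p), ⟨?_, ?_⟩, _, h3, ?_⟩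
    · rw [radX_mk]; exact hr0
    · rw [radX_mk]; exact h2
    · exact (A.kap_pr ⟨p, hs, rfl⟩ (by rw [radX_mk]; exact h) (by rw [radX_mk]; exact h2.le) h3').symm

abbrev E3 := EuclideanSpace ℝ (Fin 3)

theorem box_homeo : Nonempty (Metric.ball (0 : E3 × ℝ) (1/16) ≃ₜ EuclideanSpace ℝ (Fin 4)) := by
  have e1 : (Metric.ball (0 : E3 × ℝ) (1/16)) ≃ₜ (E3 × ℝ) := by
    have : Metric.ball (0 : E3 × ℝ) (1/16) = Metric.ball (0:E3) (1/16) ×ˢ Metric.ball (0:ℝ) (1/16) := by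
      rw [ball_prod_same]; rfl
    rw [this]
    refine (Homeomorph.Set.prod _ _).trans (Homeomorph.prodCongr ?_ ?_)
    · have := (OpenPartialHomeomorph.univBall (0:E3) (1/16)).symm.toHomeomorphSourceTarget
      rw [OpenPartialHomeomorph.symm_source, OpenPartialHomeomorph.symm_target, OpenPartialHomeomorph.univBall_source, OpenPartialHomeomorph.univBall_target (0:E3) (by norm_num : (0:ℝ) < 1/16)] at this
      exact this.trans (Homeomorph.Set.univ _)
    · have := (OpenPartialHomeomorph.univBall (0:ℝ) (1/16)).symm.toHomeomorphSourceTarget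
      rw [OpenPartialHomeomorph.symm_source, OpenPartialHomeomorph.symm_target, OpenPartialHomeomorph.univBall_source, OpenPartialHomeomorph.univBall_target (0:ℝ) (by norm_num : (0:ℝ) < 1/16)] at this
      exact this.trans (Homeomorph.Set.univ _)
  have e2 : (E3 × ℝ) ≃L[ℝ] EuclideanSpace ℝ (Fin 4) := ContinuousLinearEquiv.ofFinrankEq (by simp)
  exact ⟨e1.trans e2.toHomeomorph⟩

set_option maxHeartbeats 1000000 in
theorem MX_euclid (z : SurfSpace D) (f : connectedComponent z ≃ₜ Metric.sphere (0 : E3) 1) :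
    Nonempty (A.MX z ≃ₜ EuclideanSpace ℝ (Fin 4)) := by
  set C := connectedComponent z with hC
  let f' : SurfSpace D → E3 := fun w => if h : w ∈ C then (f ⟨w, h⟩).1 else 0
  have f'_mem : ∀ w (h : w ∈ C), f' w = (f ⟨w, h⟩).1 := fun w h => dif_pos h
  have f'_norm : ∀ w ∈ C, ‖f' w‖ = 1 := by
    intro w hw; rw [f'_mem w hw]; exact mem_sphere_zero_iff_norm.1 (f ⟨w, hw⟩).2
  have f'_le : ∀ w, ‖f' w‖ ≤ 1 := by
    intro w
    by_cases hw : w ∈ C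
    · exact (f'_norm w hw).le
    · simp [f', hw]
  have f'_cont : ContinuousOn f' C := by
    rw [continuousOn_iff_continuous_domRestrict]
    refine (continuous_subtype_val.comp f.continuous).congr fun w => ?_
    exact (f'_mem w.1 w.2).symm
  let K : Set (SurfSpace D × ℝ × ℝ) := C ×ˢ (Set.Icc (0:ℝ) (1/16) ×ˢ Set.Icc (-(1/16):ℝ) (1/16))
  have hK : IsCompact K := (isClosed_connectedComponent.isCompact).prod (isCompact_Icc.prod isCompact_Icc)
  set M := (fun q : SurfSpace D × ℝ × ℝ => A.kap q.1 q.2.1 q.2.2) '' K with hMdef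
  clear_value f'
  have hM : IsCompact M := hK.image A.kap_cont
  let F : GlueSpace D → E3 × ℝ := fun x => (radX x • f' (prX x), A.htX x)
  have hF : ∀ w ∈ C, ∀ r ∈ Set.Icc (0:ℝ) (1/16), ∀ u ∈ Set.Icc (-(1/16):ℝ) (1/16), F (A.kap w r u) = (r • f' w, u) := by
    intro w hw r hr u hu
    obtain ⟨h1, h2, h3, h4⟩ := A.kap_facts w hr hu
    show (_, _) = _
    rw [h2, h3]
    rcases hr.1.eq_or_lt with h | h
    · rw [← h]; simp
    · rw [h4 h]
  have hFc : ContinuousOn F M := by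
    rintro x ⟨⟨w, r, u⟩, ⟨hw, hr, hu⟩, rfl⟩
    dsimp only at hw hr hu ⊢
    obtain ⟨h1, h2, h3, h4⟩ := A.kap_facts w hr hu
    have hN := (setN_open D).mem_nhds h1
    have hrc := radX_cont.continuousAt hN
    refine ContinuousWithinAt.prodMk ?_ (A.htX_cont.continuousAt hN).continuousWithinAt
    rcases hr.1.eq_or_lt with h | h
    · have h0 : radX (A.kap w r u) = 0 := by rw [h2, h]
      apply ContinuousAt.continuousWithinAt
      rw [ContinuousAt, h0, zero_smul]
      rw [tendsto_zero_iff_norm_tendsto_zero]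
      have ht : Filter.Tendsto (fun x => |radX x|) (nhds (A.kap w r u)) (nhds 0) := by
        have := hrc.abs
        rw [ContinuousAt, h0, abs_zero] at this
        exact this
      refine squeeze_zero (fun _ => norm_nonneg _) (fun x => ?_) ht
      rw [norm_smul, Real.norm_eq_abs]
      exact mul_le_of_le_one_right (abs_nonneg _) (f'_le _)
    · refine hrc.continuousWithinAt.smul ?_
      have hpos : 0 < radX (A.kap w r u) := by rw [h2]; exact h
      have hev : ∀ᶠ x in nhds (A.kap w r u), x ∈ setN D ∧ 0 < radX x :=
        (Filter.eventually_iff.2 hN).and (hrc.eventually (lt_mem_nhds hpos))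
      have hpc : ContinuousAt prX (A.kap w r u) := prX_cont.continuousAt hev
      have hfw : ContinuousWithinAt f' C (prX (A.kap w r u)) := f'_cont _ (by rw [h4 h]; exact hw)
      refine Filter.Tendsto.comp hfw (tendsto_nhdsWithin_iff.2 ⟨hpc.continuousWithinAt, ?_⟩)
      have hev' : ∀ᶠ x in nhdsWithin (A.kap w r u) M, x ∈ setN D ∧ 0 < radX x := hev.filter_mono nhdsWithin_le_nhds
      filter_upwards [hev', self_mem_nhdsWithin] with x hx hxM
      obtain ⟨⟨w', r', u'⟩, ⟨hw', hr', hu'⟩, rfl⟩ := hxM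
      dsimp only at hw' hr' hu' hx ⊢
      obtain ⟨g1, g2, g3, g4⟩ := A.kap_facts w' hr' hu'
      rw [g2] at hx
      rw [g4 hx.2]; exact hw'
  have hinj : Set.InjOn F M := by
    rintro _ ⟨⟨w, r, u⟩, ⟨hw, hr, hu⟩, rfl⟩ _ ⟨⟨w', r', u'⟩, ⟨hw', hr', hu'⟩, rfl⟩ h
    dsimp only at hw hr hu hw' hr' hu' h ⊢
    rw [hF w hw r hr u hu, hF w' hw' r' hr' u' hu', Prod.mk.injEq] at h
    obtain ⟨h1, rfl⟩ := h
    have hrr : r = r' := by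
      have := congrArg norm h1
      rwa [norm_smul, norm_smul, f'_norm w hw, f'_norm w' hw', mul_one, mul_one, Real.norm_of_nonneg hr.1, Real.norm_of_nonneg hr'.1] at this
    subst hrr
    rcases hr.1.eq_or_lt with h | h
    · rw [← h]; exact A.kap_axis_const hu isPreconnected_connectedComponent hw hw'
    · have h2 : f' w = f' w' := smul_right_injective _ h.ne' h1
      rw [f'_mem w hw, f'_mem w' hw'] at h2
      have := f.injective (Subtype.ext h2)
      rw [Subtype.mk.injEq] at this
      rw [this]
  have hsub : A.MX z ⊆ M := by
    intro x hx
    obtain ⟨w, hw, r, hr, u, hu, rfl⟩ := A.MX_kap hx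
    exact ⟨(w, r, u), ⟨hw, ⟨hr.1, hr.2.le⟩, ⟨hu.1.le, hu.2.le⟩⟩, rfl⟩
  have hemb2 := emb_aux hM hFc hinj hsub
  have hrange : Set.range ((A.MX z).domRestrict F) = Metric.ball (0 : E3 × ℝ) (1/16) := by
    rw [Set.range_domRestrict]
    ext ⟨a, u⟩
    rw [mem_ball_zero_iff, Prod.norm_def, max_lt_iff, Real.norm_eq_abs, abs_lt]
    constructor
    · rintro ⟨x, hx, he⟩
      obtain ⟨w, hw, r, hr, u', hu, rfl⟩ := A.MX_kap hx
      rw [hF w hw r ⟨hr.1, hr.2.le⟩ u' ⟨hu.1.le, hu.2.le⟩, Prod.mk.injEq] at he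
      obtain ⟨rfl, rfl⟩ := he
      refine ⟨?_, hu⟩
      dsimp only
      rw [norm_smul, f'_norm w hw, mul_one, Real.norm_of_nonneg hr.1]; exact hr.2
    · rintro ⟨ha, hu⟩
      dsimp only at ha hu
      by_cases h0 : a = 0
      · refine ⟨A.kap z 0 u, A.kap_MX mem_connectedComponent ⟨le_rfl, by norm_num⟩ hu, ?_⟩
        rw [hF z mem_connectedComponent 0 ⟨le_rfl, by norm_num⟩ u ⟨hu.1.le, hu.2.le⟩, h0, zero_smul]
      · have hn : 0 < ‖a‖ := norm_pos_iff.2 h0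
        obtain ⟨w, hw⟩ := f.surjective ⟨‖a‖⁻¹ • a, by
          rw [mem_sphere_zero_iff_norm, norm_smul, norm_inv, norm_norm, inv_mul_cancel₀ hn.ne']⟩
        refine ⟨A.kap w.1 ‖a‖ u, A.kap_MX w.2 ⟨hn.le, ha⟩ hu, ?_⟩
        rw [hF w.1 w.2 ‖a‖ ⟨hn.le, ha.le⟩ u ⟨hu.1.le, hu.2.le⟩, f'_mem w.1 w.2, Subtype.coe_eta, hw, smul_smul, mul_inv_cancel₀ hn.ne', one_smul]
  obtain ⟨e⟩ := box_homeo
  exact ⟨hemb2.toHomeomorph.trans ((Homeomorph.setCongr hrange).trans e)⟩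

end DD

theorem forward (hD : Dir D) (hS : Surf D) : Euclid D := by
  obtain ⟨o, o1, o2⟩ := hD
  let A : DD D := ⟨o, o1, o2⟩
  intro i s hs
  obtain ⟨f⟩ := hS (dfl (i, ⟨s, hs⟩))
  refine ⟨A.MX (dfl (i, ⟨s, hs⟩)), A.MX_open _, ?_, A.MX_euclid _ f⟩
  have hb : bigS (edgeMidpoint s hs).1 = s := by
    refine bigS_eq (edgeMidpoint s hs).2.1 (edgeMidpoint s hs).2.2 hs fun v hv => ?_
    simp only [edgeMidpoint, if_pos hv]; norm_num
  have hsum : ∀ v ∈ s, (edgeMidpoint s hs).1 v = 1/2 := fun v hv => if_pos hv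
  refine ⟨_, ⟨by dsimp only; rw [hb]; exact hs, ?_, ?_, ?_⟩, rfl⟩
  · simp only [hb]; exact mem_connectedComponent
  · dsimp only
    rw [hb, Finset.sum_congr rfl hsum, Finset.sum_const, hs]; norm_num
  · unfold DD.htT
    dsimp only
    rw [hb, Finset.sum_congr rfl (fun v hv => by rw [hsum v hv]), ← Finset.sum_mul, A.sg_sum i hs]
    norm_num
end

section
variable {D : GlueingDatum 4}

theorem radX_nonneg' (p : GlueTotal D) : 0 ≤ 1 - ∑ v ∈ bigS p.2.1, p.2.1 v := by
  have : ∑ v ∈ bigS p.2.1, p.2.1 v ≤ ∑ v, p.2.1 v :=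
    Finset.sum_le_sum_of_subset_of_nonneg (Finset.subset_univ _) (fun v _ _ => p.2.2.1 v)
  rw [p.2.2.2] at this; linarith

namespace DD

theorem axis_mem (A : DD D) {x : GlueSpace D} (hx : x ∈ setN D) (hr : radX x ≤ 0) (hu : A.htX x = 0) :
    x ∈ Set.range fun z => A.kap z 0 0 := by
  obtain ⟨p, hp, rfl⟩ := hx
  have h0 := radX_nonneg' p
  rw [radX_mk] at hr
  have := A.kap_zero (j := p.1) (y := p.2) hp (by rw [radX_mk]; exact le_antisymm hr h0) 
    (by have : A.htX (Quot.mk (glueRel D) ⟨p.1, p.2⟩) = 0 := hu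
        rw [this]; norm_num) (defaultT _ hp).2
  have h2 : A.htX (Quot.mk (glueRel D) ⟨p.1, p.2⟩) = 0 := hu
  rw [h2] at this
  exact ⟨_, this⟩

theorem kap_mid (A : DD D) (H : Euclid D) (z : SurfSpace D) : ∃ U : Set (GlueSpace D), IsOpen U ∧ A.kap z 0 0 ∈ U ∧ Nonempty (U ≃ₜ E4) := by
  revert z
  refine surf_ind fun τ x hx => ?_
  obtain ⟨j, s, hs⟩ := τ
  obtain ⟨U, h1, h2, h3⟩ := H j s hs
  refine ⟨U, h1, ?_, h3⟩
  rw [A.kap_mkS hx ⟨le_rfl, by norm_num⟩ ⟨by norm_num, by norm_num⟩, toX_mem (A.kY_mem hs hx ⟨le_rfl, by norm_num⟩ ⟨by norm_num, by norm_num⟩)]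
  have : (⟨A.kY j s x 0 0, A.kY_mem hs hx ⟨le_rfl, by norm_num⟩ ⟨by norm_num, by norm_num⟩⟩ : Delta 4) = edgeMidpoint s hs := by
    apply Subtype.ext
    funext v
    simp [kY, edgeMidpoint]
  dsimp only
  rw [this]; exact h2

set_option maxHeartbeats 1000000 in
theorem T5 (A : DD D) (H : Euclid D) {m : ℕ} (c : SurfSpace D → Fin m → ℝ) (hc : ∀ i j, Continuous fun z => c z i * c z j)
    (h0 : ∀ z, c z ≠ 0) (γ : ℝ → SurfSpace D) (hγ : ContinuousOn γ (Set.Icc 0 1)) (hl : γ 0 = γ 1) :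
    ∀ᶠ n in Filter.atTop, hol (signW c) γ n = 0 := by
  have hz : (0:ℝ) ∈ Set.Icc (-(1/16):ℝ) (1/16) := ⟨by norm_num, by norm_num⟩
  have hz' : (0:ℝ) ∈ Set.Icc (0:ℝ) (1/16) := ⟨by norm_num, by norm_num⟩
  set p := A.kap (γ 0) 0 0 with hp
  obtain ⟨hpN, hpr, hpu, -⟩ := A.kap_facts (γ 0) hz' hz
  rw [← hp] at hpN hpr hpu
  obtain ⟨U₀, hU₀, hpU₀, hE⟩ := A.kap_mid H (γ 0)
  obtain ⟨U, hU, hpU, ⟨ψ⟩, hUN, hUF⟩ := nice_nhd hU₀ hE hpU₀ hpN _ (A.kap_axis_fin hz)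
  rw [← hp] at hpU hUF
  have hcn : IsPreconnected (γ '' Set.Icc (0:ℝ) 1) := isPreconnected_Icc.image _ hγ
  have hax : ∀ u ∈ Set.Icc (-(1/16):ℝ) (1/16), ∀ s ∈ Set.Icc (0:ℝ) 1, A.kap (γ s) 0 u = A.kap (γ 0) 0 u := by
    intro u hu s hs
    exact A.kap_axis_const hu hcn ⟨s, hs, rfl⟩ ⟨0, by norm_num, rfl⟩
  -- choose η
  have hcf : ContinuousOn (fun q : ℝ × ℝ × ℝ => A.kap (γ q.2.1) (q.1 * (1 - |q.2.2|)) (q.2.2 * q.1))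
      (Set.Icc 0 (1/16) ×ˢ (Set.Icc 0 1 ×ˢ Set.Icc (-1) 1)) := by
    refine A.kap_cont.comp_continuousOn (f := fun q : ℝ × ℝ × ℝ => (γ q.2.1, q.1 * (1 - |q.2.2|), q.2.2 * q.1)) ?_
    refine ContinuousOn.prodMk ?_ (Continuous.continuousOn (by fun_prop))
    exact hγ.comp (by fun_prop) (fun q hq => hq.2.1)
  obtain ⟨η, hη, hη', hin⟩ := tube_small (isCompact_Icc.prod isCompact_Icc) _ (by norm_num) hcf hU (by
    rintro ⟨s, t⟩ ⟨hs, ht⟩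
    dsimp only at hs ht ⊢
    rw [zero_mul, mul_zero, hax 0 hz s hs]; exact hpU)
  have hr : ∀ t ∈ Set.Icc (-1:ℝ) 1, η * (1 - |t|) ∈ Set.Icc (0:ℝ) (1/16) := by
    intro t ht
    have : |t| ≤ 1 := abs_le.2 ht
    have h2 := abs_nonneg t
    constructor
    · apply mul_nonneg hη.le; linarith
    · nlinarith
  have hu : ∀ t ∈ Set.Icc (-1:ℝ) 1, t * η ∈ Set.Icc (-(1/16):ℝ) (1/16) := by
    intro t ht
    constructor <;> nlinarith [ht.1, ht.2]
  have hpart : IsOpen (U ∩ radX ⁻¹' (Set.Ioi 0)) := (radX_cont.mono hUN).isOpen_inter_preimage hU isOpen_Ioi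
  have hw : ∀ᶠ n in Filter.atTop, hol (fun x y => signW c (prX x) (prX y)) (fun s => A.kap (γ s) (η * (1 - |(0:ℝ)|)) (0 * η)) n = 0 := by
    have key := lemmaB ψ p hpU {x | radX x ≤ 0 ∧ 0 ≤ A.htX x} {x | radX x ≤ 0 ∧ A.htX x ≤ 0} (w := fun x y => signW c (prX x) (prX y))
      (D := fun q => A.kap (γ q.1) (η * (1 - |q.2|)) (q.2 * η))
    refine key ?_ ?_ ?_ ?_ (fun x => signW_self _ _) ?_ ?_ ?_ ?_ ?_ ?_ ?_ <;> clear key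
    · have : U \ {x | radX x ≤ 0 ∧ 0 ≤ A.htX x} = (U ∩ radX ⁻¹' (Set.Ioi 0)) ∪ (U ∩ A.htX ⁻¹' (Set.Iio 0)) := by
        ext x; simp; grind
      rw [this]
      exact hpart.union ((A.htX_cont.mono hUN).isOpen_inter_preimage hU isOpen_Iio)
    · have : U \ {x | radX x ≤ 0 ∧ A.htX x ≤ 0} = (U ∩ radX ⁻¹' (Set.Ioi 0)) ∪ (U ∩ A.htX ⁻¹' (Set.Ioi 0)) := by
        ext x; simp; grind
      rw [this]
      exact hpart.union ((A.htX_cont.mono hUN).isOpen_inter_preimage hU isOpen_Ioi)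
    · rintro x hx ⟨h1, h2⟩ ⟨-, h3⟩
      exact hUF x hx (A.axis_mem (hUN hx) h1 (le_antisymm h3 h2))
    · have : U \ ({x | radX x ≤ 0 ∧ 0 ≤ A.htX x} ∪ {x | radX x ≤ 0 ∧ A.htX x ≤ 0}) = U ∩ radX ⁻¹' (Set.Ioi 0) := by
        ext x; simp
        intro _
        constructor
        · rintro ⟨h1, h2⟩
          by_contra! h3
          have := h1 h3; have := h2 h3; linarith
        · intro h; exact ⟨fun h' => absurd h h'.not_gt, fun h' => absurd h h'.not_gt⟩
      rw [this]
      refine isAS_pull hpart (prX_cont.mono fun x hx => ⟨hUN hx.1, hx.2⟩) (signW_isAS c isOpen_univ (fun i j => (hc i j).continuousOn) (fun z _ => h0 z)) (fun _ _ => trivial)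
    · exact hcf.comp (f := fun q : ℝ × ℝ => (η, q.1, q.2)) (by fun_prop) (fun q hq => ⟨⟨hη.le, hη'⟩, hq⟩)
    · intro s hs t ht
      refine ⟨hin (s, t) ⟨hs, ht⟩, ?_⟩
      intro hh
      have hh : A.kap (γ s) (η * (1 - |t|)) (t * η) = p := hh
      obtain ⟨-, g1, g2, -⟩ := A.kap_facts (γ s) (hr t ht) (hu t ht)
      rw [hh, hpr] at g1
      rw [hh, hpu] at g2
      have ht0 : t = 0 := by
        rcases mul_eq_zero.1 g2.symm with h | h
        · exact h
        · exact absurd h hη.ne'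
      rw [ht0] at g1; simp at g1; exact hη.ne g1
    · intro t _; dsimp only; rw [hl]
    · intro s hs; dsimp only
      rw [abs_one, sub_self, mul_zero]
      exact hax _ (hu 1 (by norm_num)) s hs
    · intro s hs; dsimp only
      rw [abs_neg, abs_one, sub_self, mul_zero]
      exact hax _ (hu (-1) (by norm_num)) s hs
    · rintro s hs t ht ⟨k1, k2⟩
      have ht' : t ∈ Set.Icc (-1:ℝ) 1 := ⟨by linarith [ht.1], ht.2⟩
      obtain ⟨-, g1, g2, -⟩ := A.kap_facts (γ s) (hr t ht') (hu t ht')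
      dsimp only at k1 k2
      rw [g1, abs_of_nonneg ht.1] at k1
      rw [g2] at k2
      nlinarith [ht.1, ht.2]
    · rintro s hs t ht ⟨k1, k2⟩
      have ht' : t ∈ Set.Icc (-1:ℝ) 1 := ⟨ht.1, by linarith [ht.2]⟩
      obtain ⟨-, g1, g2, -⟩ := A.kap_facts (γ s) (hr t ht') (hu t ht')
      dsimp only at k1 k2
      rw [g1, abs_of_nonpos ht.2] at k1
      rw [g2] at k2
      nlinarith [ht.1, ht.2]
  filter_upwards [hw, Filter.eventually_gt_atTop 0] with n hn hn0
  rw [← hn]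
  have e : hol (fun x y => signW c (prX x) (prX y)) (fun s => A.kap (γ s) (η * (1 - |(0:ℝ)|)) (0 * η)) n
    = hol (signW c) (fun s => prX (A.kap (γ s) (η * (1 - |(0:ℝ)|)) (0 * η))) n := rfl
  rw [e]
  refine (hol_congr _ (fun s hs => ?_) hn0).symm
  have h00 : (0:ℝ) ∈ Set.Icc (-1:ℝ) 1 := by norm_num
  exact (A.kap_facts (γ s) (hr 0 h00) (hu 0 h00)).2.2.2 (by simpa using hη)

end DD
end

section
/-- continuity descends along maps from a compact set to a Hausdorff space -/
theorem cont_desc {X Y Z : Type*} [TopologicalSpace X] [TopologicalSpace Y] [T2Space Y] [TopologicalSpace Z]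
    {K : Set X} (hK : IsCompact K) {q : X → Y} (hq : ContinuousOn q K) {F : Y → Z} (h : ContinuousOn (fun x => F (q x)) K) :
    ContinuousOn F (q '' K) := by
  haveI : CompactSpace K := isCompact_iff_compactSpace.1 hK
  rw [continuousOn_iff_continuous_domRestrict]
  let q' : K → q '' K := fun x => ⟨q x.1, ⟨x.1, x.2, rfl⟩⟩
  have hq' : Continuous q' := (continuousOn_iff_continuous_domRestrict.1 hq).subtype_mk _
  have hs : Function.Surjective q' := by
    rintro ⟨_, x, hx, rfl⟩; exact ⟨⟨x, hx⟩, rfl⟩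
  have hqm : Topology.IsQuotientMap q' := hq'.isClosedMap.isQuotientMap hq' hs
  rw [hqm.continuous_iff]
  exact continuousOn_iff_continuous_domRestrict.1 h

abbrev BB : Set ℂ := Metric.closedBall (0:ℂ) 1

theorem mem_BB {z : ℂ} : z ∈ BB ↔ ‖z‖ ≤ 1 := mem_closedBall_zero_iff

def pt (θ : ℝ) : ℂ := Complex.exp ((2 * Real.pi * θ : ℝ) * Complex.I)

theorem pt_re (θ : ℝ) : (pt θ).re = Real.cos (2 * Real.pi * θ) := Complex.exp_ofReal_mul_I_re _
theorem pt_im (θ : ℝ) : (pt θ).im = Real.sin (2 * Real.pi * θ) := Complex.exp_ofReal_mul_I_im _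
theorem pt_norm (θ : ℝ) : ‖pt θ‖ = 1 := Complex.norm_exp_ofReal_mul_I _
theorem pt_add (a b : ℝ) : pt (a + b) = pt a * pt b := by
  unfold pt; rw [← Complex.exp_add]; congr 1; push_cast; ring
theorem pt_zero : pt 0 = 1 := by simp [pt]
theorem pt_one : pt 1 = 1 := by
  unfold pt; rw [mul_one]; push_cast; exact Complex.exp_two_pi_mul_I
theorem pt_int (n : ℤ) : pt n = 1 := by
  unfold pt; push_cast
  rw [show (2 * (Real.pi:ℂ) * n * Complex.I) = n * (2 * Real.pi * Complex.I) by ring]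
  exact Complex.exp_int_mul_two_pi_mul_I n
theorem pt_half : pt (1/2) = -1 := by
  unfold pt
  rw [show (2 * Real.pi * (1/2) : ℝ) = Real.pi by ring]
  exact Complex.exp_pi_mul_I
theorem pt_ne (θ : ℝ) : pt θ ≠ 0 := Complex.exp_ne_zero _
theorem pt_cont : Continuous pt := by unfold pt; fun_prop

theorem pt_eq_iff {a b : ℝ} : pt a = pt b ↔ ∃ n : ℤ, a = b + n := by
  unfold pt
  rw [Complex.exp_eq_exp_iff_exists_int]
  refine exists_congr fun n => ?_
  have hpi : (2 * Real.pi : ℝ) ≠ 0 := by positivity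
  constructor
  · intro h
    have h1 := congrArg Complex.im h
    simp at h1
    apply mul_left_cancel₀ hpi
    linarith
  · rintro rfl; push_cast; ring

theorem pt_inj {a b : ℝ} (ha : a ∈ Set.Ico (0:ℝ) 1) (hb : b ∈ Set.Ico (0:ℝ) 1) (h : pt a = pt b) : a = b := by
  obtain ⟨n, hn⟩ := pt_eq_iff.1 h
  have h1 : (n:ℝ) < 1 := by linarith [ha.2, hb.1]
  have h2 : (-1:ℝ) < n := by linarith [ha.1, hb.2]
  have : n = 0 := by
    have h1' : n < 1 := by exact_mod_cast h1
    have h2' : -1 < n := by exact_mod_cast h2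
    omega
  rw [hn, this]; simp

theorem polar (z : ℂ) : ∃ θ ∈ Set.Ico (0:ℝ) 1, z = ‖z‖ * pt θ := by
  have hpi : (2 * Real.pi : ℝ) ≠ 0 := by positivity
  refine ⟨Int.fract (z.arg / (2 * Real.pi)), ⟨Int.fract_nonneg _, Int.fract_lt_one _⟩, ?_⟩
  have e : pt (Int.fract (z.arg / (2 * Real.pi))) = pt (z.arg / (2 * Real.pi)) := by
    rw [pt_eq_iff]
    refine ⟨-⌊z.arg / (2 * Real.pi)⌋, ?_⟩
    rw [Int.fract]; push_cast; ring
  rw [e]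
  unfold pt
  rw [mul_div_cancel₀ _ hpi]
  exact (Complex.norm_mul_exp_arg_mul_I z).symm

def th (z : ℂ) : ℝ := Classical.choose (polar z)
theorem th_mem (z : ℂ) : th z ∈ Set.Ico (0:ℝ) 1 := (Classical.choose_spec (polar z)).1
theorem th_eq (z : ℂ) : z = ‖z‖ * pt (th z) := (Classical.choose_spec (polar z)).2

section disc
variable {E : Type*} [NormedAddCommGroup E] [NormedSpace ℝ E]

def discExt (f : ℝ → E) (z : ℂ) : E := ‖z‖ • f (th z)

theorem norm_polar {ρ : ℝ} (hρ : 0 ≤ ρ) (θ : ℝ) : ‖(ρ : ℂ) * pt θ‖ = ρ := by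
  rw [norm_mul, pt_norm, mul_one, Complex.norm_real, Real.norm_of_nonneg hρ]

theorem discExt_val {f : ℝ → E} (h01 : f 0 = f 1) {ρ θ : ℝ} (hρ : 0 ≤ ρ) (hθ : θ ∈ Set.Icc (0:ℝ) 1) :
    discExt f (ρ * pt θ) = ρ • f θ := by
  unfold discExt
  rw [norm_polar hρ]
  rcases hρ.eq_or_lt with h | h
  · rw [← h, zero_smul, zero_smul]
  have h1 := th_eq (ρ * pt θ)
  rw [norm_polar hρ] at h1
  have h2 : pt θ = pt (th (ρ * pt θ)) := mul_left_cancel₀ (by exact_mod_cast h.ne') h1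
  have hm := th_mem (ρ * pt θ)
  rcases hθ.2.eq_or_lt with h3 | h3
  · rw [h3, pt_one, ← pt_zero] at h2
    have := pt_inj ⟨le_rfl, by norm_num⟩ (by rw [h3, pt_one, ← pt_zero] at hm; exact hm) h2
    rw [h3, ← h01, pt_one, ← pt_zero, ← this]
  · rw [← pt_inj ⟨hθ.1, h3⟩ hm h2]

theorem BB_polar : (fun q : ℝ × ℝ => (q.1 : ℂ) * pt q.2) '' (Set.Icc 0 1 ×ˢ Set.Icc 0 1) = BB := by
  ext z
  rw [mem_BB]
  constructor
  · rintro ⟨⟨ρ, θ⟩, ⟨h1, h2⟩, rfl⟩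
    dsimp only at *
    rw [norm_polar h1.1]; exact h1.2
  · intro h
    exact ⟨(‖z‖, th z), ⟨⟨norm_nonneg _, h⟩, ⟨(th_mem z).1, (th_mem z).2.le⟩⟩, (th_eq z).symm⟩

theorem discExt_cont {f : ℝ → E} (hf : ContinuousOn f (Set.Icc 0 1)) (h01 : f 0 = f 1) : ContinuousOn (discExt f) BB := by
  rw [← BB_polar]
  refine cont_desc (isCompact_Icc.prod isCompact_Icc) ?_ ?_
  · have := pt_cont
    apply Continuous.continuousOn; fun_prop
  · have : ContinuousOn (fun q : ℝ × ℝ => q.1 • f q.2) (Set.Icc 0 1 ×ˢ Set.Icc 0 1) :=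
      continuous_fst.continuousOn.smul (hf.comp continuous_snd.continuousOn (fun q hq => hq.2))
    refine this.congr ?_
    rintro ⟨ρ, θ⟩ ⟨h1, h2⟩
    exact discExt_val h01 h1.1 h2

end disc

/-! ### angular rescaling -/
def hpl (l m θ : ℝ) : ℝ := m / l * min θ l + (1 - m) / (1 - l) * max 0 (θ - l)

theorem hpl_le {l m θ : ℝ} (h : θ ≤ l) : hpl l m θ = m / l * θ := by
  unfold hpl; rw [min_eq_left h, max_eq_left (by linarith)]; ring
theorem hpl_ge {l m θ : ℝ} (hl : 0 < l) (h : l ≤ θ) : hpl l m θ = m + (1 - m) / (1 - l) * (θ - l) := by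
  unfold hpl; rw [min_eq_right h, max_eq_right (by linarith)]; field_simp

theorem hpl_mem {l m : ℝ} (hl : l ∈ Set.Ioo (0:ℝ) 1) (hm : m ∈ Set.Ioo (0:ℝ) 1) {θ : ℝ} (hθ : θ ∈ Set.Icc (0:ℝ) 1) :
    hpl l m θ ∈ Set.Icc (0:ℝ) 1 := by
  have h1 : 0 < 1 - l := by linarith [hl.2]
  have h2 : 0 < 1 - m := by linarith [hm.2]
  rcases le_total θ l with h | h
  · rw [hpl_le h]
    refine ⟨mul_nonneg (div_pos hm.1 hl.1).le hθ.1, ?_⟩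
    have : m / l * θ ≤ m / l * l := mul_le_mul_of_nonneg_left h (div_pos hm.1 hl.1).le
    rw [div_mul_cancel₀ _ hl.1.ne'] at this
    linarith [hm.2]
  · rw [hpl_ge hl.1 h]
    have h3 : 0 ≤ (1 - m) / (1 - l) * (θ - l) := mul_nonneg (div_pos h2 h1).le (by linarith)
    refine ⟨by linarith [hm.1], ?_⟩
    have : (1 - m) / (1 - l) * (θ - l) ≤ (1 - m) / (1 - l) * (1 - l) := mul_le_mul_of_nonneg_left (by linarith [hθ.2]) (div_pos h2 h1).le
    rw [div_mul_cancel₀ _ h1.ne'] at this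
    linarith

theorem hpl_inv {l m : ℝ} (hl : l ∈ Set.Ioo (0:ℝ) 1) (hm : m ∈ Set.Ioo (0:ℝ) 1) {θ : ℝ} :
    hpl m l (hpl l m θ) = θ := by
  have h1 : 0 < 1 - l := by linarith [hl.2]
  have h2 : 0 < 1 - m := by linarith [hm.2]
  have h3 := hl.1
  have h4 := hm.1
  rcases le_total θ l with h | h
  · rw [hpl_le h, hpl_le]
    · field_simp
    · have : m / l * θ ≤ m / l * l := mul_le_mul_of_nonneg_left h (div_pos hm.1 hl.1).le
      rwa [div_mul_cancel₀ _ hl.1.ne'] at this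
  · have h5 : 0 ≤ (1 - m) / (1 - l) * (θ - l) := mul_nonneg (div_pos h2 h1).le (by linarith)
    rw [hpl_ge hl.1 h, hpl_ge hm.1 (by linarith)]
    field_simp; ring

theorem hpl_zero {l m : ℝ} (hl : l ∈ Set.Ioo (0:ℝ) 1) : hpl l m 0 = 0 := by rw [hpl_le hl.1.le]; ring
theorem hpl_one {l m : ℝ} (hl : l ∈ Set.Ioo (0:ℝ) 1) : hpl l m 1 = 1 := by
  have h1 : 0 < 1 - l := by linarith [hl.2]
  rw [hpl_ge hl.1 hl.2.le]; field_simp; ring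
theorem hpl_cont (l m : ℝ) : Continuous (hpl l m) := by unfold hpl; fun_prop

def Rad (l m : ℝ) : ℂ → ℂ := discExt fun θ => pt (hpl l m θ)


theorem Rad01 {l m : ℝ} (hl : l ∈ Set.Ioo (0:ℝ) 1) : pt (hpl l m 0) = pt (hpl l m 1) := by
  rw [hpl_zero hl, hpl_one hl, pt_zero, pt_one]

theorem Rad_cont {l m : ℝ} (hl : l ∈ Set.Ioo (0:ℝ) 1) : ContinuousOn (Rad l m) BB :=
  discExt_cont ((pt_cont.comp (hpl_cont l m)).continuousOn) (Rad01 hl)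

theorem Rad_val {l m : ℝ} (hl : l ∈ Set.Ioo (0:ℝ) 1) {ρ θ : ℝ} (hρ : 0 ≤ ρ) (hθ : θ ∈ Set.Icc (0:ℝ) 1) : Rad l m (ρ * pt θ) = ρ * pt (hpl l m θ) :=
  (discExt_val (Rad01 hl) hρ hθ).trans (Complex.real_smul)

theorem Rad_pt {l m : ℝ} (hl : l ∈ Set.Ioo (0:ℝ) 1) {θ : ℝ} (hθ : θ ∈ Set.Icc (0:ℝ) 1) : Rad l m (pt θ) = pt (hpl l m θ) := by
  have := Rad_val (m := m) hl zero_le_one hθ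
  simpa using this

theorem Rad_norm {l m : ℝ} (hl : l ∈ Set.Ioo (0:ℝ) 1) (z : ℂ) : ‖Rad l m z‖ = ‖z‖ := by
  have h := th_mem z
  rw [th_eq z, Rad_val hl (norm_nonneg _) ⟨h.1, h.2.le⟩, norm_polar (norm_nonneg _), norm_polar (norm_nonneg _)]

theorem Rad_inv {l m : ℝ} (hl : l ∈ Set.Ioo (0:ℝ) 1) (hm : m ∈ Set.Ioo (0:ℝ) 1) (z : ℂ) : Rad m l (Rad l m z) = z := by
  have h := th_mem z
  have h' : th z ∈ Set.Icc (0:ℝ) 1 := ⟨h.1, h.2.le⟩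
  conv_lhs => rw [th_eq z]
  rw [Rad_val hl (norm_nonneg _) h', Rad_val hm (norm_nonneg _) (hpl_mem hl hm h'), hpl_inv hl hm, ← th_eq z]

theorem Rad_mem {l m : ℝ} (hl : l ∈ Set.Ioo (0:ℝ) 1) (hm : m ∈ Set.Ioo (0:ℝ) 1) {z : ℂ} (hz : z ∈ BB) : Rad l m z ∈ BB := by
  rw [mem_BB] at *; rwa [Rad_norm hl]

theorem Rad_inj {l m : ℝ} (hl : l ∈ Set.Ioo (0:ℝ) 1) (hm : m ∈ Set.Ioo (0:ℝ) 1) {z w : ℂ} (h : Rad l m z = Rad l m w) : z = w := by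
  rw [← Rad_inv hl hm z, h, Rad_inv hl hm]

/-! ### upper half disc -/
def VV (z : ℂ) : ℂ := ⟨z.re, (z.im + Real.sqrt (1 - z.re ^ 2)) / 2⟩

theorem VV_cont : Continuous VV := by
  have h1 : Continuous fun z : ℂ => z.re := Complex.continuous_re
  have h2 : Continuous fun z : ℂ => (z.im + Real.sqrt (1 - z.re ^ 2)) / 2 := by
    have := Complex.continuous_im
    fun_prop
  have : VV = fun z : ℂ => ((z.re : ℝ) : ℂ) + (((z.im + Real.sqrt (1 - z.re ^ 2)) / 2 : ℝ) : ℂ) * Complex.I := by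
    funext z; apply Complex.ext <;> simp [VV]
  rw [this]
  exact (Complex.continuous_ofReal.comp h1).add ((Complex.continuous_ofReal.comp h2).mul continuous_const)

theorem VV_inj {z w : ℂ} (h : VV z = VV w) : z = w := by
  have h1 : z.re = w.re := by
    have h' : (VV z).re = (VV w).re := by rw [h]
    exact h'
  have h2 : (z.im + Real.sqrt (1 - z.re ^ 2)) / 2 = (w.im + Real.sqrt (1 - w.re ^ 2)) / 2 := by
    have h' : (VV z).im = (VV w).im := by rw [h]
    exact h'
  rw [h1] at h2
  exact Complex.ext h1 (by linarith)

theorem BB_sq {z : ℂ} : z ∈ BB ↔ z.re ^ 2 + z.im ^ 2 ≤ 1 := by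
  rw [mem_BB, ← abs_of_nonneg (norm_nonneg z), ← sq_le_one_iff_abs_le_one, ← Complex.normSq_eq_norm_sq, Complex.normSq_apply]
  constructor <;> intro h <;> nlinarith

theorem VV_mem {z : ℂ} (hz : z ∈ BB) : VV z ∈ BB ∧ 0 ≤ (VV z).im := by
  rw [BB_sq] at hz
  have h0 : 0 ≤ 1 - z.re ^ 2 := by nlinarith
  have h1 := Real.sqrt_nonneg (1 - z.re ^ 2)
  have h2 := Real.sq_sqrt h0
  have h3 : |z.im| ≤ Real.sqrt (1 - z.re ^ 2) := Real.abs_le_sqrt (by linarith)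
  obtain ⟨h4, h5⟩ := abs_le.1 h3
  constructor
  · rw [BB_sq]
    show z.re ^ 2 + ((z.im + Real.sqrt (1 - z.re ^ 2)) / 2) ^ 2 ≤ 1
    nlinarith
  · show 0 ≤ (z.im + Real.sqrt (1 - z.re ^ 2)) / 2
    linarith

theorem VV_surj {z : ℂ} (hz : z ∈ BB) (h : 0 ≤ z.im) : ∃ w ∈ BB, VV w = z := by
  rw [BB_sq] at hz
  have h0 : 0 ≤ 1 - z.re ^ 2 := by nlinarith
  have h1 := Real.sqrt_nonneg (1 - z.re ^ 2)
  have h2 := Real.sq_sqrt h0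
  have h3 : |z.im| ≤ Real.sqrt (1 - z.re ^ 2) := Real.abs_le_sqrt (by linarith)
  obtain ⟨h4, h5⟩ := abs_le.1 h3
  refine ⟨⟨z.re, 2 * z.im - Real.sqrt (1 - z.re ^ 2)⟩, ?_, ?_⟩
  · rw [BB_sq]; dsimp only; nlinarith
  · apply Complex.ext
    · rfl
    · simp [VV]

theorem VV_up {θ : ℝ} (h : θ ∈ Set.Icc (0:ℝ) (1/2)) : VV (pt θ) = pt θ := by
  have hpi := Real.pi_pos
  have hs : 0 ≤ Real.sin (2 * Real.pi * θ) := Real.sin_nonneg_of_nonneg_of_le_pi (mul_nonneg (by positivity) h.1) (by nlinarith [h.2])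
  apply Complex.ext
  · rfl
  · simp only [VV, pt_re, pt_im]
    rw [← Real.sin_sq, Real.sqrt_sq hs]; ring

theorem VV_down {t : ℝ} (h : t ∈ Set.Icc (0:ℝ) 1) : VV (pt (1/2 + t/2)) = ((-Real.cos (Real.pi * t) : ℝ) : ℂ) := by
  have hpi := Real.pi_pos
  have hs : 0 ≤ Real.sin (Real.pi * t) := Real.sin_nonneg_of_nonneg_of_le_pi (mul_nonneg hpi.le h.1) (by nlinarith [h.2])
  have e : 2 * Real.pi * (1/2 + t/2) = Real.pi * t + Real.pi := by ring
  apply Complex.ext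
  · simp only [VV, pt_re]
    rw [e, Real.cos_add_pi, Complex.ofReal_re]
  · simp only [VV, pt_re, pt_im]
    rw [e, Real.cos_add_pi, Real.sin_add_pi, neg_sq, ← Real.sin_sq, Real.sqrt_sq hs, Complex.ofReal_im]; ring

def Up (l : ℝ) (z : ℂ) : ℂ := VV (Rad l (1/2) z)

theorem half_mem : (1/2 : ℝ) ∈ Set.Ioo (0:ℝ) 1 := by norm_num


theorem Up_cont {l : ℝ} (hl : l ∈ Set.Ioo (0:ℝ) 1) : ContinuousOn (Up l) BB := VV_cont.comp_continuousOn (Rad_cont hl)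
theorem Up_inj {l : ℝ} (hl : l ∈ Set.Ioo (0:ℝ) 1) {z w : ℂ} (h : Up l z = Up l w) : z = w := Rad_inj hl half_mem (VV_inj h)
theorem Up_mem {l : ℝ} (hl : l ∈ Set.Ioo (0:ℝ) 1) {z : ℂ} (hz : z ∈ BB) : Up l z ∈ BB ∧ 0 ≤ (Up l z).im := VV_mem (Rad_mem hl half_mem hz)
theorem Up_surj {l : ℝ} (hl : l ∈ Set.Ioo (0:ℝ) 1) {z : ℂ} (hz : z ∈ BB) (h : 0 ≤ z.im) : ∃ w ∈ BB, Up l w = z := by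
  obtain ⟨w, hw, rfl⟩ := VV_surj hz h
  exact ⟨Rad (1/2) l w, Rad_mem half_mem hl hw, by unfold Up; rw [Rad_inv half_mem hl]⟩
theorem Up_up {l : ℝ} (hl : l ∈ Set.Ioo (0:ℝ) 1) {θ : ℝ} (hθ : θ ∈ Set.Icc (0:ℝ) l) : Up l (pt θ) = pt (θ / (2 * l)) := by
  have h0 := hl.1
  unfold Up
  rw [Rad_pt hl ⟨hθ.1, hθ.2.trans hl.2.le⟩, hpl_le hθ.2, VV_up]
  · congr 1; field_simp
  · constructor
    · exact mul_nonneg (by positivity) hθ.1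
    · rw [show (1/2 / l * θ) = θ / (2 * l) by field_simp, div_le_div_iff₀ (by positivity) (by norm_num)]
      linarith [hθ.2]
theorem Up_down {l : ℝ} (hl : l ∈ Set.Ioo (0:ℝ) 1) {t : ℝ} (ht : t ∈ Set.Icc (0:ℝ) 1) : Up l (pt (l + (1 - l) * t)) = ((-Real.cos (Real.pi * t) : ℝ) : ℂ) := by
  have h0 := hl.1
  have h1 : 0 < 1 - l := by linarith [hl.2]
  unfold Up
  have hm : 0 ≤ (1 - l) * t := mul_nonneg h1.le ht.1
  rw [Rad_pt hl ⟨by linarith, by nlinarith [ht.2]⟩, hpl_ge h0 (by linarith), ← VV_down ht]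
  congr 2; field_simp; ring


/-! ### sphere map -/
def Sp (z : ℂ) : Fin 3 → ℝ := ![z.re * Real.sqrt (2 - z.re ^ 2), (1 - z.re ^ 2 - z.im ^ 2) - z.im ^ 2,
  2 * z.im * Real.sqrt (1 - z.re ^ 2 - z.im ^ 2)]

theorem Sp_cont : Continuous Sp := by
  have := Complex.continuous_re
  have := Complex.continuous_im
  refine continuous_pi fun i => ?_
  fin_cases i <;> simp [Sp] <;> fun_prop

theorem Sp_norm {z : ℂ} (hz : z ∈ BB) : ∑ i, Sp z i ^ 2 = 1 := by
  rw [BB_sq] at hz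
  have h1 := Real.sq_sqrt (show 0 ≤ 2 - z.re ^ 2 by nlinarith)
  have h2 := Real.sq_sqrt (show 0 ≤ 1 - z.re ^ 2 - z.im ^ 2 by nlinarith)
  simp only [Fin.sum_univ_three, Sp, Matrix.cons_val_zero, Matrix.cons_val_one, Matrix.cons_val]
  rw [mul_pow, mul_pow, h1, h2]; ring

theorem Sp_inj {z w : ℂ} (hz : z ∈ BB) (hw : w ∈ BB) (h : Sp z = Sp w) : z = w ∨ (‖z‖ = 1 ∧ w = (starRingEnd ℂ) z) := by
  rw [BB_sq] at hz hw
  have h0 : z.re * Real.sqrt (2 - z.re ^ 2) = w.re * Real.sqrt (2 - w.re ^ 2) := congrFun h 0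
  have h1 : (1 - z.re ^ 2 - z.im ^ 2) - z.im ^ 2 = (1 - w.re ^ 2 - w.im ^ 2) - w.im ^ 2 := congrFun h 1
  have h2 : 2 * z.im * Real.sqrt (1 - z.re ^ 2 - z.im ^ 2) = 2 * w.im * Real.sqrt (1 - w.re ^ 2 - w.im ^ 2) := congrFun h 2
  have a1 := Real.sq_sqrt (show 0 ≤ 2 - z.re ^ 2 by nlinarith)
  have a2 := Real.sq_sqrt (show 0 ≤ 2 - w.re ^ 2 by nlinarith)
  have p1 : 0 < Real.sqrt (2 - z.re ^ 2) := Real.sqrt_pos.2 (by nlinarith)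
  have p2 : 0 < Real.sqrt (2 - w.re ^ 2) := Real.sqrt_pos.2 (by nlinarith)
  have hre : z.re = w.re := by
    have hs : z.re ^ 2 * (2 - z.re ^ 2) = w.re ^ 2 * (2 - w.re ^ 2) := by
      rw [← a1, ← a2, ← mul_pow, ← mul_pow, h0]
    have hsq : z.re ^ 2 = w.re ^ 2 := by
      have h3 : (z.re ^ 2 - w.re ^ 2) * (2 - z.re ^ 2 - w.re ^ 2) = 0 := by linarith
      rcases mul_eq_zero.1 h3 with h4 | h4
      · linarith
      · nlinarith [sq_nonneg z.im, sq_nonneg w.im]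
    rw [hsq] at h0
    exact mul_right_cancel₀ p2.ne' h0
  set a := Real.sqrt (1 - z.re ^ 2 - z.im ^ 2) with ha
  set b := Real.sqrt (1 - w.re ^ 2 - w.im ^ 2) with hb
  have b1 : a ^ 2 = _ := Real.sq_sqrt (show 0 ≤ 1 - z.re ^ 2 - z.im ^ 2 by nlinarith)
  have b2 : b ^ 2 = _ := Real.sq_sqrt (show 0 ≤ 1 - w.re ^ 2 - w.im ^ 2 by nlinarith)
  have c1 : 0 ≤ a := Real.sqrt_nonneg _
  have c2 : 0 ≤ b := Real.sqrt_nonneg _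
  have him : z.im ^ 2 = w.im ^ 2 := by rw [hre] at h1; linarith
  have hab : a = b := by
    have : a ^ 2 = b ^ 2 := by rw [b1, b2, hre, him]
    exact (pow_left_inj₀ c1 c2 (by norm_num)).1 this
  rcases c1.eq_or_lt with h3 | h3
  · rcases sq_eq_sq_iff_eq_or_eq_neg.1 him with h4 | h4
    · exact Or.inl (Complex.ext hre h4)
    · right
      constructor
      · have : ‖z‖ ^ 2 = 1 := by
          rw [← Complex.normSq_eq_norm_sq, Complex.normSq_apply]
          rw [← h3] at b1; nlinarith
        exact (pow_eq_one_iff_of_nonneg (norm_nonneg _) (by norm_num)).1 this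
      · apply Complex.ext
        · simp [hre]
        · simp [h4]
  · left
    rw [← hab] at h2
    have := mul_right_cancel₀ h3.ne' h2
    exact Complex.ext hre (by linarith)

theorem Sp_surj (y : Fin 3 → ℝ) (hy : ∑ i, y i ^ 2 = 1) : ∃ z ∈ BB, Sp z = y := by
  rw [Fin.sum_univ_three] at hy
  have hy0 : 0 ≤ 1 - y 0 ^ 2 := by nlinarith [sq_nonneg (y 1), sq_nonneg (y 2)]
  set q := Real.sqrt (1 - y 0 ^ 2) with hq
  have q1 : q ^ 2 = 1 - y 0 ^ 2 := Real.sq_sqrt hy0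
  have q0 : 0 ≤ q := Real.sqrt_nonneg _
  have q2 : q ≤ 1 := Real.sqrt_le_one.2 (by nlinarith [sq_nonneg (y 0)])
  -- square root of y1 + i y2
  obtain ⟨ζ, hζ, hre⟩ : ∃ ζ : ℂ, ζ ^ 2 = ⟨y 1, y 2⟩ ∧ 0 ≤ ζ.re := by
    obtain ⟨ζ, hζ⟩ := IsAlgClosed.exists_pow_nat_eq (⟨y 1, y 2⟩ : ℂ) (n := 2) (by norm_num)
    rcases le_total 0 ζ.re with h | h
    · exact ⟨ζ, hζ, h⟩
    · exact ⟨-ζ, by rw [neg_sq, hζ], by simpa using h⟩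
  have z1 : ζ.re ^ 2 - ζ.im ^ 2 = y 1 := by
    have := congrArg Complex.re hζ; simp [sq] at this; linarith
  have z2 : 2 * ζ.im * ζ.re = y 2 := by
    have := congrArg Complex.im hζ; simp [sq] at this; linarith
  have zn : ζ.re ^ 2 + ζ.im ^ 2 = q := by
    have : (ζ.re ^ 2 + ζ.im ^ 2) ^ 2 = q ^ 2 := by
      have e : (ζ.re ^ 2 + ζ.im ^ 2) ^ 2 = (ζ.re ^ 2 - ζ.im ^ 2) ^ 2 + (2 * ζ.im * ζ.re) ^ 2 := by ring
      rw [q1, e, z1, z2]; linarith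
    exact (pow_left_inj₀ (by positivity) q0 (by norm_num)).1 this
  -- the first coordinate
  set x : ℝ := SignType.sign (y 0) * Real.sqrt (1 - q) with hx
  have s1 : Real.sqrt (1 - q) ^ 2 = 1 - q := Real.sq_sqrt (by linarith)
  have hx2 : x ^ 2 = 1 - q := by
    rcases lt_trichotomy (y 0) 0 with h | h | h
    · simp [hx, h, s1]
    · have : q = 1 := by rw [hq, h]; simp
      simp [hx, h, this]
    · simp [hx, h, s1]
  have hs3 : Real.sqrt (2 - x ^ 2) = Real.sqrt (1 + q) := by rw [hx2]; congr 1; ring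
  have hprod : Real.sqrt (1 - q) * Real.sqrt (1 + q) = |y 0| := by
    rw [← Real.sqrt_mul (by linarith), ← Real.sqrt_sq_eq_abs]; congr 1; linarith [q1, (by ring : (1 - q) * (1 + q) = 1 - q ^ 2)]
  have hw : 1 - x ^ 2 - ζ.im ^ 2 = ζ.re ^ 2 := by rw [hx2]; linarith
  refine ⟨⟨x, ζ.im⟩, ?_, ?_⟩
  · rw [BB_sq]; dsimp only; nlinarith [sq_nonneg ζ.re]
  · funext i
    fin_cases i
    · simp only [Sp, Fin.zero_eta, Matrix.cons_val_zero]
      rw [hs3, hx, mul_assoc, hprod]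
      rcases lt_trichotomy (y 0) 0 with h | h | h
      · simp [h, abs_of_neg h]
      · simp [h]
      · simp [h, abs_of_pos h]
    · simp only [Sp, Fin.mk_one, Matrix.cons_val_one, Matrix.cons_val_zero]
      rw [hw]; exact z1
    · simp only [Sp, Fin.reduceFinMk, Matrix.cons_val]
      rw [hw, Real.sqrt_sq hre]; exact z2
end

section
/-! ### the standard triangle as a disc -/
def st2 : Set (Fin 3 → ℝ) := {x | (∀ v, 0 ≤ x v) ∧ x 0 + x 1 + x 2 = 1}

def bT (θ : ℝ) : Fin 3 → ℝ := ![max 0 (1 - 3 * θ) + max 0 (3 * θ - 2), max 0 (1 - |3 * θ - 1|), max 0 (1 - |3 * θ - 2|)]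

theorem bT_cont : Continuous bT := by
  unfold bT
  refine continuous_pi fun i => ?_
  fin_cases i <;> simp <;> fun_prop

theorem bT_0 {t : ℝ} (ht : t ∈ Set.Icc (0:ℝ) 1) : bT ((0 + t) / 3) = ![1 - t, t, 0] := by
  have e : 3 * ((0 + t) / 3) = t := by ring
  unfold bT
  rw [e, max_eq_right (by linarith [ht.2]), max_eq_left (by linarith [ht.2]), abs_of_nonpos (by linarith [ht.2]), abs_of_nonpos (by linarith [ht.2]),
    max_eq_right (by linarith [ht.1]), max_eq_left (by linarith [ht.2])]
  ext i; fin_cases i <;> simp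

theorem bT_1 {t : ℝ} (ht : t ∈ Set.Icc (0:ℝ) 1) : bT ((1 + t) / 3) = ![0, 1 - t, t] := by
  have e : 3 * ((1 + t) / 3) = 1 + t := by ring
  unfold bT
  rw [e, max_eq_left (by linarith [ht.1]), max_eq_left (by linarith [ht.2]), abs_of_nonneg (by linarith [ht.1]), abs_of_nonpos (by linarith [ht.2]),
    max_eq_right (by linarith [ht.2]), max_eq_right (by linarith [ht.1])]
  ext i; fin_cases i <;> simp; ring

theorem bT_2 {t : ℝ} (ht : t ∈ Set.Icc (0:ℝ) 1) : bT ((2 + t) / 3) = ![t, 0, 1 - t] := by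
  have e : 3 * ((2 + t) / 3) = 2 + t := by ring
  unfold bT
  rw [e, max_eq_left (by linarith [ht.1]), max_eq_right (by linarith [ht.1]), abs_of_nonneg (by linarith [ht.1]), abs_of_nonneg (by linarith [ht.1]),
    max_eq_left (by linarith [ht.1]), max_eq_right (by linarith [ht.2])]
  ext i; fin_cases i <;> simp

theorem th_split {θ : ℝ} (h : θ ∈ Set.Ico (0:ℝ) 1) : (∃ t ∈ Set.Ico (0:ℝ) 1, θ = (0 + t) / 3) ∨ (∃ t ∈ Set.Ico (0:ℝ) 1, θ = (1 + t) / 3) ∨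
    (∃ t ∈ Set.Ico (0:ℝ) 1, θ = (2 + t) / 3) := by
  obtain ⟨h0, h1⟩ := h
  by_cases a : 3 * θ < 1
  · exact Or.inl ⟨3 * θ, ⟨by linarith, a⟩, by ring⟩
  by_cases b : 3 * θ < 2
  · exact Or.inr (Or.inl ⟨3 * θ - 1, ⟨by linarith, by linarith⟩, by ring⟩)
  · exact Or.inr (Or.inr ⟨3 * θ - 2, ⟨by linarith, by linarith⟩, by ring⟩)

theorem ico_icc {t : ℝ} (h : t ∈ Set.Ico (0:ℝ) 1) : t ∈ Set.Icc (0:ℝ) 1 := ⟨h.1, h.2.le⟩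

theorem bT01 : bT 0 = bT 1 := by
  have h := bT_0 (t := 0) (by norm_num)
  have h' := bT_2 (t := 1) (by norm_num)
  norm_num at h h'
  rw [h, h']

theorem bT_prop {θ : ℝ} (h : θ ∈ Set.Ico (0:ℝ) 1) : bT θ ∈ st2 ∧ ∃ i, bT θ i = 0 := by
  rcases th_split h with ⟨t, ht, rfl⟩ | ⟨t, ht, rfl⟩ | ⟨t, ht, rfl⟩
  · rw [bT_0 (ico_icc ht)]
    refine ⟨⟨fun v => ?_, by simp⟩, 2, by simp⟩
    fin_cases v <;> simp [ht.1, ht.2.le]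
  · rw [bT_1 (ico_icc ht)]
    refine ⟨⟨fun v => ?_, by simp⟩, 0, by simp⟩
    fin_cases v <;> simp [ht.1, ht.2.le]
  · rw [bT_2 (ico_icc ht)]
    refine ⟨⟨fun v => ?_, by simp⟩, 1, by simp⟩
    fin_cases v <;> simp [ht.1, ht.2.le]

theorem bT_inj {θ θ' : ℝ} (h : θ ∈ Set.Ico (0:ℝ) 1) (h' : θ' ∈ Set.Ico (0:ℝ) 1) (e : bT θ = bT θ') : θ = θ' := by
  have e0 := congrFun e 0
  have e1 := congrFun e 1
  have e2 := congrFun e 2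
  rcases th_split h with ⟨t, ht, rfl⟩ | ⟨t, ht, rfl⟩ | ⟨t, ht, rfl⟩ <;>
  rcases th_split h' with ⟨t', ht', rfl⟩ | ⟨t', ht', rfl⟩ | ⟨t', ht', rfl⟩ <;>
  simp only [bT_0 (ico_icc ht), bT_1 (ico_icc ht), bT_2 (ico_icc ht), bT_0 (ico_icc ht'), bT_1 (ico_icc ht'), bT_2 (ico_icc ht'),
    Matrix.cons_val_zero, Matrix.cons_val_one, Matrix.cons_val] at e0 e1 e2 <;>
  obtain ⟨u1, u2⟩ := ht <;> obtain ⟨u3, u4⟩ := ht' <;> linarith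

theorem bT_surj {x : Fin 3 → ℝ} (hx : x ∈ st2) (h0 : ∃ i, x i = 0) : ∃ θ ∈ Set.Ico (0:ℝ) 1, bT θ = x := by
  have main : ∃ θ ∈ Set.Icc (0:ℝ) 1, bT θ = x := by
    obtain ⟨i, hi⟩ := h0
    obtain ⟨h, hs⟩ := hx
    have a0 := h 0
    have a1 := h 1
    have a2 := h 2
    fin_cases i
    · simp only [Fin.zero_eta] at hi
      refine ⟨(1 + x 2) / 3, ⟨by linarith, by linarith⟩, ?_⟩
      rw [bT_1 ⟨a2, by linarith⟩]
      ext j; fin_cases j <;> simp [hi]; linarith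
    · simp only [Fin.mk_one] at hi
      refine ⟨(2 + x 0) / 3, ⟨by linarith, by linarith⟩, ?_⟩
      rw [bT_2 ⟨a0, by linarith⟩]
      ext j; fin_cases j <;> simp [hi]; linarith
    · simp only [Fin.reduceFinMk] at hi
      refine ⟨(0 + x 1) / 3, ⟨by linarith, by linarith⟩, ?_⟩
      rw [bT_0 ⟨a1, by linarith⟩]
      ext j; fin_cases j <;> simp [hi]; linarith
  obtain ⟨θ, h, e⟩ := main
  rcases h.2.lt_or_eq with h1 | h1
  · exact ⟨θ, ⟨h.1, h1⟩, e⟩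
  · exact ⟨0, by norm_num, by rw [bT01, ← h1, e]⟩

def bM (θ : ℝ) : Fin 3 → ℝ := fun i => bT θ i - 1/3
def GT (z : ℂ) : Fin 3 → ℝ := fun i => 1/3 + discExt bM z i

theorem bM01 : bM 0 = bM 1 := by unfold bM; rw [bT01]

theorem GT_val {ρ θ : ℝ} (hρ : 0 ≤ ρ) (hθ : θ ∈ Set.Icc (0:ℝ) 1) (i) : GT (ρ * pt θ) i = 1/3 + ρ * (bT θ i - 1/3) := by
  unfold GT; rw [discExt_val bM01 hρ hθ]; rfl

theorem GT_cont : ContinuousOn GT BB := by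
  have : ContinuousOn (discExt bM) BB := discExt_cont (by
    apply Continuous.continuousOn
    exact continuous_pi fun i => ((continuous_apply i).comp bT_cont).sub continuous_const) bM01
  refine continuousOn_pi.2 fun i => ?_
  exact continuousOn_const.add ((continuous_apply i).comp_continuousOn this)

theorem GT_mem {z : ℂ} (hz : z ∈ BB) : GT z ∈ st2 := by
  rw [mem_BB] at hz
  obtain ⟨⟨h1, h2⟩, -⟩ := bT_prop (th_mem z)
  rw [th_eq z]
  have hn := norm_nonneg z
  refine ⟨fun v => ?_, ?_⟩
  · rw [GT_val hn (ico_icc (th_mem z))]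
    nlinarith [mul_nonneg hn (h1 v)]
  · simp only [GT_val hn (ico_icc (th_mem z))]
    linear_combination ‖z‖ * h2

theorem GT_min {z : ℂ} : (∀ i, (1 - ‖z‖) / 3 ≤ GT z i) ∧ ∃ i, (1 - ‖z‖) / 3 = GT z i := by
  obtain ⟨⟨h1, h2⟩, i, h3⟩ := bT_prop (th_mem z)
  have hn := norm_nonneg z
  have e : ∀ i, GT z i = 1/3 + ‖z‖ * (bT (th z) i - 1/3) := fun i => by
    conv_lhs => rw [th_eq z]
    exact GT_val hn (ico_icc (th_mem z)) i
  refine ⟨fun i => ?_, i, ?_⟩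
  · rw [e]; nlinarith [mul_nonneg hn (h1 i)]
  · rw [e, h3]; ring

theorem GT_inj {z w : ℂ} (h : GT z = GT w) : z = w := by
  have hn : ‖z‖ = ‖w‖ := by
    obtain ⟨a1, i, a2⟩ := GT_min (z := z)
    obtain ⟨b1, j, b2⟩ := GT_min (z := w)
    have c1 := a1 j
    have c2 := b1 i
    rw [h] at c1 a2
    linarith
  by_cases h0 : ‖w‖ = 0
  · rw [h0] at hn; rw [norm_eq_zero.1 h0, norm_eq_zero.1 hn]
  have e : ∀ z i, GT z i = 1/3 + ‖z‖ * (bT (th z) i - 1/3) := fun z i => by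
    conv_lhs => rw [th_eq z]
    exact GT_val (norm_nonneg z) (ico_icc (th_mem z)) i
  have : bT (th z) = bT (th w) := by
    funext i
    have h' := congrFun h i
    rw [e, e, hn] at h'
    have : ‖w‖ * (bT (th z) i - bT (th w) i) = 0 := by linarith
    rcases mul_eq_zero.1 this with h | h
    · exact absurd h h0
    · linarith
  rw [th_eq z, th_eq w, hn, bT_inj (th_mem z) (th_mem w) this]

theorem GT_surj {x : Fin 3 → ℝ} (hx : x ∈ st2) : ∃ z ∈ BB, GT z = x := by
  obtain ⟨h, hs⟩ := hx
  obtain ⟨i, hi⟩ : ∃ i, ∀ j, x i ≤ x j := Finite.exists_min x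
  have i0 := hi 0
  have i1 := hi 1
  have i2 := hi 2
  have hρ : 0 ≤ 1 - 3 * x i := by linarith
  rcases hρ.lt_or_eq with hρ' | hρ'
  · set ρ := 1 - 3 * x i with hρe
    obtain ⟨θ, hθ, e⟩ := bT_surj (x := fun j => (x j - 1/3) / ρ + 1/3) ⟨fun v => by
      have : (x v - 1/3) / ρ + 1/3 = (x v - x i) / ρ := by field_simp; rw [hρe]; ring
      show 0 ≤ (x v - 1/3) / ρ + 1/3
      rw [this]
      exact div_nonneg (by linarith [hi v]) hρ, by field_simp; linarith⟩ ⟨i, by field_simp; rw [hρe]; ring⟩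
    refine ⟨ρ * pt θ, ?_, ?_⟩
    · rw [mem_BB, norm_polar hρ]; linarith [h i]
    · funext j
      rw [GT_val hρ (ico_icc hθ), e]
      field_simp
      ring
  · refine ⟨0, by simp [mem_BB], ?_⟩
    have e : (0:ℂ) = ((0:ℝ):ℂ) * pt 0 := by simp
    have q0 := hi 0
    funext j
    rw [e, GT_val le_rfl (by norm_num)]
    have hj := hi j
    fin_cases j <;> simp <;> simp at hj <;> linarith

def T3 (x : Fin 3 → ℝ) : ℂ := Function.invFunOn GT BB x

theorem T3_spec {x : Fin 3 → ℝ} (hx : x ∈ st2) : T3 x ∈ BB ∧ GT (T3 x) = x := by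
  obtain ⟨z, h1, h2⟩ := GT_surj hx
  exact ⟨Function.invFunOn_mem ⟨z, h1, h2⟩, Function.invFunOn_eq ⟨z, h1, h2⟩⟩

theorem T3_GT {z : ℂ} (hz : z ∈ BB) : T3 (GT z) = z := GT_inj (T3_spec (GT_mem hz)).2

theorem T3_inj {x y : Fin 3 → ℝ} (hx : x ∈ st2) (hy : y ∈ st2) (h : T3 x = T3 y) : x = y := by
  rw [← (T3_spec hx).2, h, (T3_spec hy).2]

theorem T3_side {x : Fin 3 → ℝ} {θ : ℝ} (hθ : θ ∈ Set.Icc (0:ℝ) 1) (h : bT θ = x) : T3 x = pt θ := by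
  have hp : pt θ ∈ BB := by rw [mem_BB, pt_norm]
  have : GT (pt θ) = x := by
    funext i
    have := GT_val (ρ := 1) (by norm_num) hθ i
    simp only [Complex.ofReal_one, one_mul] at this
    rw [this, h]; ring
  rw [← this, T3_GT hp]

theorem T3_cont : ContinuousOn T3 st2 := by
  have e : st2 = GT '' BB := by
    ext x; constructor
    · intro h; obtain ⟨z, h1, h2⟩ := GT_surj h; exact ⟨z, h1, h2⟩
    · rintro ⟨z, h1, rfl⟩; exact GT_mem h1
  rw [e]
  refine cont_desc (isCompact_closedBall _ _) GT_cont ?_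
  exact continuousOn_id.congr fun z hz => T3_GT hz
end

section
/-! ### directed sides of triangles -/
@[ext] structure DS (D : GlueingDatum 4) where
  tri : Tri D
  c : Fin 5
  d : Fin 5
  hc : c ∉ tri.2.1
  hd : d ∉ tri.2.1
  hcd : c ≠ d

variable {D : GlueingDatum 4}

theorem third_ex : ∀ (s : Finset (Fin 5)) (c d : Fin 5), s.card = 2 → c ∉ s → d ∉ s → c ≠ d →
    ∃ e, e ∉ s ∧ e ≠ c ∧ e ≠ d ∧ (∀ v, v ∉ s → v = c ∨ v = d ∨ v = e) := by
  decide

namespace DS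

/-- the third vertex -/
def e (δ : DS D) : Fin 5 := Classical.choose (third_ex δ.tri.2.1 δ.c δ.d δ.tri.2.2 δ.hc δ.hd δ.hcd)

theorem e_spec (δ : DS D) : δ.e ∉ δ.tri.2.1 ∧ δ.e ≠ δ.c ∧ δ.e ≠ δ.d ∧ (∀ v, v ∉ δ.tri.2.1 → v = δ.c ∨ v = δ.d ∨ v = δ.e) :=
  Classical.choose_spec (third_ex δ.tri.2.1 δ.c δ.d δ.tri.2.2 δ.hc δ.hd δ.hcd)

theorem e_uniq (δ : DS D) {k : Fin 5} (h : k ∉ δ.tri.2.1) (h1 : k ≠ δ.c) (h2 : k ≠ δ.d) : δ.e = k := by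
  rcases δ.e_spec.2.2.2 k h with h | h | h
  · exact absurd h h1
  · exact absurd h h2
  · exact h.symm

def rev (δ : DS D) : DS D := ⟨δ.tri, δ.d, δ.c, δ.hd, δ.hc, δ.hcd.symm⟩
theorem rev_rev (δ : DS D) : δ.rev.rev = δ := rfl
theorem rev_tri (δ : DS D) : δ.rev.tri = δ.tri := rfl
theorem rev_e (δ : DS D) : δ.rev.e = δ.e := e_uniq _ δ.e_spec.1 δ.e_spec.2.2.1 δ.e_spec.2.1
theorem rev_ne (δ : DS D) : δ.rev ≠ δ := fun h => δ.hcd (congrArg DS.d h)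

/-- the next side of the loop -/
def nx (δ : DS D) : DS D := ⟨δ.tri, δ.d, δ.e, δ.hd, δ.e_spec.1, δ.e_spec.2.2.1.symm⟩
theorem nx_tri (δ : DS D) : δ.nx.tri = δ.tri := rfl
theorem nx_e (δ : DS D) : δ.nx.e = δ.c := e_uniq _ δ.hc δ.hcd δ.e_spec.2.1.symm
theorem nx_nx_c (δ : DS D) : δ.nx.nx.c = δ.e := rfl
theorem nx_nx_d (δ : DS D) : δ.nx.nx.d = δ.c := nx_e δ

theorem sides (δ δ' : DS D) (h : δ'.tri = δ.tri) : δ' = δ ∨ δ' = δ.rev ∨ δ' = δ.nx ∨ δ' = δ.nx.rev ∨ δ' = δ.nx.nx ∨ δ' = δ.nx.nx.rev := by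
  obtain ⟨τ, c, d, hc, hd, hcd⟩ := δ'
  simp only at h
  subst h
  have h1 := δ.e_spec.2.2.2 c hc
  have h2 := δ.e_spec.2.2.2 d hd
  have h3 := δ.nx_nx_d
  have h4 := δ.nx_nx_c
  rcases h1 with rfl | rfl | rfl <;> rcases h2 with rfl | rfl | rfl <;>
    first
    | exact absurd rfl hcd
    | exact Or.inl rfl
    | exact Or.inr (Or.inl rfl)
    | exact Or.inr (Or.inr (Or.inl rfl))
    | exact Or.inr (Or.inr (Or.inr (Or.inl rfl)))
    | exact Or.inr (Or.inr (Or.inr (Or.inr (Or.inl (DS.ext rfl rfl h3.symm)))))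
    | exact Or.inr (Or.inr (Or.inr (Or.inr (Or.inr (DS.ext rfl h3.symm rfl)))))

/-- points of the side -/
def P (δ : DS D) (t : ℝ) : Fin 5 → ℝ := fun v => if v = δ.c then 1 - t else if v = δ.d then t else 0

theorem P_c (δ : DS D) (t) : δ.P t δ.c = 1 - t := if_pos rfl
theorem P_d (δ : DS D) (t) : δ.P t δ.d = t := by unfold P; rw [if_neg δ.hcd.symm, if_pos rfl]
theorem P_o (δ : DS D) (t) {v : Fin 5} (h : v ≠ δ.c) (h' : v ≠ δ.d) : δ.P t v = 0 := by unfold P; rw [if_neg h, if_neg h']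
theorem P_e (δ : DS D) (t) : δ.P t δ.e = 0 := δ.P_o t δ.e_spec.2.1 δ.e_spec.2.2.1
theorem P_rev (δ : DS D) (t) : δ.rev.P t = δ.P (1 - t) := by
  funext v
  unfold P
  show (if v = δ.d then 1 - t else if v = δ.c then t else 0) = _
  by_cases h1 : v = δ.d
  · have h2 : v ≠ δ.c := fun h => δ.hcd (h.symm.trans h1)
    rw [if_pos h1, if_neg h2, if_pos h1]
  · by_cases h2 : v = δ.c
    · rw [if_neg h1, if_pos h2, if_pos h2]; ring
    · rw [if_neg h1, if_neg h2, if_neg h2, if_neg h1]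

theorem lab_sum (δ : DS D) {x : Fin 5 → ℝ} (hx : x ∈ labS δ.tri.2.1) : x δ.c + x δ.d + x δ.e = 1 := by
  rw [← hx.2.1, ← Finset.sum_subset (Finset.subset_univ {δ.c, δ.d, δ.e})]
  · rw [Finset.sum_insert, Finset.sum_pair δ.e_spec.2.2.1.symm]
    · ring
    · simp [δ.hcd, δ.e_spec.2.1.symm]
  · intro v _ hv
    by_contra h
    have : v ∉ δ.tri.2.1 := fun h' => h (hx.2.2 v h')
    rcases δ.e_spec.2.2.2 v this with h | h | h <;> simp [h] at hv

theorem lab_ext (δ : DS D) {x y : Fin 5 → ℝ} (hx : x ∈ labS δ.tri.2.1) (hy : y ∈ labS δ.tri.2.1) (h1 : x δ.c = y δ.c) (h2 : x δ.d = y δ.d)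
    (h3 : x δ.e = y δ.e) : x = y := by
  funext v
  by_cases h : v ∈ δ.tri.2.1
  · rw [hx.2.2 v h, hy.2.2 v h]
  · rcases δ.e_spec.2.2.2 v h with rfl | rfl | rfl <;> assumption

theorem P_mem (δ : DS D) {t : ℝ} (ht : t ∈ Set.Icc (0:ℝ) 1) : δ.P t ∈ labS δ.tri.2.1 := by
  refine ⟨fun v => ?_, ?_, fun v hv => δ.P_o t (fun h => δ.hc (h ▸ hv)) (fun h => δ.hd (h ▸ hv))⟩
  · unfold P; split_ifs
    · linarith [ht.2]
    · exact ht.1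
    · exact le_rfl
  · rw [← Finset.sum_subset (Finset.subset_univ {δ.c, δ.d}), Finset.sum_pair δ.hcd, P_c, P_d]
    · ring
    · intro v _ hv
      simp only [Finset.mem_insert, Finset.mem_singleton, not_or] at hv
      exact δ.P_o t hv.1 hv.2

theorem mem_P (δ : DS D) {x : Fin 5 → ℝ} (hx : x ∈ labS δ.tri.2.1) (h : x δ.e = 0) : x δ.d ∈ Set.Icc (0:ℝ) 1 ∧ x = δ.P (x δ.d) := by
  have hs := δ.lab_sum hx
  have h1 := hx.1 δ.c
  have h2 := hx.1 δ.d
  have ht : x δ.d ∈ Set.Icc (0:ℝ) 1 := ⟨h2, by linarith⟩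
  refine ⟨ht, δ.lab_ext hx (δ.P_mem ht) ?_ ?_ ?_⟩
  · rw [P_c]; linarith
  · rw [P_d]
  · rw [P_e, h]

/-- the side glued to `δ` -/
def mate (δ : DS D) : DS D := ⟨nbr δ.tri δ.e, D.glue (δ.tri.1, δ.e) δ.c, D.glue (δ.tri.1, δ.e) δ.d,
  by simpa [nbr] using δ.hc, by simpa [nbr] using δ.hd, by simpa using δ.hcd⟩

theorem mate_e (δ : DS D) : δ.mate.e = D.glue (δ.tri.1, δ.e) δ.e :=
  e_uniq _ (by simpa [mate, nbr] using δ.e_spec.1) (by simpa [mate] using δ.e_spec.2.1) (by simpa [mate] using δ.e_spec.2.2.1)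

theorem mate_face (δ : DS D) : (δ.mate.tri.1, δ.mate.e) = D.P (δ.tri.1, δ.e) := by
  rw [mate_e, D.glue_face]; rfl

theorem mate_rev (δ : DS D) : δ.rev.mate = δ.mate.rev := by
  apply DS.ext
  · show nbr δ.tri δ.rev.e = nbr δ.tri δ.e
    rw [rev_e]
  · show D.glue (δ.tri.1, δ.rev.e) δ.d = D.glue (δ.tri.1, δ.e) δ.d
    rw [rev_e]
  · show D.glue (δ.tri.1, δ.rev.e) δ.c = D.glue (δ.tri.1, δ.e) δ.c
    rw [rev_e]

theorem mate_mate (δ : DS D) : δ.mate.mate = δ := by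
  have hf := δ.mate_face
  apply DS.ext
  · show nbr δ.mate.tri δ.mate.e = δ.tri
    unfold nbr
    apply Prod.ext
    · simp only [hf, D.P_involutive]
    · apply Subtype.ext
      simp only [hf, D.glue_symm]
      show (δ.tri.2.1.image (D.glue (δ.tri.1, δ.e))).image _ = _
      rw [Finset.image_image]; simp
  · show D.glue (δ.mate.tri.1, δ.mate.e) (D.glue (δ.tri.1, δ.e) δ.c) = δ.c
    rw [hf, D.glue_symm]; simp
  · show D.glue (δ.mate.tri.1, δ.mate.e) (D.glue (δ.tri.1, δ.e) δ.d) = δ.d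
    rw [hf, D.glue_symm]; simp

theorem mate_ne (δ : DS D) : δ.mate ≠ δ := by
  intro h
  have := δ.mate_face
  rw [h] at this
  exact D.P_fixedPointFree _ this.symm

theorem mate_ne_rev (δ : DS D) : δ.mate ≠ δ.rev := by
  intro h
  have := δ.mate_face
  rw [h, rev_e] at this
  exact D.P_fixedPointFree _ this.symm

theorem mate_P (δ : DS D) (t : ℝ) : δ.mate.P t = δ.P t ∘ (D.glue (δ.tri.1, δ.e)).symm := by
  funext v
  obtain ⟨w, rfl⟩ := (D.glue (δ.tri.1, δ.e)).surjective v
  simp [P, mate]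

theorem mate_mkS (δ : DS D) {t : ℝ} (ht : t ∈ Set.Icc (0:ℝ) 1) : mkS D δ.tri (δ.P t) = mkS D δ.mate.tri (δ.mate.P t) := by
  rw [mate_P]
  exact (mkS_glue δ.tri δ.e δ.e_spec.1 (δ.P_mem ht) (δ.P_e t)).2

theorem ex_side : ∀ (s : Finset (Fin 5)) (k : Fin 5), s.card = 2 → k ∉ s →
    ∃ c d, c ∉ s ∧ d ∉ s ∧ c ≠ d ∧ k ≠ c ∧ k ≠ d := by decide

theorem rel (p q : SurfTotal D) (h : surfRel D p q) : ∃ δ : DS D, ∃ t ∈ Set.Icc (0:ℝ) 1, δ.tri = p.1 ∧ δ.P t = p.2.1 ∧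
    δ.mate.tri = q.1 ∧ δ.mate.P t = q.2.1 := by
  obtain ⟨τ, x⟩ := p
  obtain ⟨τ', y⟩ := q
  obtain ⟨k, hk, h0, h1, h2, h3⟩ := h
  simp only at hk h0 h1 h2 h3
  obtain ⟨c, d, hc, hd, hcd, kc, kd⟩ := ex_side _ k τ.2.2 hk
  let δ : DS D := ⟨τ, c, d, hc, hd, hcd⟩
  have he : δ.e = k := e_uniq _ hk kc kd
  obtain ⟨ht, hx⟩ := δ.mem_P (x := x.1) x.2 (by rw [he, h0])
  refine ⟨δ, _, ht, rfl, hx.symm, ?_, ?_⟩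
  · show nbr τ δ.e = τ'
    rw [he]
    exact Prod.ext h1 (Subtype.ext h2.symm)
  · rw [mate_P, ← hx, he]
    exact h3.symm

/-! ### the disc map of a triangle -/
def T (δ : DS D) (x : Fin 5 → ℝ) : ℂ := T3 ![x δ.d, x δ.e, x δ.c]

theorem T_st (δ : DS D) {x : Fin 5 → ℝ} (hx : x ∈ labS δ.tri.2.1) : (![x δ.d, x δ.e, x δ.c] : Fin 3 → ℝ) ∈ st2 := by
  refine ⟨fun v => by fin_cases v <;> simp [hx.1], ?_⟩
  have := δ.lab_sum hx
  simp; linarith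

theorem T_mem (δ : DS D) {x : Fin 5 → ℝ} (hx : x ∈ labS δ.tri.2.1) : δ.T x ∈ BB := (T3_spec (δ.T_st hx)).1

theorem T_inj (δ : DS D) {x y : Fin 5 → ℝ} (hx : x ∈ labS δ.tri.2.1) (hy : y ∈ labS δ.tri.2.1) (h : δ.T x = δ.T y) : x = y := by
  have := T3_inj (δ.T_st hx) (δ.T_st hy) h
  have h0 := congrFun this 0
  have h1 := congrFun this 1
  have h2 := congrFun this 2
  simp at h0 h1 h2
  exact δ.lab_ext hx hy h2 h0 h1

theorem T_cont (δ : DS D) : ContinuousOn δ.T (labS δ.tri.2.1) := by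
  refine T3_cont.comp (t := st2) ?_ fun x hx => δ.T_st hx
  apply Continuous.continuousOn
  refine continuous_pi fun i => ?_
  fin_cases i <;> simp <;> exact continuous_apply _

theorem T_surj (δ : DS D) {z : ℂ} (hz : z ∈ BB) : ∃ x ∈ labS δ.tri.2.1, δ.T x = z := by
  have hm := GT_mem hz
  let y := GT z
  have e1 := δ.e_spec.2.1
  have e2 := δ.e_spec.2.2.1
  have e3 := δ.hcd
  let x : Fin 5 → ℝ := fun v => if v = δ.d then y 0 else if v = δ.e then y 1 else if v = δ.c then y 2 else 0
  have xd : x δ.d = y 0 := if_pos rfl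
  have xe : x δ.e = y 1 := by simp [x, e2]
  have xc : x δ.c = y 2 := by simp [x, e3, e1.symm]
  refine ⟨x, ⟨fun v => ?_, ?_, fun v hv => ?_⟩, ?_⟩
  · show 0 ≤ (if v = δ.d then y 0 else if v = δ.e then y 1 else if v = δ.c then y 2 else 0)
    split_ifs
    · exact hm.1 _
    · exact hm.1 _
    · exact hm.1 _
    · exact le_rfl
  · rw [← Finset.sum_subset (Finset.subset_univ {δ.c, δ.d, δ.e})]
    · rw [Finset.sum_insert (by simp [δ.hcd, δ.e_spec.2.1.symm]), Finset.sum_pair δ.e_spec.2.2.1.symm, xd, xe, xc]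
      linarith [hm.2]
    · intro v _ hv
      simp only [Finset.mem_insert, Finset.mem_singleton, not_or] at hv
      simp [x, hv.1, hv.2.1, hv.2.2]
  · have h1 : v ≠ δ.d := fun h => δ.hd (h ▸ hv)
    have h2 : v ≠ δ.e := fun h => δ.e_spec.1 (h ▸ hv)
    have h3 : v ≠ δ.c := fun h => δ.hc (h ▸ hv)
    simp [x, h1, h2, h3]
  · unfold T
    rw [xd, xe, xc]
    have : (![y 0, y 1, y 2] : Fin 3 → ℝ) = GT z := by ext i; fin_cases i <;> rfl
    rw [this, T3_GT hz]

theorem T_0 (δ : DS D) {t : ℝ} (ht : t ∈ Set.Icc (0:ℝ) 1) : δ.T (δ.nx.P t) = pt ((0 + t) / 3) := by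
  refine T3_side ⟨by linarith [ht.1], by linarith [ht.2]⟩ ?_
  have h1 : δ.nx.P t δ.d = 1 - t := δ.nx.P_c t
  have h2 : δ.nx.P t δ.e = t := δ.nx.P_d t
  have h3 : δ.nx.P t δ.c = 0 := by have := δ.nx.P_e t; rwa [nx_e] at this
  rw [bT_0 ht, h1, h2, h3]

theorem T_1 (δ : DS D) {t : ℝ} (ht : t ∈ Set.Icc (0:ℝ) 1) : δ.T (δ.nx.nx.P t) = pt ((1 + t) / 3) := by
  refine T3_side ⟨by linarith [ht.1], by linarith [ht.2]⟩ ?_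
  have h1 : δ.nx.nx.P t δ.e = 1 - t := δ.nx.nx.P_c t
  have h2 : δ.nx.nx.P t δ.c = t := by have := δ.nx.nx.P_d t; rwa [nx_nx_d] at this
  have h3 : δ.nx.nx.P t δ.d = 0 := by have := δ.nx.nx.P_e t; rwa [nx_e] at this
  rw [bT_1 ht, h1, h2, h3]

theorem T_2 (δ : DS D) {t : ℝ} (ht : t ∈ Set.Icc (0:ℝ) 1) : δ.T (δ.P t) = pt ((2 + t) / 3) := by
  refine T3_side ⟨by linarith [ht.1], by linarith [ht.2]⟩ ?_
  rw [bT_2 ht, P_c, P_d, P_e]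

end DS
end

section
variable {D : GlueingDatum 4}

structure St (A : Set (Tri D)) (L : List (DS D)) (Φ : Tri D → (Fin 5 → ℝ) → ℂ) : Prop where
  cont : ∀ τ ∈ A, ContinuousOn (Φ τ) (labS τ.2.1)
  maps : ∀ τ ∈ A, ∀ x ∈ labS τ.2.1, Φ τ x ∈ BB
  surj : ∀ z ∈ BB, ∃ τ ∈ A, ∃ x ∈ labS τ.2.1, Φ τ x = z
  sound : ∀ τ ∈ A, ∀ x ∈ labS τ.2.1, ∀ τ' ∈ A, ∀ y ∈ labS τ'.2.1, Φ τ x = Φ τ' y → mkS D τ x = mkS D τ' y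
  inA : ∀ δ ∈ L, δ.tri ∈ A
  bdry : ∀ (k : ℕ) (δ : DS D), L[k]? = some δ → ∀ t ∈ Set.Icc (0:ℝ) 1, Φ δ.tri (δ.P t) = pt ((k + t) / L.length)
  complete : ∀ δ : DS D, δ.tri ∈ A → δ ∈ L ∨ δ.rev ∈ L ∨
    (δ.mate.tri ∈ A ∧ ∀ t ∈ Set.Icc (0:ℝ) 1, Φ δ.tri (δ.P t) = Φ δ.mate.tri (δ.mate.P t))
  closed : ∀ δ ∈ L, δ.mate.tri ∈ A → δ.mate ∈ L ∨ δ.mate.rev ∈ L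

theorem one_sub_mem {t : ℝ} (ht : t ∈ Set.Icc (0:ℝ) 1) : 1 - t ∈ Set.Icc (0:ℝ) 1 := ⟨by linarith [ht.2], by linarith [ht.1]⟩

theorem getElem?_lt {α} {L : List α} {k : ℕ} {a : α} (h : L[k]? = some a) : k < L.length := by
  by_contra h'
  rw [List.getElem?_eq_none (by omega)] at h
  exact absurd h (by simp)

theorem St.uniq {A : Set (Tri D)} {L Φ} (S : St A L Φ) {i j : ℕ} {δ δ' : DS D} (hi : L[i]? = some δ) (hj : L[j]? = some δ')
    (h : δ' = δ ∨ δ' = δ.rev) : i = j := by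
  have hm : (1/2:ℝ) ∈ Set.Icc (0:ℝ) 1 := by norm_num
  have e1 := S.bdry i δ hi _ hm
  have e2 := S.bdry j δ' hj _ hm
  have e3 : Φ δ'.tri (δ'.P (1/2)) = Φ δ.tri (δ.P (1/2)) := by
    rcases h with rfl | rfl
    · rfl
    · rw [DS.P_rev, DS.rev_tri]; norm_num
  rw [e1, e2] at e3
  have li := getElem?_lt hi
  have lj := getElem?_lt hj
  have n0 : (0:ℝ) < L.length := by exact_mod_cast (by omega : 0 < L.length)
  have aux : ∀ i : ℕ, i < L.length → ((i:ℝ) + 1/2) / L.length ∈ Set.Ico (0:ℝ) 1 := by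
    intro i hi
    refine ⟨by positivity, ?_⟩
    rw [div_lt_one n0]
    have : (i:ℝ) + 1 ≤ L.length := by exact_mod_cast hi
    linarith
  have := pt_inj (aux j lj) (aux i li) e3
  field_simp at this
  have h' : (i:ℝ) = j := by linarith
  exact_mod_cast h'

theorem St.uniq_last {A : Set (Tri D)} {L' M Φ} (S : St A (L' ++ M) Φ) {δ δ' : DS D} (h1 : δ' ∈ L') (h2 : δ ∈ M)
    (h : δ' = δ ∨ δ' = δ.rev) : False := by
  obtain ⟨i, hi⟩ := List.mem_iff_getElem?.1 h1
  obtain ⟨j, hj⟩ := List.mem_iff_getElem?.1 h2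
  have li := getElem?_lt hi
  have a1 : (L' ++ M)[i]? = some δ' := by rw [List.getElem?_append_left li, hi]
  have a2 : (L' ++ M)[L'.length + j]? = some δ := by
    rw [List.getElem?_append_right (by omega)]; simpa using hj
  have := S.uniq a2 a1 h
  omega

/-! ### rotation -/
theorem St.rot1 {A : Set (Tri D)} {a : DS D} {L' Φ} (S : St A (a :: L') Φ) :
    ∃ Φ', St A (L' ++ [a]) Φ' := by
  have n0 : (0:ℝ) < (L'.length + 1 : ℕ) := by positivity
  set n : ℝ := ((L'.length + 1 : ℕ) : ℝ) with hn
  have hnorm : ∀ z : ℂ, ‖pt (-1/n) * z‖ = ‖z‖ := fun z => by rw [norm_mul, pt_norm, one_mul]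
  have hinj : ∀ {z w : ℂ}, pt (-1/n) * z = pt (-1/n) * w → z = w := fun h => mul_left_cancel₀ (pt_ne _) h
  have hmem : ∀ δ : DS D, δ ∈ L' ++ [a] ↔ δ ∈ a :: L' := fun δ => by simp [or_comm]
  refine ⟨fun τ x => pt (-1/n) * Φ τ x, ?_, ?_, ?_, ?_, ?_, ?_, ?_, ?_⟩
  · intro τ hτ; exact continuousOn_const.mul (S.cont τ hτ)
  · intro τ hτ x hx; rw [mem_BB, hnorm]; exact mem_BB.1 (S.maps τ hτ x hx)
  · intro z hz
    obtain ⟨τ, hτ, x, hx, e⟩ := S.surj (pt (1/n) * z) (by rw [mem_BB, norm_mul, pt_norm, one_mul]; exact mem_BB.1 hz)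
    refine ⟨τ, hτ, x, hx, ?_⟩
    show pt (-1/n) * Φ τ x = z
    rw [e, ← mul_assoc, ← pt_add, show -1/n + 1/n = 0 by ring, pt_zero, one_mul]
  · intro τ hτ x hx τ' hτ' y hy h
    exact S.sound τ hτ x hx τ' hτ' y hy (hinj h)
  · intro δ hδ; exact S.inA δ ((hmem δ).1 hδ)
  · intro k δ hk t ht
    have hlen : (((L' ++ [a]).length : ℕ) : ℝ) = n := by simp [hn]
    have hlen' : (((a :: L').length : ℕ) : ℝ) = n := by simp [hn]
    rw [hlen]
    show pt (-1/n) * Φ δ.tri (δ.P t) = _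
    by_cases hkl : k < L'.length
    · rw [List.getElem?_append_left hkl] at hk
      rw [S.bdry (k+1) δ (by simpa using hk) t ht, hlen', ← pt_add]
      congr 1
      push_cast
      ring
    · have hk' := getElem?_lt hk
      simp only [List.length_append, List.length_cons, List.length_nil] at hk'
      have hke : k = L'.length := by omega
      subst hke
      simp at hk
      subst hk
      rw [S.bdry 0 _ (by simp) t ht, hlen', ← pt_add, show ((L'.length:ℝ) + t) / n = (-1/n + ((0:ℕ) + t)/n) + 1 by
        rw [hn]; push_cast; field_simp; ring, pt_add (_ + _) 1, pt_one, mul_one]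
  · intro δ hδ
    rcases S.complete δ hδ with h | h | ⟨h, h'⟩
    · exact Or.inl ((hmem _).2 h)
    · exact Or.inr (Or.inl ((hmem _).2 h))
    · exact Or.inr (Or.inr ⟨h, fun t ht => by show _ * _ = _ * _; rw [h' t ht]⟩)
  · intro δ hδ h
    rw [hmem, hmem]
    exact S.closed δ ((hmem _).1 hδ) h

def Stt (A : Set (Tri D)) (L : List (DS D)) : Prop := ∃ Φ, St A L Φ

theorem Stt.rot {A : Set (Tri D)} {L1 : List (DS D)} : ∀ {L2 : List (DS D)}, Stt A (L1 ++ L2) → Stt A (L2 ++ L1) := by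
  induction L1 with
  | nil => intro L2 h; simpa using h
  | cons a L ih =>
    intro L2 h
    obtain ⟨Φ, S⟩ := h
    have h2 : Stt A (L ++ (L2 ++ [a])) := by
      have := St.rot1 (L' := L ++ L2) (a := a) (by simpa using S)
      simpa [Stt] using this
    have := ih h2
    simpa using this

/-! ### the initial triangle -/
theorem Stt.start (δ : DS D) : Stt {δ.tri} [δ.nx, δ.nx.nx, δ] := by
  refine ⟨fun _ => δ.T, ?_, ?_, ?_, ?_, ?_, ?_, ?_, ?_⟩
  · rintro τ rfl; exact δ.T_cont
  · rintro τ rfl x hx; exact δ.T_mem hx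
  · intro z hz
    obtain ⟨x, h1, h2⟩ := δ.T_surj hz
    exact ⟨δ.tri, rfl, x, h1, h2⟩
  · rintro τ rfl x hx τ' rfl y hy h
    rw [δ.T_inj hx hy h]
  · intro δ' h
    simp only [List.mem_cons, List.not_mem_nil, or_false] at h
    rcases h with rfl | rfl | rfl <;> rfl
  · intro k δ' hk t ht
    have := getElem?_lt hk
    simp only [List.length_cons, List.length_nil] at this
    simp only [List.length_cons, List.length_nil]
    interval_cases k
    · simp at hk; subst hk; rw [δ.T_0 ht]; norm_num
    · simp at hk; subst hk; rw [δ.T_1 ht]; norm_num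
    · simp at hk; subst hk; rw [δ.T_2 ht]; norm_num
  · intro δ' h
    rcases DS.sides δ δ' h with rfl | rfl | rfl | rfl | rfl | rfl <;> simp [DS.rev_rev]
  · intro δ' _ h
    rcases DS.sides δ δ'.mate h with h | h | h | h | h | h <;> simp [h, DS.rev_rev]

/-! ### real points of half discs -/
theorem cos_ex {r : ℝ} (h1 : -1 ≤ r) (h2 : r ≤ 1) : ∃ t ∈ Set.Icc (0:ℝ) 1, r = - Real.cos (Real.pi * t) := by
  have hpi := Real.pi_pos
  refine ⟨Real.arccos (-r) / Real.pi, ⟨div_nonneg (Real.arccos_nonneg _) hpi.le, (div_le_one hpi).2 (Real.arccos_le_pi _)⟩, ?_⟩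
  rw [mul_div_cancel₀ _ hpi.ne', Real.cos_arccos (by linarith) (by linarith)]; ring

theorem re_mem {z : ℂ} (hz : z ∈ BB) : -1 ≤ z.re ∧ z.re ≤ 1 := by
  have := (Complex.abs_re_le_norm z).trans (mem_BB.1 hz)
  exact abs_le.1 this

theorem Up_real {l : ℝ} (hl : l ∈ Set.Ioo (0:ℝ) 1) {z : ℂ} (h0 : (Up l z).im = 0) {t : ℝ} (ht : t ∈ Set.Icc (0:ℝ) 1)
    (h : (Up l z).re = - Real.cos (Real.pi * t)) : z = pt (l + (1 - l) * t) := by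
  apply Up_inj hl
  rw [Up_down hl ht]
  apply Complex.ext
  · rw [h, Complex.ofReal_re]
  · rw [h0, Complex.ofReal_im]
end

section
variable {D : GlueingDatum 4}

theorem merge_val1 {m : ℕ} (hm : 1 ≤ m) {k : ℕ} (hk : k < m) {t : ℝ} (ht : t ∈ Set.Icc (0:ℝ) 1) :
    Rad (1/2) ((m:ℝ) / (m + 2)) (Up ((m:ℝ) / (m + 1)) (pt ((k + t) / (m + 1)))) = pt ((k + t) / (m + 2)) := by
  have m0 : (0:ℝ) < m := by exact_mod_cast hm
  have hk' : (k:ℝ) + 1 ≤ m := by exact_mod_cast hk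
  have hl : (m:ℝ) / (m + 1) ∈ Set.Ioo (0:ℝ) 1 := ⟨by positivity, by rw [div_lt_one (by positivity)]; linarith⟩
  have k0 : (0:ℝ) ≤ k := by positivity
  rw [Up_up hl ⟨div_nonneg (by linarith [ht.1]) (by positivity), by gcongr; linarith [ht.2]⟩]
  have e : ((k:ℝ) + t) / (m + 1) / (2 * (m / (m + 1))) = (k + t) / (2 * m) := by field_simp
  have h2 : ((k:ℝ) + t) / (2 * m) ≤ 1/2 := by rw [div_le_iff₀ (by positivity)]; linarith [ht.2]
  rw [e, Rad_pt half_mem ⟨div_nonneg (by linarith [ht.1]) (by positivity), by linarith⟩, hpl_le h2]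
  congr 1
  field_simp

theorem merge_val2 {m : ℕ} (hm : 1 ≤ m) {j : ℝ} (hj : j ∈ Set.Icc (0:ℝ) 1) {t : ℝ} (ht : t ∈ Set.Icc (0:ℝ) 1) :
    Rad (1/2) ((m:ℝ) / (m + 2)) (-Up (2/3) (pt ((j + t) / 3))) = pt ((m + j + t) / (m + 2)) := by
  have m0 : (0:ℝ) < m := by exact_mod_cast hm
  have hl : (2/3:ℝ) ∈ Set.Ioo (0:ℝ) 1 := by norm_num
  rw [Up_up hl ⟨div_nonneg (by linarith [ht.1, hj.1]) (by positivity), by linarith [ht.2, hj.2]⟩]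
  have e : -pt ((j + t) / 3 / (2 * (2/3))) = pt (1/2 + (j + t) / 4) := by
    rw [pt_add, pt_half, neg_one_mul]; congr 2; ring
  rw [e, Rad_pt half_mem ⟨by linarith [ht.1, hj.1], by linarith [ht.2, hj.2]⟩, hpl_ge (by norm_num) (by linarith [ht.1, hj.1])]
  congr 1
  field_simp
  ring

theorem Stt.merge {A : Set (Tri D)} {L' : List (DS D)} {δ : DS D} (h : Stt A (L' ++ [δ])) (hm : 1 ≤ L'.length) (hA : δ.mate.tri ∉ A) :
    Stt (insert δ.mate.tri A) (L' ++ [δ.mate.rev.nx, δ.mate.rev.nx.nx]) := by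
  obtain ⟨Φ, S⟩ := h
  set μ := δ.mate.rev with hμ
  have μt : μ.tri = δ.mate.tri := rfl
  rw [← μt] at hA
  rw [← μt]
  set m := L'.length with hmdef
  have m0 : (0:ℝ) < m := by exact_mod_cast hm
  set l : ℝ := (m:ℝ) / (m + 1) with hldef
  set r : ℝ := (m:ℝ) / (m + 2) with hrdef
  have hl : l ∈ Set.Ioo (0:ℝ) 1 := ⟨by positivity, by rw [hldef, div_lt_one (by positivity)]; linarith⟩
  have hr : r ∈ Set.Ioo (0:ℝ) 1 := ⟨by positivity, by rw [hrdef, div_lt_one (by positivity)]; linarith⟩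
  have h23 : (2/3:ℝ) ∈ Set.Ioo (0:ℝ) 1 := by norm_num
  have mμ : μ.rev = δ.mate := rfl
  let Φ' : Tri D → (Fin 5 → ℝ) → ℂ := fun τ x => if τ = μ.tri then Rad (1/2) r (-Up (2/3) (μ.T x)) else Rad (1/2) r (Up l (Φ τ x))
  have Φn : ∀ x, Φ' μ.tri x = Rad (1/2) r (-Up (2/3) (μ.T x)) := fun x => if_pos rfl
  have Φo : ∀ τ ∈ A, ∀ x, Φ' τ x = Rad (1/2) r (Up l (Φ τ x)) := fun τ hτ x => if_neg (show ¬ τ = μ.tri from fun h => hA (h ▸ hτ))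
  have negBB : ∀ {z : ℂ}, z ∈ BB → -z ∈ BB := fun {z} hz => by rw [mem_BB, norm_neg]; exact mem_BB.1 hz
  have hlast : ∀ t ∈ Set.Icc (0:ℝ) 1, Φ δ.tri (δ.P t) = pt (l + (1 - l) * t) := by
    intro t ht
    rw [S.bdry m δ (by simp [hmdef]) t ht]
    congr 1
    rw [hldef]
    simp only [List.length_append, List.length_cons, List.length_nil]
    push_cast
    field_simp
    ring
  have hδA : δ.tri ∈ A := S.inA δ (by simp)
  -- the glued points
  have glu : ∀ t ∈ Set.Icc (0:ℝ) 1, Φ' δ.tri (δ.P t) = Φ' δ.mate.tri (δ.mate.P t) := by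
    intro t ht
    rw [Φo _ hδA, hlast t ht, Up_down hl ht, ← μt, Φn]
    have e : δ.mate.P t = μ.P (1 - t) := by rw [← mμ, DS.P_rev]
    rw [e, μ.T_2 (one_sub_mem ht), show (2 + (1 - t)) / 3 = 2/3 + (1 - 2/3) * (1 - t) by ring, Up_down h23 (one_sub_mem ht)]
    congr 1
    rw [show Real.pi * (1 - t) = Real.pi - Real.pi * t by ring, Real.cos_pi_sub]
    push_cast; ring
  have mixed : ∀ τ ∈ A, ∀ x ∈ labS τ.2.1, ∀ y ∈ labS μ.tri.2.1, Φ' τ x = Φ' μ.tri y → mkS D τ x = mkS D μ.tri y := by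
    intro τ hτ x hx y hy h
    rw [Φo τ hτ, Φn] at h
    have h1 := Rad_inj half_mem hr h
    have i1 := (Up_mem hl (S.maps τ hτ x hx)).2
    have i2 := (Up_mem h23 (μ.T_mem hy)).2
    have him : (Up l (Φ τ x)).im = -(Up (2/3) (μ.T y)).im := by rw [h1, Complex.neg_im]
    have hre : (Up l (Φ τ x)).re = -(Up (2/3) (μ.T y)).re := by rw [h1, Complex.neg_re]
    obtain ⟨b1, b2⟩ := re_mem (Up_mem hl (S.maps τ hτ x hx)).1
    obtain ⟨t, ht, e⟩ := cos_ex b1 b2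
    have c1 := Up_real hl (by linarith) ht e
    have c2 := Up_real h23 (z := μ.T y) (by linarith) (one_sub_mem ht) (by
      rw [show Real.pi * (1 - t) = Real.pi - Real.pi * t by ring, Real.cos_pi_sub]; linarith)
    rw [← hlast t ht] at c1
    rw [show 2/3 + (1 - 2/3) * (1 - t) = (2 + (1 - t)) / 3 by ring, ← μ.T_2 (one_sub_mem ht)] at c2
    have c3 := μ.T_inj hy (μ.P_mem (one_sub_mem ht)) c2
    rw [S.sound τ hτ x hx δ.tri hδA _ (δ.P_mem ht) c1, c3, δ.mate_mkS ht, ← mμ, DS.P_rev]; rfl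
  have mate_old : ∀ δ' ∈ L', ¬ (δ' = δ ∨ δ' = δ.rev) := fun δ' h h' => S.uniq_last h (by simp) h'
  have memL : ∀ {δ'}, δ' ∈ L' ++ [δ] → δ' ∈ L' ∨ δ' = δ := fun h => by simpa using h
  -- the sides of the new triangle
  have sidesμ : ∀ δ' : DS D, δ'.tri = μ.tri → δ' = δ.mate ∨ δ' = δ.mate.rev ∨ δ' ∈ L' ++ [μ.nx, μ.nx.nx] ∨ δ'.rev ∈ L' ++ [μ.nx, μ.nx.nx] := by
    intro δ' h
    rcases DS.sides μ δ' h with h | h | h | h | h | h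
    · right; left; rw [h]
    · left; rw [h]; rfl
    all_goals simp [h, DS.rev_rev]
  refine ⟨Φ', ?_, ?_, ?_, ?_, ?_, ?_, ?_, ?_⟩
  · intro τ hτ
    rcases hτ with rfl | hτ
    · have : ContinuousOn (fun x => Rad (1/2) r (-Up (2/3) (μ.T x))) (labS μ.tri.2.1) :=
        (Rad_cont half_mem).comp (t := BB) ((Up_cont h23).comp (t := BB) μ.T_cont fun x hx => μ.T_mem hx).neg
          fun x hx => negBB (Up_mem h23 (μ.T_mem hx)).1
      exact this.congr fun x _ => Φn x
    · have h0 : ContinuousOn (fun x => Up l (Φ τ x)) (labS τ.2.1) :=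
        ContinuousOn.comp (g := Up l) (t := BB) (Up_cont hl) (S.cont τ hτ) fun x hx => S.maps τ hτ x hx
      have : ContinuousOn (fun x => Rad (1/2) r (Up l (Φ τ x))) (labS τ.2.1) :=
        (Rad_cont half_mem).comp (t := BB) h0
          fun x hx => (Up_mem hl (S.maps τ hτ x hx)).1
      exact this.congr fun x _ => Φo τ hτ x
  · intro τ hτ x hx
    rcases hτ with rfl | hτ
    · rw [Φn]; exact Rad_mem half_mem hr (negBB (Up_mem h23 (μ.T_mem hx)).1)
    · rw [Φo τ hτ]; exact Rad_mem half_mem hr (Up_mem hl (S.maps τ hτ x hx)).1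
  · intro z hz
    have hw := Rad_mem (m := 1/2) hr half_mem hz
    have hw' := Rad_inv hr half_mem z
    rcases le_total 0 (Rad r (1/2) z).im with h | h
    · obtain ⟨u, hu, e⟩ := Up_surj hl hw h
      obtain ⟨τ, hτ, x, hx, e2⟩ := S.surj u hu
      refine ⟨τ, Or.inr hτ, x, hx, ?_⟩
      rw [Φo τ hτ, e2, e, hw']
    · obtain ⟨u, hu, e⟩ := Up_surj h23 (negBB hw) (by rw [Complex.neg_im]; linarith)
      obtain ⟨x, hx, e2⟩ := μ.T_surj hu
      refine ⟨μ.tri, Or.inl rfl, x, hx, ?_⟩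
      rw [Φn, e2, e, neg_neg, hw']
  · intro τ hτ x hx τ' hτ' y hy h
    rcases hτ with rfl | hτ <;> rcases hτ' with rfl | hτ'
    · rw [Φn, Φn] at h
      rw [μ.T_inj hx hy (Up_inj h23 (neg_injective (Rad_inj half_mem hr h)))]
    · exact (mixed τ' hτ' y hy x hx h.symm).symm
    · exact mixed τ hτ x hx y hy h
    · rw [Φo τ hτ, Φo τ' hτ'] at h
      exact S.sound τ hτ x hx τ' hτ' y hy (Up_inj hl (Rad_inj half_mem hr h))
  · intro δ' h
    simp only [List.mem_append, List.mem_cons, List.not_mem_nil, or_false] at h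
    rcases h with h | rfl | rfl
    · exact Or.inr (S.inA δ' (by simp [h]))
    · exact Or.inl rfl
    · exact Or.inl rfl
  · intro k δ' hk t ht
    have hlen : (((L' ++ [μ.nx, μ.nx.nx]).length : ℕ) : ℝ) = m + 2 := by simp [hmdef]
    rw [hlen]
    by_cases hkl : k < m
    · rw [List.getElem?_append_left hkl] at hk
      have hδ' : δ' ∈ L' := List.mem_of_getElem? hk
      rw [Φo _ (S.inA δ' (by simp [hδ'])), S.bdry k δ' (by rw [List.getElem?_append_left hkl, hk]) t ht]
      have := merge_val1 hm hkl ht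
      rw [← this]
      congr 3
      simp [hmdef]
    · have hk' := getElem?_lt hk
      simp only [List.length_append, List.length_cons, List.length_nil] at hk'
      rcases (by omega : k = m ∨ k = m + 1) with rfl | rfl
      · rw [List.getElem?_append_right le_rfl] at hk
        simp [← hmdef] at hk
        subst hk
        show Φ' μ.tri _ = _
        rw [Φn, μ.T_0 ht, merge_val2 hm (by norm_num) ht]; simp
      · rw [List.getElem?_append_right (by omega)] at hk
        simp [← hmdef] at hk
        subst hk
        show Φ' μ.tri _ = _
        rw [Φn, μ.T_1 ht, merge_val2 hm (by norm_num) ht]; push_cast; rfl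
  · intro δ' h
    have gl' : ∀ δ'', δ'' = δ ∨ δ'' = δ.rev ∨ δ'' = δ.mate ∨ δ'' = δ.mate.rev → (δ''.mate.tri ∈ insert μ.tri A ∧ ∀ t ∈ Set.Icc (0:ℝ) 1, Φ' δ''.tri (δ''.P t) = Φ' δ''.mate.tri (δ''.mate.P t)) := by
      rintro δ'' (rfl | rfl | rfl | rfl)
      · exact ⟨Or.inl rfl, glu⟩
      · rw [DS.mate_rev]
        refine ⟨Or.inl rfl, fun t ht => ?_⟩
        rw [DS.P_rev, DS.P_rev]
        exact glu _ (one_sub_mem ht)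
      · rw [DS.mate_mate]
        exact ⟨Or.inr hδA, fun t ht => (glu t ht).symm⟩
      · rw [DS.mate_rev, DS.mate_mate]
        refine ⟨Or.inr hδA, fun t ht => ?_⟩
        rw [DS.P_rev, DS.P_rev]
        exact (glu _ (one_sub_mem ht)).symm
    rcases h with h | h
    · rcases sidesμ δ' h with h | h | h | h
      · exact Or.inr (Or.inr (gl' δ' (by simp [h])))
      · exact Or.inr (Or.inr (gl' δ' (by simp [h])))
      · exact Or.inl h
      · exact Or.inr (Or.inl h)
    · rcases S.complete δ' h with h1 | h1 | ⟨h1, h2⟩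
      · rcases memL h1 with h1 | h1
        · exact Or.inl (by simp [h1])
        · exact Or.inr (Or.inr (gl' δ' (by simp [h1])))
      · rcases memL h1 with h1 | h1
        · exact Or.inr (Or.inl (by simp [h1]))
        · exact Or.inr (Or.inr (gl' δ' (by simp [← h1, DS.rev_rev])))
      · refine Or.inr (Or.inr ⟨Or.inr h1, fun t ht => ?_⟩)
        rw [Φo _ h, Φo _ h1, h2 t ht]
  · intro δ' h hm'
    have nδ : δ' ≠ δ ∧ δ' ≠ δ.rev ∧ δ' ≠ δ.mate ∧ δ' ≠ δ.mate.rev := by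
      simp only [List.mem_append, List.mem_cons, List.not_mem_nil, or_false] at h
      rcases h with h | h
      · have hA' := S.inA δ' (by simp [h])
        refine ⟨fun e => mate_old δ' h (Or.inl e), fun e => mate_old δ' h (Or.inr e), ?_, ?_⟩
        · rintro rfl; exact hA hA'
        · rintro rfl; exact hA hA'
      · have ht : δ'.tri = μ.tri := by rcases h with rfl | rfl <;> rfl
        have c1 : δ'.c ≠ μ.c := by
          rcases h with rfl | rfl
          · exact μ.hcd.symm
          · exact μ.e_spec.2.1
        have c2 : δ'.d ≠ μ.d := by
          rcases h with rfl | rfl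
          · exact μ.e_spec.2.2.1
          · rw [DS.nx_nx_d]; exact μ.hcd
        have c3 : δ' ≠ μ.rev := by
          rintro rfl
          rcases h with h | h
          · have := congrArg DS.d h
            exact μ.e_spec.2.1 this.symm
          · have := congrArg DS.c h
            exact μ.e_spec.2.2.1 this.symm
        refine ⟨?_, ?_, c3, ?_⟩
        · rintro rfl; rw [ht] at hδA; exact hA hδA
        · rintro rfl; rw [DS.rev_tri] at ht; rw [ht] at hδA; exact hA hδA
        · rintro rfl; exact c1 rfl
    have nm : δ'.mate ≠ δ ∧ δ'.mate ≠ δ.rev ∧ δ'.mate ≠ δ.mate ∧ δ'.mate ≠ δ.mate.rev := by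
      obtain ⟨n1, n2, n3, n4⟩ := nδ
      refine ⟨fun e => n3 ?_, fun e => n4 ?_, fun e => n1 ?_, fun e => n2 ?_⟩
      · rw [← e, DS.mate_mate]
      · rw [← DS.mate_rev, ← e, DS.mate_mate]
      · rw [← DS.mate_mate δ', e, DS.mate_mate]
      · rw [← DS.mate_mate δ', e, DS.mate_rev, DS.mate_mate]
    obtain ⟨n1, n2, n3, n4⟩ := nm
    have fin : (δ'.mate ∈ L' ++ [δ] ∨ δ'.mate.rev ∈ L' ++ [δ]) → δ'.mate ∈ L' ++ [μ.nx, μ.nx.nx] ∨ δ'.mate.rev ∈ L' ++ [μ.nx, μ.nx.nx] := by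
      rintro (h1 | h1)
      · rcases memL h1 with h1 | h1
        · left; simp [h1]
        · exact absurd h1 n1
      · rcases memL h1 with h1 | h1
        · right; simp [h1]
        · exact absurd (by rw [← h1, DS.rev_rev]) n2
    rcases hm' with hm' | hm'
    · rcases sidesμ _ hm' with h | h | h | h
      · exact absurd h n3
      · exact absurd h n4
      · exact Or.inl h
      · exact Or.inr h
    · simp only [List.mem_append, List.mem_cons, List.not_mem_nil, or_false] at h
      rcases h with h | h
      · exact fin (S.closed δ' (by simp [h]) hm')
      · have ht : δ'.tri = μ.tri := by rcases h with rfl | rfl <;> rfl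
        rcases S.complete δ'.mate hm' with h1 | h1 | ⟨h1, -⟩
        · exact fin (Or.inl h1)
        · exact fin (Or.inr h1)
        · rw [DS.mate_mate, ht] at h1; exact absurd h1 hA
end

section
variable {D : GlueingDatum 4}

theorem Stt.fold {A : Set (Tri D)} {L' : List (DS D)} {a : DS D} (h : Stt A (L' ++ [a, a.mate.rev])) (hm : 1 ≤ L'.length) :
    Stt A L' := by
  obtain ⟨Φ, S⟩ := h
  set m := L'.length with hmdef
  have m0 : (0:ℝ) < m := by exact_mod_cast hm
  set l : ℝ := (m:ℝ) / (m + 2) with hldef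
  have hl : l ∈ Set.Ioo (0:ℝ) 1 := ⟨by positivity, by rw [hldef, div_lt_one (by positivity)]; linarith⟩
  have hlen : (((L' ++ [a, a.mate.rev]).length : ℕ) : ℝ) = m + 2 := by simp [hmdef]
  let Φ' : Tri D → (Fin 5 → ℝ) → ℂ := fun τ x => (Up l (Φ τ x)) ^ 2
  have aA : a.tri ∈ A := S.inA a (by simp)
  have bA : a.mate.tri ∈ A := S.inA a.mate.rev (by simp)
  have ha : ∀ t ∈ Set.Icc (0:ℝ) 1, Φ a.tri (a.P t) = pt (l + (1 - l) * (t / 2)) := by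
    intro t ht
    rw [S.bdry m a (by simp [hmdef]) t ht, hlen]
    congr 1
    rw [hldef]; field_simp; ring
  have hb : ∀ t ∈ Set.Icc (0:ℝ) 1, Φ a.mate.tri (a.mate.P t) = pt (l + (1 - l) * (1 - t / 2)) := by
    intro t ht
    have := S.bdry (m+1) a.mate.rev (by simp [hmdef]) (1 - t) (one_sub_mem ht)
    rw [DS.P_rev, DS.rev_tri, hlen, show 1 - (1 - t) = t by ring] at this
    rw [this]
    congr 1
    rw [hldef]; push_cast; field_simp; ring
  have hh : ∀ t ∈ Set.Icc (0:ℝ) 1, t / 2 ∈ Set.Icc (0:ℝ) 1 := fun t ht => ⟨by linarith [ht.1], by linarith [ht.2]⟩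
  have glu : ∀ t ∈ Set.Icc (0:ℝ) 1, Φ' a.tri (a.P t) = Φ' a.mate.tri (a.mate.P t) := by
    intro t ht
    show (Up l (Φ _ _)) ^ 2 = (Up l (Φ _ _)) ^ 2
    rw [ha t ht, hb t ht, Up_down hl (hh t ht), Up_down hl (one_sub_mem (hh t ht)),
      show Real.pi * (1 - t / 2) = Real.pi - Real.pi * (t / 2) by ring, Real.cos_pi_sub]
    push_cast; ring
  have memL : ∀ {δ'}, δ' ∈ L' ++ [a, a.mate.rev] → δ' ∈ L' ∨ δ' = a ∨ δ' = a.mate.rev := fun h => by simpa using h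
  refine ⟨Φ', ?_, ?_, ?_, ?_, ?_, ?_, ?_, ?_⟩
  · intro τ hτ
    have h0 : ContinuousOn (fun x => Up l (Φ τ x)) (labS τ.2.1) :=
        ContinuousOn.comp (g := Up l) (t := BB) (Up_cont hl) (S.cont τ hτ) fun x hx => S.maps τ hτ x hx
    exact h0.pow 2
  · intro τ hτ x hx
    have := mem_BB.1 (Up_mem hl (S.maps τ hτ x hx)).1
    rw [mem_BB, norm_pow]
    exact pow_le_one₀ (norm_nonneg _) this
  · intro z hz
    obtain ⟨w, hw, him⟩ : ∃ w : ℂ, w ^ 2 = z ∧ 0 ≤ w.im := by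
      obtain ⟨ζ, hζ⟩ := IsAlgClosed.exists_pow_nat_eq z (n := 2) (by norm_num)
      rcases le_total 0 ζ.im with h | h
      · exact ⟨ζ, hζ, h⟩
      · exact ⟨-ζ, by rw [neg_sq, hζ], by simpa using h⟩
    have hwB : w ∈ BB := by
      rw [mem_BB] at hz ⊢
      rw [← hw, norm_pow] at hz
      exact (pow_le_one_iff_of_nonneg (norm_nonneg _) (by norm_num)).1 hz
    obtain ⟨u, hu, e⟩ := Up_surj hl hwB him
    obtain ⟨τ, hτ, x, hx, e2⟩ := S.surj u hu
    exact ⟨τ, hτ, x, hx, by show (Up l (Φ τ x)) ^ 2 = z; rw [e2, e, hw]⟩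
  · intro τ hτ x hx τ' hτ' y hy h
    rcases sq_eq_sq_iff_eq_or_eq_neg.1 h with h | h
    · exact S.sound τ hτ x hx τ' hτ' y hy (Up_inj hl h)
    · have i1 := (Up_mem hl (S.maps τ hτ x hx)).2
      have i2 := (Up_mem hl (S.maps τ' hτ' y hy)).2
      have him : (Up l (Φ τ x)).im = -(Up l (Φ τ' y)).im := by rw [h, Complex.neg_im]
      have hre : (Up l (Φ τ x)).re = -(Up l (Φ τ' y)).re := by rw [h, Complex.neg_re]
      obtain ⟨b1, b2⟩ := re_mem (Up_mem hl (S.maps τ hτ x hx)).1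
      obtain ⟨t, ht, e⟩ := cos_ex b1 b2
      have c1 := Up_real hl (by linarith) ht e
      have c2 := Up_real hl (z := Φ τ' y) (by linarith) (one_sub_mem ht) (by
        rw [show Real.pi * (1 - t) = Real.pi - Real.pi * t by ring, Real.cos_pi_sub]; linarith)
      -- choose the common parameter
      rcases le_total t (1/2) with h2 | h2
      · have hs : 2 * t ∈ Set.Icc (0:ℝ) 1 := ⟨by linarith [ht.1], by linarith⟩
        have d1 := S.sound τ hτ x hx _ aA _ (a.P_mem hs) (by rw [c1, ha _ hs]; congr 1; ring)
        have d2 := S.sound τ' hτ' y hy _ bA _ (a.mate.P_mem hs) (by rw [c2, hb _ hs]; congr 1; ring)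
        rw [d1, d2, a.mate_mkS hs]
      · have hs : 2 * (1 - t) ∈ Set.Icc (0:ℝ) 1 := ⟨by linarith [ht.2], by linarith⟩
        have d1 := S.sound τ hτ x hx _ bA _ (a.mate.P_mem hs) (by rw [c1, hb _ hs]; congr 1; ring)
        have d2 := S.sound τ' hτ' y hy _ aA _ (a.P_mem hs) (by rw [c2, ha _ hs]; congr 1; ring)
        rw [d1, d2, a.mate_mkS hs]
  · intro δ h; exact S.inA δ (by simp [h])
  · intro k δ hk t ht
    have hkl := getElem?_lt hk
    have hk' : (k:ℝ) + 1 ≤ m := by exact_mod_cast hkl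
    have k0 : (0:ℝ) ≤ k := by positivity
    show (Up l (Φ δ.tri (δ.P t))) ^ 2 = _
    rw [S.bdry k δ (by rw [List.getElem?_append_left hkl, hk]) t ht, hlen,
      Up_up hl ⟨div_nonneg (by linarith [ht.1]) (by positivity), by rw [hldef]; gcongr; linarith [ht.2]⟩, sq, ← pt_add]
    congr 1
    rw [hldef, ← hmdef]
    field_simp
    ring
  · intro δ hδ
    have gl' : ∀ δ'', δ'' = a ∨ δ'' = a.rev ∨ δ'' = a.mate ∨ δ'' = a.mate.rev → (δ''.mate.tri ∈ A ∧ ∀ t ∈ Set.Icc (0:ℝ) 1, Φ' δ''.tri (δ''.P t) = Φ' δ''.mate.tri (δ''.mate.P t)) := by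
      rintro δ'' (rfl | rfl | rfl | rfl)
      · exact ⟨bA, glu⟩
      · rw [DS.mate_rev]
        refine ⟨bA, fun t ht => ?_⟩
        rw [DS.P_rev, DS.P_rev]
        exact glu _ (one_sub_mem ht)
      · rw [DS.mate_mate]
        exact ⟨aA, fun t ht => (glu t ht).symm⟩
      · rw [DS.mate_rev, DS.mate_mate]
        refine ⟨aA, fun t ht => ?_⟩
        rw [DS.P_rev, DS.P_rev]
        exact (glu _ (one_sub_mem ht)).symm
    rcases S.complete δ hδ with h1 | h1 | ⟨h1, h2⟩
    · rcases memL h1 with h1 | h1 | h1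
      · exact Or.inl h1
      · exact Or.inr (Or.inr (gl' δ (by simp [h1])))
      · exact Or.inr (Or.inr (gl' δ (by simp [h1])))
    · rcases memL h1 with h1 | h1 | h1
      · exact Or.inr (Or.inl h1)
      · exact Or.inr (Or.inr (gl' δ (by simp [← h1, DS.rev_rev])))
      · exact Or.inr (Or.inr (gl' δ (by right; right; left; rw [← δ.rev_rev, h1, DS.rev_rev])))
    · refine Or.inr (Or.inr ⟨h1, fun t ht => ?_⟩)
      show (Up l (Φ _ _)) ^ 2 = (Up l (Φ _ _)) ^ 2
      rw [h2 t ht]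
  · intro δ hδ hmA
    have n1 : ¬ (δ = a ∨ δ = a.rev) := fun h' => S.uniq_last hδ (by simp) h'
    have n2 : ¬ (δ = a.mate.rev ∨ δ = a.mate) := fun h' => S.uniq_last hδ (δ := a.mate.rev) (by simp) h'
    push Not at n1 n2
    have k1 : δ.mate ≠ a := fun e => n2.2 (by rw [← e, DS.mate_mate])
    have k2 : δ.mate ≠ a.rev := fun e => n2.1 (by rw [← DS.mate_rev, ← e, DS.mate_mate])
    have k3 : δ.mate ≠ a.mate := fun e => n1.1 (by rw [← DS.mate_mate δ, e, DS.mate_mate])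
    have k4 : δ.mate ≠ a.mate.rev := fun e => n1.2 (by rw [← DS.mate_mate δ, e, DS.mate_rev, DS.mate_mate])
    rcases S.closed δ (by simp [hδ]) hmA with h1 | h1
    · rcases memL h1 with h1 | h1 | h1
      · exact Or.inl h1
      · exact absurd h1 k1
      · exact absurd h1 k4
    · rcases memL h1 with h1 | h1 | h1
      · exact Or.inr h1
      · exact absurd (by rw [← h1, DS.rev_rev]) k2
      · exact absurd (by rw [← δ.mate.rev_rev, h1, DS.rev_rev]) k3

/-! ### phase 1 -/
theorem phase1 (N : ℕ) : ∀ (A : Set (Tri D)) (L : List (DS D)), (Aᶜ).ncard ≤ N → 2 ≤ L.length → Stt A L → ∀ τ₀ ∈ A,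
    ∃ A' L', Stt A' L' ∧ 2 ≤ L'.length ∧ τ₀ ∈ A' ∧ ∀ δ ∈ L', δ.mate.tri ∈ A' := by
  induction N with
  | zero =>
    intro A L hN hL hS τ₀ h0
    refine ⟨A, L, hS, hL, h0, fun δ _ => ?_⟩
    by_contra h
    have : (Aᶜ) = ∅ := (Set.ncard_eq_zero (Set.toFinite _)).1 (by omega)
    have h' : δ.mate.tri ∈ Aᶜ := h
    rw [this] at h'
    exact h'
  | succ N ih =>
    intro A L hN hL hS τ₀ h0
    by_cases hall : ∀ δ ∈ L, δ.mate.tri ∈ A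
    · exact ⟨A, L, hS, hL, h0, hall⟩
    push Not at hall
    obtain ⟨δ, hδ, hm⟩ := hall
    obtain ⟨L1, L2, rfl⟩ := List.append_of_mem hδ
    have h2 : Stt A ((L2 ++ L1) ++ [δ]) := by
      have h3 : Stt A ((L1 ++ [δ]) ++ L2) := by simpa using hS
      simpa using h3.rot
    have hlen : 1 ≤ (L2 ++ L1).length := by simp at hL ⊢; omega
    refine ih _ _ ?_ ?_ (h2.merge hlen hm) τ₀ (Or.inr h0)
    · have : (insert δ.mate.tri A)ᶜ ⊂ Aᶜ := by
        refine ⟨Set.compl_subset_compl.2 (Set.subset_insert _ _), fun h => ?_⟩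
        exact h (show δ.mate.tri ∈ Aᶜ from hm) (Set.mem_insert _ _)
      have := Set.ncard_lt_ncard this (Set.toFinite _)
      omega
    · simp only [List.length_append, List.length_cons, List.length_nil]; omega
end

section
variable {D : GlueingDatum 4}

def MC (A : Set (Tri D)) : Prop := ∀ δ : DS D, δ.tri ∈ A → δ.mate.tri ∈ A

theorem MC.rel {A : Set (Tri D)} (h : MC A) {p q : SurfTotal D} (hr : surfRel D p q) : p.1 ∈ A ↔ q.1 ∈ A := by
  obtain ⟨δ, t, ht, h1, h2, h3, h4⟩ := DS.rel p q hr
  rw [← h1, ← h3]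
  refine ⟨h δ, fun h' => ?_⟩
  have := h _ h'
  rwa [DS.mate_mate] at this

instance totCompact : CompactSpace (SurfTotal D) := inferInstance

theorem KA_clopen (A : Set (Tri D)) : IsClopen {p : SurfTotal D | p.1 ∈ A} := by
  constructor
  · rw [← isOpen_compl_iff, isOpen_sigma_iff]
    intro τ
    by_cases h : τ ∈ A
    · convert isOpen_empty; ext x; simp [h]
    · convert isOpen_univ; ext x; simp [h]
  · rw [isOpen_sigma_iff]
    intro τ
    by_cases h : τ ∈ A
    · convert isOpen_univ; ext x; simp [h]
    · convert isOpen_empty; ext x; simp [h]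

theorem tot_cont {Y : Type*} [TopologicalSpace Y] {A : Set (Tri D)} {F : Tri D → (Fin 5 → ℝ) → Y} (h : ∀ τ ∈ A, ContinuousOn (F τ) (labS τ.2.1)) :
    ContinuousOn (fun p : SurfTotal D => F p.1 p.2.1) {p : SurfTotal D | p.1 ∈ A} := by
  rw [continuousOn_iff_continuous_domRestrict]
  have : ContinuousOn (fun p : SurfTotal D => if p.1 ∈ A then F p.1 p.2.1 else F p.1 (defaultT p.1.2.1 p.1.2.2).1) Set.univ := by
    rw [continuousOn_univ]
    refine continuous_sigma fun τ => ?_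
    by_cases hτ : τ ∈ A
    · simp only [hτ, if_true]
      have h9 : Continuous fun x : labS τ.2.1 => F τ x.1 := continuousOn_iff_continuous_domRestrict.1 (h τ hτ)
      exact h9
    · simp only [hτ, if_false]
      have h9 : Continuous fun _ : labS τ.2.1 => F τ (defaultT τ.2.1 τ.2.2).1 := continuous_const
      exact h9
  rw [continuousOn_univ] at this
  refine (this.comp continuous_subtype_val).congr fun p => ?_
  show (if p.1.1 ∈ A then _ else _) = _
  rw [if_pos (show p.1.1 ∈ A from p.2)]; rfl

theorem St.ex_q {A : Set (Tri D)} {L Φ} (S : St A L Φ) : ∃ q : ℂ → SurfSpace D, ContinuousOn q BB ∧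
    (∀ z ∈ BB, ∃ τ ∈ A, ∃ x ∈ labS τ.2.1, Φ τ x = z ∧ q z = mkS D τ x) ∧
    ∀ τ ∈ A, ∀ x ∈ labS τ.2.1, q (Φ τ x) = mkS D τ x := by
  haveI : Nonempty (Tri D) := by
    obtain ⟨τ, -⟩ := S.surj 0 (by rw [mem_BB]; simp)
    exact ⟨τ⟩
  choose! f hf g hg e using S.surj
  let q : ℂ → SurfSpace D := fun z => mkS D (f z) (g z)
  have hq : ∀ τ ∈ A, ∀ x ∈ labS τ.2.1, q (Φ τ x) = mkS D τ x := by
    intro τ hτ x hx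
    have hz := S.maps τ hτ x hx
    exact S.sound _ (hf _ hz) _ (hg _ hz) τ hτ x hx (e _ hz)
  refine ⟨q, ?_, fun z hz => ⟨f z, hf z hz, g z, hg z hz, e z hz, rfl⟩, hq⟩
  have himg : BB = (fun p : SurfTotal D => Φ p.1 p.2.1) '' {p : SurfTotal D | p.1 ∈ A} := by
    ext z; constructor
    · intro hz; exact ⟨⟨f z, ⟨g z, hg z hz⟩⟩, hf z hz, e z hz⟩
    · rintro ⟨p, hp, rfl⟩; exact S.maps p.1 hp p.2.1 p.2.2
  rw [himg]
  refine cont_desc (KA_clopen A).isClosed.isCompact (tot_cont S.cont) ?_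
  have : ContinuousOn (fun p : SurfTotal D => (Quot.mk (surfRel D) p : SurfSpace D)) {p : SurfTotal D | p.1 ∈ A} := continuous_quot_mk.continuousOn
  refine this.congr fun p hp => ?_
  show q (Φ p.1 p.2.1) = _
  rw [hq p.1 hp p.2.1 p.2.2, mkS_mem p.2.2]

theorem pm_trans {V : Type*} [AddGroup V] {a b c : V} (h1 : a = b ∨ a = -b) (h2 : b = c ∨ b = -c) : a = c ∨ a = -c := by
  rcases h1 with rfl | rfl <;> rcases h2 with rfl | rfl <;> simp

theorem pm_symm {V : Type*} [AddGroup V] {a b : V} (h1 : a = b ∨ a = -b) : b = a ∨ b = -a := by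
  rcases h1 with rfl | rfl <;> simp

theorem St.flip {A : Set (Tri D)} {L Φ} (S : St A L Φ) (hA : MC A) (O : DD D) (H : Euclid D) {m : ℕ} (φ : ℂ → Fin m → ℝ) (hm : 0 < m)
    (hφ : ContinuousOn φ BB) (h0 : ∀ z ∈ BB, φ z ≠ 0)
    (hinv : ∀ δ : DS D, δ.tri ∈ A → ∀ t ∈ Set.Icc (0:ℝ) 1, φ (Φ δ.tri (δ.P t)) = φ (Φ δ.mate.tri (δ.mate.P t)) ∨
      φ (Φ δ.tri (δ.P t)) = - φ (Φ δ.mate.tri (δ.mate.P t)))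
    {u v : ℝ} (q : ℂ → SurfSpace D) (hq : ContinuousOn q BB) (hq1 : ∀ z ∈ BB, ∃ τ ∈ A, ∃ x ∈ labS τ.2.1, Φ τ x = z ∧ q z = mkS D τ x)
    (huv : q (pt u) = q (pt v)) : φ (pt u) = φ (pt v) := by
  let cT : SurfTotal D → Fin m → ℝ := fun p => if p.1 ∈ A then φ (Φ p.1 p.2.1) else fun _ => 1
  have crel : ∀ p q, surfRel D p q → cT p = cT q ∨ cT p = - cT q := by
    intro p q h
    have hm := hA.rel h
    by_cases hp : p.1 ∈ A
    · obtain ⟨δ, t, ht, h1, h2, h3, h4⟩ := DS.rel p q h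
      simp only [cT, hp, hm.1 hp, if_true]
      have h5 := hinv δ (h1 ▸ hp) t ht
      rw [h2, h4, h1, h3] at h5
      exact h5
    · left; simp only [cT, hp, mt hm.2 hp, if_false]
  have cpm : ∀ {p q}, Quot.mk (surfRel D) p = Quot.mk (surfRel D) q → (cT p = cT q ∨ cT p = - cT q) :=
    eqvGen_prop (fun p q => cT p = cT q ∨ cT p = - cT q) crel (fun _ => Or.inl rfl) (fun _ _ h => pm_symm h) (fun _ _ _ h h' => pm_trans h h')
  let c : SurfSpace D → Fin m → ℝ := fun z => cT z.out
  have cmk : ∀ p, cT p = c (Quot.mk _ p) ∨ cT p = - c (Quot.mk _ p) := fun p => cpm (Quot.out_eq _).symm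
  have cT0 : ∀ p, cT p ≠ 0 := by
    intro p
    by_cases hp : p.1 ∈ A
    · simp only [cT, hp, if_true]; exact h0 _ (S.maps _ hp _ p.2.2)
    · simp only [cT, hp, if_false]
      intro h
      have := congrFun h ⟨0, hm⟩
      norm_num at this
  have cc : ∀ i j, Continuous fun z => c z i * c z j := by
    intro i j
    have hT : Continuous fun p => cT p i * cT p j := by
      refine continuous_sigma fun τ => ?_
      by_cases hτ : τ ∈ A
      · simp only [cT, hτ, if_true]
        have : Continuous fun x : labS τ.2.1 => φ (Φ τ x.1) :=
          continuousOn_iff_continuous_domRestrict.1 (hφ.comp (S.cont τ hτ) fun x hx => S.maps τ hτ x hx)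
        exact ((continuous_apply i).comp this).mul ((continuous_apply j).comp this)
      · simp only [cT, hτ, if_false]; exact continuous_const
    rw [isQuotientMap_quot_mk.continuous_iff]
    refine hT.congr fun p => ?_
    show cT p i * cT p j = c (Quot.mk _ p) i * c (Quot.mk _ p) j
    rcases cmk p with h | h <;> rw [h] <;> simp
  let z : ℝ → ℂ := fun s => ((max 0 (1 - 2 * s) : ℝ) : ℂ) * pt u + ((max 0 (2 * s - 1) : ℝ) : ℂ) * pt v
  have zc : Continuous z := by
    have := Complex.continuous_ofReal
    show Continuous fun s => ((max 0 (1 - 2 * s) : ℝ) : ℂ) * pt u + ((max 0 (2 * s - 1) : ℝ) : ℂ) * pt v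
    exact ((this.comp (by fun_prop : Continuous fun s : ℝ => max 0 (1 - 2 * s))).mul continuous_const).add
      ((this.comp (by fun_prop : Continuous fun s : ℝ => max 0 (2 * s - 1))).mul continuous_const)
  have zB : ∀ s ∈ Set.Icc (0:ℝ) 1, z s ∈ BB := by
    intro s hs
    rw [mem_BB]
    refine (norm_add_le _ _).trans ?_
    rw [norm_polar (le_max_left _ _), norm_polar (le_max_left _ _)]
    rcases le_total s (1/2) with h | h
    · rw [max_eq_right (by linarith), max_eq_left (by linarith)]; linarith [hs.1]
    · rw [max_eq_left (by linarith), max_eq_right (by linarith)]; linarith [hs.2]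
  have z0 : z 0 = pt u := by simp [z]
  have z1 : z 1 = pt v := by simp [z]; norm_num
  have hol := O.T5 H c cc (fun w => cT0 _) (fun s => q (z s)) (hq.comp zc.continuousOn zB) (by simp only [z0, z1, huv])
  have := hol_lift c (fun s => q (z s)) (fun s => φ (z s)) (hφ.comp zc.continuousOn zB) (fun s hs => h0 _ (zB s hs)) ?_
    (by simp only [z0, z1, huv]) hol
  · simpa only [z0, z1] using this
  · intro s hs
    obtain ⟨τ, hτ, x, hx, e1, e2⟩ := hq1 (z s) (zB s hs)
    show φ (z s) = c (q (z s)) ∨ φ (z s) = -c (q (z s))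
    rw [e2, mkS_mem hx]
    have := cmk ⟨τ, ⟨x, hx⟩⟩
    simp only [cT, hτ, if_true, e1] at this
    exact this

/-! ### the curve function -/
def cl (u : ℝ) : ℝ := max 0 (min 1 u)
theorem cl_le {u : ℝ} (h : u ≤ 0) : cl u = 0 := by unfold cl; rw [min_eq_right (by linarith), max_eq_left h]
theorem cl_ge {u : ℝ} (h : 1 ≤ u) : cl u = 1 := by unfold cl; rw [min_eq_left h, max_eq_right (by norm_num)]
theorem cl_mid {u : ℝ} (h : u ∈ Set.Icc (0:ℝ) 1) : cl u = u := by unfold cl; rw [min_eq_right h.2, max_eq_right h.1]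

def psi (n p p' ε : ℝ) (θ : ℝ) : Fin 2 → ℝ :=
  ![1 - 2 * cl (n * θ - p) + 2 * cl (n * θ - p'), cl (n * θ - p) * (1 - cl (n * θ - p)) + ε * (cl (n * θ - p') * (1 - cl (n * θ - p')))]

theorem psi_cont (n p p' ε : ℝ) : Continuous (psi n p p' ε) := by
  unfold psi cl
  refine continuous_pi fun i => ?_
  fin_cases i <;> simp <;> fun_prop

theorem psi_ne {n p p' ε : ℝ} (h : p + 1 ≤ p') (hε : ε ≠ 0) (θ : ℝ) : psi n p p' ε θ ≠ 0 := by
  intro h0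
  have e0 := congrFun h0 0
  have e1 := congrFun h0 1
  simp only [psi, Matrix.cons_val_zero, Matrix.cons_val_one, Pi.zero_apply] at e0 e1
  rcases le_total (n * θ) p' with h1 | h1
  · rw [cl_le (u := n * θ - p') (by linarith)] at e0 e1
    have : cl (n * θ - p) = 1/2 := by linarith
    rw [this] at e1; norm_num at e1
  · rw [cl_ge (u := n * θ - p) (by linarith)] at e0 e1
    have : cl (n * θ - p') = 1/2 := by linarith
    rw [this] at e1; norm_num at e1; exact hε e1


theorem psi01 {n p p' : ℕ} {ε : ℝ} (hp : p < p') (hn : p' < n) : psi n p p' ε 0 = psi n p p' ε 1 := by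
  have h1 : (p:ℝ) + 1 ≤ p' := by exact_mod_cast hp
  have h2 : (p':ℝ) + 1 ≤ n := by exact_mod_cast hn
  have h3 : (0:ℝ) ≤ p := by positivity
  unfold psi
  rw [cl_le (u := n * 0 - p) (by linarith), cl_le (u := n * 0 - p') (by linarith), cl_ge (u := n * 1 - p) (by linarith), cl_ge (u := n * 1 - p') (by linarith)]
  ext i; fin_cases i <;> simp

theorem psi_out {n p p' : ℕ} {ε : ℝ} (hp : p < p') (hn : p' < n) {k : ℕ} (h : k < p ∨ p' < k) {t : ℝ} (ht : t ∈ Set.Icc (0:ℝ) 1) : psi n p p' ε ((k + t) / n) = ![1, 0] := by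
  have h1 : (p:ℝ) + 1 ≤ p' := by exact_mod_cast hp
  have n0 : (n:ℝ) ≠ 0 := by have : 0 < n := by omega
                            positivity
  unfold psi
  rw [mul_div_cancel₀ _ n0]
  rcases h with h | h
  · have h3 : (k:ℝ) + 1 ≤ p := by exact_mod_cast h
    rw [cl_le (by linarith [ht.2]), cl_le (by linarith [ht.2])]
    ext i; fin_cases i <;> simp
  · have h3 : (p':ℝ) + 1 ≤ k := by exact_mod_cast h
    rw [cl_ge (by linarith [ht.1]), cl_ge (by linarith [ht.1])]
    ext i; fin_cases i <;> simp

theorem psi_in {n p p' : ℕ} {ε : ℝ} (hp : p < p') (hn : p' < n) {k : ℕ} (h : p < k) (h' : k < p') {t : ℝ} (ht : t ∈ Set.Icc (0:ℝ) 1) : psi n p p' ε ((k + t) / n) = ![-1, 0] := by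
  have n0 : (n:ℝ) ≠ 0 := by have : 0 < n := by omega
                            positivity
  have h3 : (p:ℝ) + 1 ≤ k := by exact_mod_cast h
  have h4 : (k:ℝ) + 1 ≤ p' := by exact_mod_cast h'
  unfold psi
  rw [mul_div_cancel₀ _ n0, cl_ge (by linarith [ht.1]), cl_le (by linarith [ht.2])]
  ext i; fin_cases i <;> simp; norm_num

theorem psi_p {n p p' : ℕ} {ε : ℝ} (hp : p < p') (hn : p' < n) {t : ℝ} (ht : t ∈ Set.Icc (0:ℝ) 1) : psi n p p' ε ((p + t) / n) = ![1 - 2 * t, t * (1 - t)] := by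
  have n0 : (n:ℝ) ≠ 0 := by have : 0 < n := by omega
                            positivity
  have h1 : (p:ℝ) + 1 ≤ p' := by exact_mod_cast hp
  unfold psi
  rw [mul_div_cancel₀ _ n0, cl_le (u := p + t - p') (by linarith [ht.2]), add_sub_cancel_left, cl_mid ht]
  ext i; fin_cases i <;> simp

theorem psi_p' {n p p' : ℕ} {ε : ℝ} (hp : p < p') (hn : p' < n) {t : ℝ} (ht : t ∈ Set.Icc (0:ℝ) 1) : psi n p p' ε ((p' + t) / n) = ![-1 + 2 * t, ε * (t * (1 - t))] := by
  have n0 : (n:ℝ) ≠ 0 := by have : 0 < n := by omega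
                            positivity
  have h1 : (p:ℝ) + 1 ≤ p' := by exact_mod_cast hp
  unfold psi
  rw [mul_div_cancel₀ _ n0, cl_ge (u := p' + t - p) (by linarith [ht.1]), add_sub_cancel_left, cl_mid ht]
  ext i; fin_cases i <;> simp; norm_num

def phi3 (f : ℝ → Fin 2 → ℝ) (z : ℂ) : Fin 3 → ℝ := ![discExt f z 0, discExt f z 1, 1 - ‖z‖]

theorem phi3_cont {f : ℝ → Fin 2 → ℝ} (hf : Continuous f) (h01 : f 0 = f 1) : ContinuousOn (phi3 f) BB := by
  have h := discExt_cont hf.continuousOn h01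
  refine continuousOn_pi.2 fun i => ?_
  fin_cases i
  · exact (continuous_apply (0 : Fin 2)).comp_continuousOn h
  · exact (continuous_apply (1 : Fin 2)).comp_continuousOn h
  · exact (continuous_const.sub continuous_norm).continuousOn

theorem phi3_pt {f : ℝ → Fin 2 → ℝ} (h01 : f 0 = f 1) {θ : ℝ} (hθ : θ ∈ Set.Icc (0:ℝ) 1) : phi3 f (pt θ) = ![f θ 0, f θ 1, 0] := by
  have := discExt_val h01 (ρ := 1) (by norm_num) hθ
  simp only [Complex.ofReal_one, one_mul, one_smul] at this
  unfold phi3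
  rw [this, pt_norm, sub_self]

theorem phi3_ne {f : ℝ → Fin 2 → ℝ} (h01 : f 0 = f 1) (h0 : ∀ θ, f θ ≠ 0) {z : ℂ} (hz : z ∈ BB) : phi3 f z ≠ 0 := by
  intro h
  have h2 : ‖z‖ = 1 := by
    have := congrFun h 2
    simp [phi3] at this; linarith
  have e := th_eq z
  rw [h2, Complex.ofReal_one, one_mul] at e
  rw [e, phi3_pt h01 (ico_icc (th_mem z))] at h
  apply h0 (th z)
  have a := congrFun h 0
  have b := congrFun h 1
  ext i; fin_cases i
  · exact a
  · exact b
end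

section
variable {D : GlueingDatum 4}

def Par (η η' : DS D) : Prop := η' = η.mate ∨ η' = η.mate.rev

theorem DS.rev_inj {a b : DS D} (h : a.rev = b.rev) : a = b := by
  have := congrArg DS.rev h
  rwa [DS.rev_rev, DS.rev_rev] at this

theorem Par.symm {η η' : DS D} (h : Par η η') : Par η' η := by
  rcases h with rfl | rfl
  · left; rw [DS.mate_mate]
  · right; rw [DS.mate_rev, DS.mate_mate, DS.rev_rev]

theorem Par.uniq {η a b : DS D} (h : Par η a) (h' : Par η b) : a = b ∨ a = b.rev := by
  rcases h with rfl | rfl <;> rcases h' with rfl | rfl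
  · left; rfl
  · right; rfl
  · right; rfl
  · left; rfl

theorem St.uniqP {A : Set (Tri D)} {L Φ} (S : St A L Φ) {i j : ℕ} {η a b : DS D} (hk : Par η a) (hk' : Par η b) (hi : L[i]? = some a) (hj : L[j]? = some b) : i = j :=
  S.uniq hj hi (hk.uniq hk') |>.symm

theorem St.partner {A : Set (Tri D)} {L Φ} (S : St A L Φ) (hA : MC A) {k : ℕ} {η : DS D} (hk : L[k]? = some η) :
    ∃ k' η', L[k']? = some η' ∧ Par η η' ∧ k' ≠ k := by
  have hm := List.mem_of_getElem? hk
  have key : ∃ η', η' ∈ L ∧ Par η η' := by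
    rcases S.closed η hm (hA _ (S.inA _ hm)) with h | h
    · exact ⟨_, h, Or.inl rfl⟩
    · exact ⟨_, h, Or.inr rfl⟩
  obtain ⟨η', h, hp⟩ := key
  obtain ⟨k', hk'⟩ := List.mem_iff_getElem?.1 h
  refine ⟨k', η', hk', hp, ?_⟩
  rintro rfl
  rw [hk] at hk'
  have e := Option.some.inj hk'
  rcases hp with h1 | h1
  · exact η.mate_ne (by rw [← h1, ← e])
  · rw [← e] at h1
    exact η.mate_ne_rev (DS.rev_inj (by rw [← h1, DS.rev_rev]))


theorem St.par0 {A : Set (Tri D)} {L : List (DS D)} {Φ : Tri D → (Fin 5 → ℝ) → ℂ} (S : St A L Φ) {p p' : ℕ} {δ δ' : DS D} (hpp : p < p') (hp : L[p]? = some δ) (hp' : L[p']? = some δ') {ε : ℝ} (hε : (δ' = δ.mate ∧ ε = -1) ∨ (δ' = δ.mate.rev ∧ ε = 1)) : Par δ δ' := by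
  rcases hε with ⟨h, -⟩ | ⟨h, -⟩
  · exact Or.inl h
  · exact Or.inr h

theorem St.psi_other {A : Set (Tri D)} {L : List (DS D)} {Φ : Tri D → (Fin 5 → ℝ) → ℂ} (S : St A L Φ) {p p' : ℕ} {δ δ' : DS D} (hpp : p < p') (hp : L[p]? = some δ) (hp' : L[p']? = some δ') {ε : ℝ} (hε : (δ' = δ.mate ∧ ε = -1) ∨ (δ' = δ.mate.rev ∧ ε = 1)) {k : ℕ} (h1 : k ≠ p) (h2 : k ≠ p') {t : ℝ} (ht : t ∈ Set.Icc (0:ℝ) 1) :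
    psi L.length p p' ε ((k + t) / L.length) = ![1, 0] ∨ psi L.length p p' ε ((k + t) / L.length) = - ![1, 0] := by
  have hn := getElem?_lt hp'
  rcases lt_or_gt_of_ne h1 with h | h
  · left; exact psi_out hpp hn (Or.inl h) ht
  · rcases lt_or_gt_of_ne h2 with h' | h'
    · right; rw [psi_in hpp hn h h' ht]; ext i; fin_cases i <;> simp
    · left; exact psi_out hpp hn (Or.inr h') ht

theorem St.psi_mate {A : Set (Tri D)} {L : List (DS D)} {Φ : Tri D → (Fin 5 → ℝ) → ℂ} (S : St A L Φ) {p p' : ℕ} {δ δ' : DS D} (hpp : p < p') (hp : L[p]? = some δ) (hp' : L[p']? = some δ') {ε : ℝ} (hε : (δ' = δ.mate ∧ ε = -1) ∨ (δ' = δ.mate.rev ∧ ε = 1)) {k k' : ℕ} {η η' : DS D} (hk : L[k]? = some η) (hk' : L[k']? = some η') {s t : ℝ} (ht : t ∈ Set.Icc (0:ℝ) 1)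
    (hs : (η' = η.mate ∧ s = t) ∨ (η' = η.mate.rev ∧ s = 1 - t)) :
    psi L.length p p' ε ((k + t) / L.length) = psi L.length p p' ε ((k' + s) / L.length) ∨
    psi L.length p p' ε ((k + t) / L.length) = - psi L.length p p' ε ((k' + s) / L.length) := by
  have hn := getElem?_lt hp'
  have h0 := S.par0 hpp hp hp' hε
  have hs1 : s ∈ Set.Icc (0:ℝ) 1 := by
    rcases hs with ⟨-, rfl⟩ | ⟨-, rfl⟩
    · exact ht
    · exact one_sub_mem ht
  have hP : Par η η' := by
    rcases hs with ⟨h, -⟩ | ⟨h, -⟩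
    · exact Or.inl h
    · exact Or.inr h
  by_cases k1 : k = p
  · subst k1
    obtain rfl : δ = η := Option.some.inj (hp.symm.trans hk)
    obtain rfl : k' = p' := S.uniqP hP h0 hk' hp'
    obtain rfl : δ' = η' := Option.some.inj (hp'.symm.trans hk')
    rw [psi_p hpp hn ht, psi_p' hpp hn hs1]
    rcases hε with ⟨e, rfl⟩ | ⟨e, rfl⟩ <;> rcases hs with ⟨e', rfl⟩ | ⟨e', rfl⟩
    · right; ext i; fin_cases i <;> simp <;> ring
    · exact absurd (e'.symm.trans e) (DS.rev_ne _)
    · exact absurd (e.symm.trans e') (DS.rev_ne _)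
    · left; ext i; fin_cases i <;> simp <;> ring
  · by_cases k2 : k = p'
    · subst k2
      obtain rfl : δ' = η := Option.some.inj (hp'.symm.trans hk)
      obtain rfl : k' = p := S.uniqP hP h0.symm hk' hp
      obtain rfl : δ = η' := Option.some.inj (hp.symm.trans hk')
      rw [psi_p hpp hn hs1, psi_p' hpp hn ht]
      rcases hε with ⟨e, rfl⟩ | ⟨e, rfl⟩ <;> rcases hs with ⟨e', rfl⟩ | ⟨e', rfl⟩
      · right; ext i; fin_cases i <;> simp <;> ring
      · rw [e, DS.mate_mate] at e'
        exact absurd e'.symm (DS.rev_ne _)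
      · rw [e, DS.mate_rev, DS.mate_mate] at e'
        exact absurd e'.symm (DS.rev_ne _)
      · left; ext i; fin_cases i <;> simp <;> ring
    · have k3 : k' ≠ p := by
        rintro rfl
        obtain rfl : δ = η' := Option.some.inj (hp.symm.trans hk')
        exact k2 (S.uniqP hP.symm h0 hk hp')
      have k4 : k' ≠ p' := by
        rintro rfl
        obtain rfl : δ' = η' := Option.some.inj (hp'.symm.trans hk')
        exact k1 (S.uniqP hP.symm h0.symm hk hp)
      exact pm_trans (S.psi_other hpp hp hp' hε k1 k2 ht) (pm_symm (S.psi_other hpp hp hp' hε k3 k4 hs1))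

theorem pos_mem {k n : ℕ} (h : k < n) {t : ℝ} (ht : t ∈ Set.Icc (0:ℝ) 1) : ((k:ℝ) + t) / n ∈ Set.Icc (0:ℝ) 1 := by
  have h1 : (k:ℝ) + 1 ≤ n := by exact_mod_cast h
  have h2 : (0:ℝ) ≤ k := by positivity
  have h3 : (0:ℝ) < n := by linarith
  exact ⟨div_nonneg (by linarith [ht.1]) h3.le, by rw [div_le_one h3]; linarith [ht.2]⟩

theorem St.noncross {A : Set (Tri D)} {L : List (DS D)} {Φ : Tri D → (Fin 5 → ℝ) → ℂ} (S : St A L Φ) (hA : MC A) (O : DD D) (H : Euclid D)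
    {p p' : ℕ} {δ δ' : DS D} (hpp : p < p') (hp : L[p]? = some δ) (hp' : L[p']? = some δ') {ε : ℝ}
    (hε : (δ' = δ.mate ∧ ε = -1) ∨ (δ' = δ.mate.rev ∧ ε = 1)) {k k' : ℕ} {η η' : DS D} (hk : L[k]? = some η) (hk' : L[k']? = some η')
    (hP : Par η η') :
    psi L.length p p' ε ((k + 1/2) / L.length) = psi L.length p p' ε ((k' + 1/2) / L.length) := by
  have hn := getElem?_lt hp'
  have h01 : psi L.length p p' ε 0 = psi L.length p p' ε 1 := psi01 hpp hn
  have hh : (1/2:ℝ) ∈ Set.Icc (0:ℝ) 1 := by constructor <;> norm_num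
  obtain ⟨q, hq, hq1, hq2⟩ := S.ex_q
  have main : ∀ η ∈ L, ∀ t ∈ Set.Icc (0:ℝ) 1, phi3 (psi L.length p p' ε) (Φ η.tri (η.P t)) = phi3 (psi L.length p p' ε) (Φ η.mate.tri (η.mate.P t)) ∨
      phi3 (psi L.length p p' ε) (Φ η.tri (η.P t)) = - phi3 (psi L.length p p' ε) (Φ η.mate.tri (η.mate.P t)) := by
    intro η hη t ht
    obtain ⟨k, hk⟩ := List.mem_iff_getElem?.1 hη
    have key : ∃ (k' : ℕ) (η' : DS D) (s : ℝ), L[k']? = some η' ∧ s ∈ Set.Icc (0:ℝ) 1 ∧ ((η' = η.mate ∧ s = t) ∨ (η' = η.mate.rev ∧ s = 1 - t)) ∧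
        Φ η.mate.tri (η.mate.P t) = pt ((k' + s) / L.length) := by
      rcases S.closed η hη (hA _ (S.inA _ hη)) with h | h
      · obtain ⟨k', hk'⟩ := List.mem_iff_getElem?.1 h
        exact ⟨k', _, t, hk', ht, Or.inl ⟨rfl, rfl⟩, S.bdry _ _ hk' t ht⟩
      · obtain ⟨k', hk'⟩ := List.mem_iff_getElem?.1 h
        refine ⟨k', _, 1 - t, hk', one_sub_mem ht, Or.inr ⟨rfl, rfl⟩, ?_⟩
        have := S.bdry _ _ hk' (1 - t) (one_sub_mem ht)
        rwa [DS.P_rev, sub_sub_cancel, DS.rev_tri] at this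
    obtain ⟨k', η', s, hk', hs, hss, e⟩ := key
    rw [e, S.bdry _ _ hk t ht, phi3_pt h01 (pos_mem (getElem?_lt hk) ht), phi3_pt h01 (pos_mem (getElem?_lt hk') hs)]
    rcases S.psi_mate hpp hp hp' hε hk hk' ht hss with h | h
    · left; rw [h]
    · right; rw [h]; ext i; fin_cases i <;> simp
  have hε0 : ε ≠ 0 := by rcases hε with ⟨-, rfl⟩ | ⟨-, rfl⟩ <;> norm_num
  have hqq : q (pt ((k + 1/2) / L.length)) = q (pt ((k' + 1/2) / L.length)) := by
    rw [← S.bdry _ _ hk _ hh, ← S.bdry _ _ hk' _ hh, hq2 _ (S.inA _ (List.mem_of_getElem? hk)) _ (η.P_mem hh),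
      hq2 _ (S.inA _ (List.mem_of_getElem? hk')) _ (η'.P_mem hh), η.mate_mkS hh]
    rcases hP with rfl | rfl
    · rfl
    · rw [DS.P_rev, DS.rev_tri]; norm_num
  have := S.flip hA O H (phi3 (psi L.length p p' ε)) (by norm_num) (phi3_cont (psi_cont _ _ _ _) h01)
    (fun z hz => phi3_ne h01 (psi_ne (by exact_mod_cast hpp) hε0) hz) ?_ q hq hq1 hqq
  · rw [phi3_pt h01 (pos_mem (getElem?_lt hk) hh), phi3_pt h01 (pos_mem (getElem?_lt hk') hh)] at this
    ext i
    fin_cases i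
    · exact congrFun this 0
    · exact congrFun this 1
  · intro η hη t ht
    rcases S.complete η hη with h | h | h
    · exact main η h t ht
    · have := main _ h (1 - t) (one_sub_mem ht)
      rwa [DS.mate_rev, DS.P_rev, DS.P_rev, sub_sub_cancel, DS.rev_tri, DS.rev_tri] at this
    · left; rw [h.2 t ht]

theorem St.adj {A : Set (Tri D)} {L : List (DS D)} {Φ : Tri D → (Fin 5 → ℝ) → ℂ} (S : St A L Φ) (hA : MC A) (O : DD D) (H : Euclid D) :
    ∀ (N p p' : ℕ) (δ δ' : DS D), p' - p ≤ N → p < p' → L[p]? = some δ → L[p']? = some δ' → Par δ δ' →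
    ∃ p a, L[p]? = some a ∧ L[p + 1]? = some a.mate.rev := by
  intro N
  induction N with
  | zero => intro p p' _ _ h1 h2; omega
  | succ N ih =>
    intro p p' δ δ' hN hpp hp hp' hP
    have hn := getElem?_lt hp'
    have hh : (1/2:ℝ) ∈ Set.Icc (0:ℝ) 1 := by constructor <;> norm_num
    have h1 : δ' = δ.mate.rev := by
      rcases hP with h | h
      · exfalso
        have := S.noncross hA O H hpp hp hp' (Or.inl ⟨h, rfl⟩) hp hp' (Or.inl h)
        rw [psi_p hpp hn hh, psi_p' hpp hn hh] at this
        have := congrFun this 1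
        norm_num at this
      · exact h
    by_cases he : p' = p + 1
    · subst he; exact ⟨p, δ, hp, by rw [hp', h1]⟩
    · have hk : L[p + 1]? = some (L[p + 1]'(by omega)) := List.getElem?_eq_getElem _
      obtain ⟨k', η', hk', hPk, hne⟩ := S.partner hA hk
      have hnc := S.noncross hA O H hpp hp hp' (Or.inr ⟨h1, rfl⟩) hk hk' hPk
      rw [psi_in hpp hn (by omega) (by omega) hh] at hnc
      have k1 : k' ≠ p := by
        rintro rfl
        obtain rfl : δ = η' := Option.some.inj (hp.symm.trans hk')
        have := S.uniqP hPk.symm hP hk hp'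
        omega
      have k2 : k' ≠ p' := by
        rintro rfl
        obtain rfl : δ' = η' := Option.some.inj (hp'.symm.trans hk')
        have := S.uniqP hPk.symm hP.symm hk hp
        omega
      have k3 : p < k' ∧ k' < p' := by
        by_contra hcon
        rw [psi_out hpp hn (by omega) hh] at hnc
        have := congrFun hnc 0
        norm_num at this
      exact ih (p + 1) k' _ η' (by omega) (by omega) hk hk' hPk

theorem St.adj' {A : Set (Tri D)} {L : List (DS D)} {Φ : Tri D → (Fin 5 → ℝ) → ℂ} (S : St A L Φ) (hA : MC A) (O : DD D) (H : Euclid D) (hL : 0 < L.length) :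
    ∃ L1 L2 a, L = L1 ++ [a, a.mate.rev] ++ L2 := by
  have h0 : L[0]? = some (L[0]'hL) := List.getElem?_eq_getElem _
  obtain ⟨k, η, hk, hP, hne⟩ := S.partner hA h0
  obtain ⟨p, a, h1, h2⟩ := S.adj hA O H k 0 k _ η (by omega) (by omega) h0 hk hP
  refine ⟨L.take p, L.drop (p + 2), a, ?_⟩
  have l1 := getElem?_lt h1
  have l2 := getElem?_lt h2
  rw [List.getElem?_eq_getElem l1] at h1
  rw [List.getElem?_eq_getElem l2] at h2
  rw [← Option.some.inj h2]
  have e1 := Option.some.inj h1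
  conv_lhs => rw [← List.take_append_drop p L, List.drop_eq_getElem_cons l1, List.drop_eq_getElem_cons l2, e1]
  simp

theorem reduce {A : Set (Tri D)} (hA : MC A) (O : DD D) (H : Euclid D) : ∀ (N : ℕ) (L : List (DS D)), L.length ≤ N → 2 ≤ L.length → Stt A L →
    ∃ a : DS D, Stt A [a, a.mate.rev] := by
  intro N
  induction N with
  | zero => intro L h1 h2; omega
  | succ N ih =>
    intro L hN h2 ⟨Φ, S⟩
    obtain ⟨L1, L2, a, rfl⟩ := S.adj' hA O H (by omega)
    have h3 : Stt A (L2 ++ (L1 ++ [a, a.mate.rev])) := Stt.rot ⟨Φ, S⟩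
    rw [← List.append_assoc] at h3
    simp only [List.length_append, List.length_cons, List.length_nil] at hN h2
    by_cases hl : 1 ≤ (L2 ++ L1).length
    · have h4 := h3.fold hl
      by_cases hl2 : 2 ≤ (L2 ++ L1).length
      · exact ih _ (by simp only [List.length_append]; omega) hl2 h4
      · exfalso
        obtain ⟨Φ', S'⟩ := h4
        obtain ⟨M1, M2, b, e⟩ := S'.adj' hA O H (by omega)
        rw [e] at hl2
        simp at hl2
        omega
    · have : L2 ++ L1 = [] := List.eq_nil_of_length_eq_zero (by omega)
      rw [this] at h3
      exact ⟨a, h3⟩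
end

section
variable {D : GlueingDatum 4}

theorem Sp_conj {z : ℂ} (h : ‖z‖ = 1) : Sp ((starRingEnd ℂ) z) = Sp z := by
  have h2 : 1 - z.re ^ 2 - z.im ^ 2 = 0 := by
    have := Complex.normSq_eq_norm_sq z
    rw [h, Complex.normSq_apply] at this
    linarith
  unfold Sp
  simp only [Complex.conj_re, Complex.conj_im]
  rw [neg_sq, h2, Real.sqrt_zero]
  simp

theorem pt_conj (θ : ℝ) : (starRingEnd ℂ) (pt θ) = pt (1 - θ) := by
  apply Complex.ext
  · rw [Complex.conj_re, pt_re, pt_re, mul_sub, mul_one, Real.cos_two_pi_sub]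
  · rw [Complex.conj_im, pt_im, pt_im, mul_sub, mul_one, Real.sin_two_pi_sub]


theorem St.fin_a {A : Set (Tri D)} {a : DS D} {Φ : Tri D → (Fin 5 → ℝ) → ℂ} (S : St A [a, a.mate.rev] Φ) {t : ℝ} (ht : t ∈ Set.Icc (0:ℝ) 1) : Φ a.tri (a.P t) = pt (t / 2) := by
  have := S.bdry 0 a rfl t ht
  simpa using this

theorem St.fin_b {A : Set (Tri D)} {a : DS D} {Φ : Tri D → (Fin 5 → ℝ) → ℂ} (S : St A [a, a.mate.rev] Φ) {t : ℝ} (ht : t ∈ Set.Icc (0:ℝ) 1) : Φ a.mate.tri (a.mate.P t) = pt (1 - t / 2) := by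
  have := S.bdry 1 a.mate.rev rfl (1 - t) (one_sub_mem ht)
  rw [DS.P_rev, sub_sub_cancel, DS.rev_tri] at this
  rw [this]
  congr 1
  simp only [List.length_cons, List.length_nil]
  push_cast
  ring

theorem St.fin_base {A : Set (Tri D)} {a : DS D} {Φ : Tri D → (Fin 5 → ℝ) → ℂ} (S : St A [a, a.mate.rev] Φ) {t : ℝ} (ht : t ∈ Set.Icc (0:ℝ) 1) : Sp (Φ a.tri (a.P t)) = Sp (Φ a.mate.tri (a.mate.P t)) := by
  rw [S.fin_a ht, S.fin_b ht, ← pt_conj, Sp_conj (pt_norm _)]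

theorem St.fin_L {A : Set (Tri D)} {a : DS D} {Φ : Tri D → (Fin 5 → ℝ) → ℂ} (S : St A [a, a.mate.rev] Φ) (δ : DS D) (hδ : δ ∈ [a, a.mate.rev]) {t : ℝ} (ht : t ∈ Set.Icc (0:ℝ) 1) : Sp (Φ δ.tri (δ.P t)) = Sp (Φ δ.mate.tri (δ.mate.P t)) := by
  simp only [List.mem_cons, List.not_mem_nil, or_false] at hδ
  rcases hδ with rfl | rfl
  · exact S.fin_base ht
  · rw [DS.mate_rev, DS.mate_mate, DS.P_rev, DS.P_rev, DS.rev_tri, DS.rev_tri]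
    exact (S.fin_base (one_sub_mem ht)).symm

theorem St.fin_rel {A : Set (Tri D)} {a : DS D} {Φ : Tri D → (Fin 5 → ℝ) → ℂ} (S : St A [a, a.mate.rev] Φ) (δ : DS D) (hδ : δ.tri ∈ A) {t : ℝ} (ht : t ∈ Set.Icc (0:ℝ) 1) : Sp (Φ δ.tri (δ.P t)) = Sp (Φ δ.mate.tri (δ.mate.P t)) := by
  rcases S.complete δ hδ with h | h | h
  · exact S.fin_L δ h ht
  · have := S.fin_L _ h (one_sub_mem ht)
    rwa [DS.mate_rev, DS.P_rev, DS.P_rev, sub_sub_cancel, DS.rev_tri, DS.rev_tri] at this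
  · rw [h.2 t ht]

theorem St.fin_q {A : Set (Tri D)} {a : DS D} {Φ : Tri D → (Fin 5 → ℝ) → ℂ} (S : St A [a, a.mate.rev] Φ) {q : ℂ → SurfSpace D} (hA : MC A) (hq : ∀ τ ∈ A, ∀ x ∈ labS τ.2.1, q (Φ τ x) = mkS D τ x) {θ : ℝ} (h : θ ∈ Set.Icc (0:ℝ) 1) :
    q (pt θ) = q (pt (1 - θ)) := by
  have haA : a.tri ∈ A := S.inA a (by simp)
  have key : ∀ θ ∈ Set.Icc (0:ℝ) (1/2), q (pt θ) = q (pt (1 - θ)) := by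
    intro θ h
    have ht : 2 * θ ∈ Set.Icc (0:ℝ) 1 := ⟨by linarith [h.1], by linarith [h.2]⟩
    have e1 := S.fin_a ht
    have e2 := S.fin_b ht
    rw [mul_div_cancel_left₀ _ (two_ne_zero)] at e1 e2
    rw [← e1, ← e2, hq _ haA _ (a.P_mem ht), hq _ (hA _ haA) _ (a.mate.P_mem ht), a.mate_mkS ht]
  rcases le_total θ (1/2) with h1 | h1
  · exact key θ ⟨h.1, h1⟩
  · have := key (1 - θ) ⟨by linarith [h.2], by linarith⟩
    rw [sub_sub_cancel] at this
    exact this.symm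

theorem MC.clopen {A : Set (Tri D)} (hA : MC A) : IsClopen {z : SurfSpace D | ∃ τ ∈ A, ∃ x ∈ labS τ.2.1, z = mkS D τ x} := by
  have key : ∀ {p q : SurfTotal D}, Quot.mk (surfRel D) p = Quot.mk (surfRel D) q → (p.1 ∈ A ↔ q.1 ∈ A) :=
    eqvGen_prop (fun p q : SurfTotal D => p.1 ∈ A ↔ q.1 ∈ A) (fun _ _ h => hA.rel h) (fun _ => Iff.rfl) (fun _ _ h => h.symm) (fun _ _ _ h h' => h.trans h')
  have e : (Quot.mk (surfRel D)) ⁻¹' {z : SurfSpace D | ∃ τ ∈ A, ∃ x ∈ labS τ.2.1, z = mkS D τ x} = {p : SurfTotal D | p.1 ∈ A} := by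
    ext p; constructor
    · rintro ⟨τ, hτ, x, hx, h⟩
      rw [mkS_mem hx] at h
      exact (key h).2 hτ
    · intro hp
      exact ⟨p.1, hp, p.2.1, p.2.2, by rw [mkS_mem p.2.2]⟩
  rw [← isQuotientMap_quot_mk.isClopen_preimage, e]
  exact KA_clopen A

theorem terminal {A : Set (Tri D)} {a : DS D} {Φ : Tri D → (Fin 5 → ℝ) → ℂ} (S : St A [a, a.mate.rev] Φ) (hA : MC A)
    (z : SurfSpace D) (hz : ∃ τ ∈ A, ∃ x ∈ labS τ.2.1, z = mkS D τ x) :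
    Nonempty (↥(connectedComponent z) ≃ₜ ↥(Metric.sphere (0 : EuclideanSpace ℝ (Fin 3)) 1)) := by
  obtain ⟨q, hqc, hq1, hq2⟩ := S.ex_q
  set C : Set (SurfSpace D) := {z : SurfSpace D | ∃ τ ∈ A, ∃ x ∈ labS τ.2.1, z = mkS D τ x} with hC
  have hCq : C = q '' BB := by
    ext w; constructor
    · rintro ⟨τ, hτ, x, hx, rfl⟩
      exact ⟨Φ τ x, S.maps τ hτ x hx, hq2 τ hτ x hx⟩
    · rintro ⟨u, hu, rfl⟩
      obtain ⟨τ, hτ, x, hx, -, e⟩ := hq1 u hu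
      exact ⟨τ, hτ, x, hx, e⟩
  have hconn : IsPreconnected C := by
    rw [hCq]
    exact (convex_closedBall (0:ℂ) 1).isPreconnected.image q hqc
  have hcl := hA.clopen
  have hCC : connectedComponent z = C :=
    Set.Subset.antisymm (hcl.connectedComponent_subset hz) (hconn.subset_connectedComponent hz)
  rw [hCC]
  let gT : SurfTotal D → EuclideanSpace ℝ (Fin 3) := fun p => if p.1 ∈ A then WithLp.toLp 2 (Sp (Φ p.1 p.2.1)) else 0
  have grel : ∀ p q, surfRel D p q → gT p = gT q := by
    intro p q h
    have hm := hA.rel h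
    by_cases hp : p.1 ∈ A
    · obtain ⟨δ, t, ht, h1, h2, h3, h4⟩ := DS.rel p q h
      simp only [gT, hp, hm.1 hp, if_true]
      have h5 := S.fin_rel δ (h1 ▸ hp) ht
      rw [h2, h4, h1, h3] at h5
      rw [h5]
    · simp only [gT, hp, mt hm.2 hp, if_false]
  let g : SurfSpace D → EuclideanSpace ℝ (Fin 3) := Quot.lift gT grel
  have gc : Continuous g := by
    refine continuous_quot_lift _ ?_
    refine continuous_sigma fun τ => ?_
    by_cases hτ : τ ∈ A
    · simp only [gT, hτ, if_true]
      have : Continuous fun x : labS τ.2.1 => Φ τ x.1 := continuousOn_iff_continuous_domRestrict.1 (S.cont τ hτ)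
      exact (PiLp.continuous_toLp 2 _).comp (Sp_cont.comp this)
    · simp only [gT, hτ, if_false]; exact continuous_const
  have gmk : ∀ τ ∈ A, ∀ x ∈ labS τ.2.1, g (mkS D τ x) = WithLp.toLp 2 (Sp (Φ τ x)) := by
    intro τ hτ x hx
    rw [mkS_mem hx]
    show gT _ = _
    simp only [gT, hτ, if_true]
  have gs : ∀ w ∈ C, g w ∈ Metric.sphere (0 : EuclideanSpace ℝ (Fin 3)) 1 := by
    rintro w ⟨τ, hτ, x, hx, rfl⟩
    rw [gmk τ hτ x hx, mem_sphere_zero_iff_norm, EuclideanSpace.norm_eq]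
    simp only [Real.norm_eq_abs, sq_abs]
    rw [Sp_norm (S.maps τ hτ x hx), Real.sqrt_one]
  let F : C → Metric.sphere (0 : EuclideanSpace ℝ (Fin 3)) 1 := fun w => ⟨g w.1, gs w.1 w.2⟩
  have Fc : Continuous F := Continuous.subtype_mk (gc.comp continuous_subtype_val) _
  have Finj : Function.Injective F := by
    rintro ⟨w, τ, hτ, x, hx, rfl⟩ ⟨w', τ', hτ', x', hx', rfl⟩ h
    have h1 : g (mkS D τ x) = g (mkS D τ' x') := congrArg Subtype.val h
    rw [gmk τ hτ x hx, gmk τ' hτ' x' hx'] at h1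
    have h2 : Sp (Φ τ x) = Sp (Φ τ' x') := congrArg WithLp.ofLp h1
    apply Subtype.ext
    show mkS D τ x = mkS D τ' x'
    rw [← hq2 τ hτ x hx, ← hq2 τ' hτ' x' hx']
    rcases Sp_inj (S.maps τ hτ x hx) (S.maps τ' hτ' x' hx') h2 with e | ⟨e, e'⟩
    · rw [e]
    · rw [e']
      have e1 := th_eq (Φ τ x)
      rw [e, Complex.ofReal_one, one_mul] at e1
      rw [e1, pt_conj]
      exact S.fin_q hA hq2 (ico_icc (th_mem _))
  have Fsurj : Function.Surjective F := by
    rintro ⟨y, hy⟩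
    rw [mem_sphere_zero_iff_norm, EuclideanSpace.norm_eq, Real.sqrt_eq_one] at hy
    simp only [Real.norm_eq_abs, sq_abs] at hy
    obtain ⟨u, hu, e⟩ := Sp_surj (fun i => y i) hy
    obtain ⟨τ, hτ, x, hx, e1⟩ := S.surj u hu
    refine ⟨⟨mkS D τ x, τ, hτ, x, hx, rfl⟩, Subtype.ext ?_⟩
    show g (mkS D τ x) = y
    rw [gmk τ hτ x hx, e1, e]
  haveI := surfCompact (D := D)
  haveI : CompactSpace C := isCompact_iff_compactSpace.1 hcl.isClosed.isCompact
  exact ⟨Continuous.homeoOfEquivCompactToT2 (f := Equiv.ofBijective F ⟨Finj, Fsurj⟩) Fc⟩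

theorem two_out : ∀ (s : Finset (Fin 5)), s.card = 2 → ∃ c d : Fin 5, c ∉ s ∧ d ∉ s ∧ c ≠ d := by decide

theorem surf_of_euclid (O : DD D) (H : Euclid D) : Surf D := by
  intro z
  induction z using surf_ind with
  | h τ x hx =>
    obtain ⟨c, d, hc, hd, hcd⟩ := two_out τ.2.1 τ.2.2
    let δ : DS D := ⟨τ, c, d, hc, hd, hcd⟩
    obtain ⟨A, L, hS, hL, hτ, hall⟩ := phase1 _ _ _ le_rfl (by simp) (Stt.start δ) τ (Set.mem_singleton _)
    have hA : MC A := by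
      obtain ⟨Φ, S⟩ := hS
      intro η hη
      rcases S.complete η hη with h | h | h
      · exact hall _ h
      · have := hall _ h
        rwa [DS.mate_rev, DS.rev_tri] at this
      · exact h.1
    obtain ⟨a, Φ, S⟩ := reduce hA O H _ L le_rfl hL hS
    exact terminal S hA _ ⟨τ, hτ, x, hx, rfl⟩

theorem backward (H : Euclid D) : Dir D ∧ Surf D := by
  have hD := dir_of_euclid H
  refine ⟨hD, ?_⟩
  obtain ⟨o, o1, o2⟩ := hD
  exact surf_of_euclid ⟨o, o1, o2⟩ H
end

/-- Proposition: conditions Dir and Surf jointly hold if and only if the image in `X`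
of the midpoint of every edge of every 4-simplex has an open neighborhood homeomorphic
to `ℝ⁴`. -/
theorem dir_and_surf_iff_edge_midpoints_euclidean (D : GlueingDatum 4) :
    (Dir D ∧ Surf D) ↔
      ∀ (i : D.I) (s : Finset (Fin 5)) (hs : s.card = 2),
        ∃ U : Set (GlueSpace D), IsOpen U ∧
          Quot.mk (glueRel D) ⟨i, edgeMidpoint s hs⟩ ∈ U ∧
          Nonempty (↥U ≃ₜ EuclideanSpace ℝ (Fin 4)) := by
  exact ⟨fun h => forward h.1 h.2, fun H => backward H⟩
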